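/- arXiv:1806.03326 — 3 statements merged into one kernel-verified Lean document; each statement's English description precedes it below -/
import Mathlib

section
/- Let n > 2, x₀ ∈ ℝⁿ, R > 0, and let f : ℝⁿ → ℝ^k (k ≥ 1) be measurable. Then there is a constant c depending only on n such that the modified Riesz potential satisfies P₁^f(x₀,R) ≤ c · ∫₀^∞ |{x ∈ B_{2R}(x₀) : |f(x)| > λ}|^{1/n} dλ. In particular, if f ∈ L(n,1)(B_{2R}(x₀)) then P₁^f(x₀,R) is finite, and ‖P₁^f(·,R)‖_{L^∞(B)} ≤ c‖f‖_{L(n,1)(B_{2R})} for every ball B of radius R. -/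
open MeasureTheory Set Metric
open scoped ENNReal NNReal
noncomputable section

/-- The modified Riesz potential
`P₁^f(x₀,R) = ∫₀^R (ϱ² ⨍_{B_ϱ(x₀)} |f|² dx)^{1/2} dϱ/ϱ`. -/
def modRieszPot {n k : ℕ} (f : EuclideanSpace ℝ (Fin n) → EuclideanSpace ℝ (Fin k))
    (x₀ : EuclideanSpace ℝ (Fin n)) (R : ℝ) : ℝ≥0∞ :=
  ∫⁻ ρ in Ioo (0:ℝ) R,
    (ENNReal.ofReal (ρ ^ 2) *
        ((∫⁻ x in ball x₀ ρ, (‖f x‖₊ : ℝ≥0∞) ^ 2) / volume (ball x₀ ρ))) ^ (1/2 : ℝ) /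
      ENNReal.ofReal ρ

/-- The Lorentz `L(n,1)`-functional `‖f‖_{L(n,1)(Ω)} = ∫₀^∞ |{x ∈ Ω : |f(x)| > λ}|^{1/n} dλ`. -/
def lorentzNorm {n k : ℕ} (Ω : Set (EuclideanSpace ℝ (Fin n)))
    (f : EuclideanSpace ℝ (Fin n) → EuclideanSpace ℝ (Fin k)) : ℝ≥0∞ :=
  ∫⁻ lam in Ioi (0:ℝ), (volume {x | x ∈ Ω ∧ lam < ‖f x‖}) ^ (1 / (n : ℝ))

/-- The `L²` norm is bounded by the integral of the square root of the distribution function. -/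
theorem lintegral_sq_le_lintegral_meas_lt_rpow {α : Type*} [MeasurableSpace α] (ν : Measure α)
    {g : α → ℝ≥0} (hg : Measurable g) :
    ∫⁻ x, (g x : ℝ≥0∞) ^ 2 ∂ν ≤
      (∫⁻ s in Ioi (0:ℝ), ν {x | s < g x} ^ (1 / 2 : ℝ)) ^ 2 := by
  have layer (κ : Measure α) :
      ∫⁻ x, (g x : ℝ≥0∞) ∂κ = ∫⁻ s in Ioi (0:ℝ), κ {x | s < g x} := by
    simpa using lintegral_eq_lintegral_meas_lt κ (f := fun x ↦ (g x : ℝ))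
      (.of_forall fun x ↦ (g x).2) hg.coe_nnreal_real.aemeasurable
  have hA (s : ℝ) : MeasurableSet {x | s < g x} :=
    measurableSet_lt measurable_const hg.coe_nnreal_real
  have hmin (s t : ℝ) : ν ({x | t < g x} ∩ {x | s < g x}) ≤
      ν {x | s < g x} ^ (1 / 2 : ℝ) * ν {x | t < g x} ^ (1 / 2 : ℝ) := by
    calc ν ({x | t < g x} ∩ {x | s < g x})
        = ν ({x | t < g x} ∩ {x | s < g x}) ^ (1 / 2 : ℝ) *
          ν ({x | t < g x} ∩ {x | s < g x}) ^ (1 / 2 : ℝ) := by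
          rw [← ENNReal.rpow_add_of_nonneg _ _ (by norm_num) (by norm_num)]; norm_num
      _ ≤ _ := by gcongr; exacts [inter_subset_right, inter_subset_left]
  have hmeas : Measurable fun s : ℝ ↦ ν {x | s < g x} ^ (1 / 2 : ℝ) :=
    (Antitone.measurable fun s t hst ↦ by gcongr).pow_const _
  calc ∫⁻ x, (g x : ℝ≥0∞) ^ 2 ∂ν
      = ∫⁻ x, (g x : ℝ≥0∞) ∂(ν.withDensity fun x ↦ (g x : ℝ≥0∞)) := by
        rw [lintegral_withDensity_eq_lintegral_mul _ hg.coe_nnreal_ennreal hg.coe_nnreal_ennreal]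
        simp [sq]
    _ = ∫⁻ s in Ioi (0:ℝ), ∫⁻ t in Ioi (0:ℝ), ν ({x | t < g x} ∩ {x | s < g x}) := by
        simp_rw [layer, withDensity_apply _ (hA _), layer, Measure.restrict_apply (hA _)]
    _ ≤ ∫⁻ s in Ioi (0:ℝ), ∫⁻ t in Ioi (0:ℝ),
          ν {x | s < g x} ^ (1 / 2 : ℝ) * ν {x | t < g x} ^ (1 / 2 : ℝ) := by
        gcongr with s t; exact hmin s t
    _ = _ := by
        simp_rw [lintegral_const_mul _ hmeas, lintegral_mul_const _ hmeas, sq]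

theorem lintegral_Ioi_min_one_rpow_le {p r : ℝ} (hp : 1 < p) (hr : 0 ≤ r) :
    ∫⁻ ρ in Ioi (0:ℝ), min 1 (ENNReal.ofReal (r ^ p * ρ ^ (-p))) ≤
      ENNReal.ofReal (p / (p - 1) * r) := by
  rcases hr.eq_or_lt with rfl | hr
  · simp [Real.zero_rpow (by linarith : p ≠ 0)]
  have hint : ∫⁻ ρ in Ioi r, ENNReal.ofReal (r ^ p * ρ ^ (-p)) =
      ENNReal.ofReal (r / (p - 1)) := by
    rw [← ofReal_integral_eq_lintegral_ofReal, integral_const_mul,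
      integral_Ioi_rpow_of_lt (by linarith) hr]
    · congr 1
      rw [Real.rpow_add hr, Real.rpow_neg hr.le, Real.rpow_one]
      have := (Real.rpow_pos_of_pos hr p).ne'
      have h1 : p - 1 ≠ 0 := by linarith
      have h2 : -p + 1 ≠ 0 := by linarith
      field_simp
      ring
    · exact (integrableOn_Ioi_rpow_of_lt (by linarith) hr).const_mul _
    · filter_upwards [ae_restrict_mem measurableSet_Ioi] with ρ hρ
      have : 0 < ρ := hr.trans hρ
      simp only [Pi.zero_apply]
      positivity
  rw [← Ioc_union_Ioi_eq_Ioi hr.le]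
  calc _ ≤ (∫⁻ ρ in Ioc 0 r, min 1 (ENNReal.ofReal (r ^ p * ρ ^ (-p)))) +
        ∫⁻ ρ in Ioi r, min 1 (ENNReal.ofReal (r ^ p * ρ ^ (-p))) := lintegral_union_le _ _ _
    _ ≤ (∫⁻ _ in Ioc 0 r, 1) + ∫⁻ ρ in Ioi r, ENNReal.ofReal (r ^ p * ρ ^ (-p)) := by
        gcongr
        exacts [min_le_left _ _, min_le_right _ _]
    _ = ENNReal.ofReal (p / (p - 1) * r) := by
        rw [hint, setLIntegral_one, Real.volume_Ioc, ← ENNReal.ofReal_add (by linarith)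
          (div_nonneg hr.le (by linarith))]
        congr 1
        have h1 : p - 1 ≠ 0 := by linarith
        field_simp
        ring

theorem lintegral_min_volume_ball_le {n : ℕ} (hn : 2 < n) (x₀ : EuclideanSpace ℝ (Fin n))
    {M : ℝ≥0∞} (hM : M ≠ ⊤) :
    ∫⁻ ρ in Ioi (0:ℝ), min 1 (M / volume (ball x₀ ρ)) ^ (1 / 2 : ℝ) ≤
      ENNReal.ofReal (n / (n - 2)) *
        (volume (ball (0 : EuclideanSpace ℝ (Fin n)) 1))⁻¹ ^ (1 / (n : ℝ)) *
        M ^ (1 / (n : ℝ)) := by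
  have hn' : (2:ℝ) < n := by exact_mod_cast hn
  have hn0 : (n:ℝ) ≠ 0 := by linarith
  set ω := volume (ball (0 : EuclideanSpace ℝ (Fin n)) 1)
  have hω0 : ω ≠ 0 := (measure_ball_pos volume _ one_pos).ne'
  have hωt : ω ≠ ⊤ := measure_ball_lt_top.ne
  have hMω : ω⁻¹ * M ≠ ⊤ := ENNReal.mul_ne_top (by simpa) hM
  set m := (ω⁻¹ * M).toReal
  have hm0 : 0 ≤ m := ENNReal.toReal_nonneg
  have hmM : ω⁻¹ * M = ENNReal.ofReal m := (ENNReal.ofReal_toReal hMω).symm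
  have key {ρ : ℝ} (hρ : 0 < ρ) : min 1 (M / volume (ball x₀ ρ)) ^ (1 / 2 : ℝ) =
      min 1 (ENNReal.ofReal ((m ^ (1 / (n:ℝ))) ^ ((n:ℝ) / 2) * ρ ^ (-((n:ℝ) / 2)))) := by
    rw [(ENNReal.monotone_rpow_of_nonneg (by norm_num : (0:ℝ) ≤ 1 / 2)).map_min,
      ENNReal.one_rpow, Measure.addHaar_ball_of_pos _ _ hρ, finrank_euclideanSpace_fin,
      ENNReal.div_eq_inv_mul, ENNReal.mul_inv (by right; exact hωt) (by right; exact hω0),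
      mul_assoc, hmM, ← ENNReal.ofReal_inv_of_pos (by positivity),
      ← ENNReal.ofReal_mul (by positivity), ENNReal.ofReal_rpow_of_nonneg (by positivity)
      (by norm_num)]
    congr 2
    rw [Real.mul_rpow (by positivity) hm0, ← Real.rpow_mul hm0, mul_comm, Real.rpow_neg hρ.le,
      Real.inv_rpow (by positivity), ← Real.rpow_natCast, ← Real.rpow_mul hρ.le]
    congr 2
    · field_simp
    · congr 1; ring
  rw [setLIntegral_congr_fun measurableSet_Ioi fun ρ hρ ↦ key hρ]
  refine (lintegral_Ioi_min_one_rpow_le (by linarith) (by positivity)).trans_eq ?_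
  rw [mul_assoc, ← ENNReal.mul_rpow_of_nonneg _ _ (by positivity), hmM,
    ENNReal.ofReal_rpow_of_nonneg hm0 (by positivity), ← ENNReal.ofReal_mul
    (div_nonneg (by linarith) (by linarith))]
  congr 2
  have h1 : (n:ℝ) - 2 ≠ 0 := by linarith
  have h2 : (n:ℝ) / 2 - 1 ≠ 0 := by linarith
  field_simp

theorem modRieszPot_integrand_le {n k : ℕ}
    {f : EuclideanSpace ℝ (Fin n) → EuclideanSpace ℝ (Fin k)} (hf : Measurable f)
    (x₀ : EuclideanSpace ℝ (Fin n)) {ρ R : ℝ} (hρ : 0 < ρ) (hρR : ρ ≤ R) :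
    (ENNReal.ofReal (ρ ^ 2) *
        ((∫⁻ x in ball x₀ ρ, (‖f x‖₊ : ℝ≥0∞) ^ 2) / volume (ball x₀ ρ))) ^ (1 / 2 : ℝ) /
      ENNReal.ofReal ρ ≤
    ∫⁻ s in Ioi (0:ℝ),
      min 1 (volume {x | x ∈ ball x₀ R ∧ s < ‖f x‖} / volume (ball x₀ ρ)) ^ (1 / 2 : ℝ) := by
  have hV0 : volume (ball x₀ ρ) ≠ 0 := (measure_ball_pos volume _ hρ).ne'
  have hVt : volume (ball x₀ ρ) ≠ ⊤ := measure_ball_lt_top.ne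
  have hρ0 : ENNReal.ofReal ρ ≠ 0 := by simpa using hρ
  have hsq (a : ℝ≥0∞) : (a ^ 2) ^ (1 / 2 : ℝ) = a := by
    rw [← ENNReal.rpow_natCast, ← ENNReal.rpow_mul]; norm_num
  rw [ENNReal.mul_rpow_of_nonneg _ _ (by norm_num), ENNReal.ofReal_pow hρ.le, hsq, mul_comm,
    ENNReal.mul_div_cancel_right hρ0 ENNReal.ofReal_ne_top]
  calc _ ≤ ((∫⁻ s in Ioi (0:ℝ),
          volume.restrict (ball x₀ ρ) {x | s < ‖f x‖₊} ^ (1 / 2 : ℝ)) ^ 2 /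
            volume (ball x₀ ρ)) ^ (1 / 2 : ℝ) := by
        gcongr
        exact lintegral_sq_le_lintegral_meas_lt_rpow _ hf.nnnorm
    _ = ∫⁻ s in Ioi (0:ℝ), (volume.restrict (ball x₀ ρ) {x | s < ‖f x‖₊} /
          volume (ball x₀ ρ)) ^ (1 / 2 : ℝ) := by
        simp_rw [ENNReal.div_rpow_of_nonneg _ _ (by norm_num : (0:ℝ) ≤ 1 / 2), hsq,
          div_eq_mul_inv]
        rw [lintegral_mul_const']
        simp [hV0]
    _ ≤ _ := by
        gcongr with s
        have hs : MeasurableSet {x | s < ‖f x‖₊} :=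
          measurableSet_lt measurable_const hf.nnnorm.coe_nnreal_real
        rw [Measure.restrict_apply hs]
        refine le_min (ENNReal.div_le_of_le_mul ?_) ?_
        · rw [one_mul]; exact measure_mono inter_subset_right
        · gcongr
          exact fun x hx ↦ ⟨ball_subset_ball hρR hx.2, hx.1⟩

theorem lorentzNorm_mono {n k : ℕ} {Ω Ω' : Set (EuclideanSpace ℝ (Fin n))} (h : Ω ⊆ Ω')
    (f : EuclideanSpace ℝ (Fin n) → EuclideanSpace ℝ (Fin k)) :
    lorentzNorm Ω f ≤ lorentzNorm Ω' f := by
  unfold lorentzNorm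
  gcongr with s x

theorem modRieszPot_le_lorentzNorm_ball {n k : ℕ} (hn : 2 < n)
    {f : EuclideanSpace ℝ (Fin n) → EuclideanSpace ℝ (Fin k)} (hf : Measurable f)
    (x₀ : EuclideanSpace ℝ (Fin n)) (R : ℝ) :
    modRieszPot f x₀ R ≤ ENNReal.ofReal (n / (n - 2)) *
        (volume (ball (0 : EuclideanSpace ℝ (Fin n)) 1))⁻¹ ^ (1 / (n : ℝ)) *
        lorentzNorm (ball x₀ R) f := by
  set μ : ℝ → ℝ≥0∞ := fun s ↦ volume {x | x ∈ ball x₀ R ∧ s < ‖f x‖}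
  have hμt (s : ℝ) : μ s ≠ ⊤ :=
    ((measure_mono fun x hx ↦ hx.1).trans_lt (measure_ball_lt_top (x := x₀) (r := R))).ne
  have hμm : Measurable μ := Antitone.measurable fun s t hst ↦
    measure_mono fun x hx ↦ ⟨hx.1, hst.trans_lt hx.2⟩
  have hVm : Measurable fun ρ ↦ volume (ball x₀ ρ) :=
    Monotone.measurable fun s t hst ↦ measure_mono (ball_subset_ball hst)
  calc modRieszPot f x₀ R
      ≤ ∫⁻ ρ in Ioo 0 R, ∫⁻ s in Ioi (0:ℝ), min 1 (μ s / volume (ball x₀ ρ)) ^ (1 / 2 : ℝ) :=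
        setLIntegral_mono' measurableSet_Ioo fun ρ hρ ↦
          modRieszPot_integrand_le hf x₀ hρ.1 hρ.2.le
    _ ≤ ∫⁻ ρ in Ioi 0, ∫⁻ s in Ioi (0:ℝ), min 1 (μ s / volume (ball x₀ ρ)) ^ (1 / 2 : ℝ) :=
        lintegral_mono_set Ioo_subset_Ioi_self
    _ = ∫⁻ s in Ioi (0:ℝ), ∫⁻ ρ in Ioi 0, min 1 (μ s / volume (ball x₀ ρ)) ^ (1 / 2 : ℝ) :=
        lintegral_lintegral_swap <| Measurable.aemeasurable <| (measurable_const.min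
          ((hμm.comp measurable_snd).div (hVm.comp measurable_fst))).pow_const _
    _ ≤ ∫⁻ s in Ioi (0:ℝ), ENNReal.ofReal (n / (n - 2)) *
        (volume (ball (0 : EuclideanSpace ℝ (Fin n)) 1))⁻¹ ^ (1 / (n : ℝ)) *
          μ s ^ (1 / (n : ℝ)) :=
        lintegral_mono fun s ↦ lintegral_min_volume_ball_le hn x₀ (hμt s)
    _ = _ := lintegral_const_mul _ (hμm.pow_const _)

/-- For `n > 2` the modified Riesz potential is controlled, with a constant
depending only on `n`, by the Lorentz `L(n,1)`-functional on the doubled ball: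
`P₁^f(x₀,R) ≤ c‖f‖_{L(n,1)(B_{2R}(x₀))}`; in particular `P₁^f(x₀,R)` is finite whenever
`f ∈ L(n,1)(B_{2R}(x₀))`, and `‖P₁^f(·,R)‖_{L^∞(B)} ≤ c‖f‖_{L(n,1)(B_{2R})}` for every ball
`B` of radius `R`. -/
theorem modRieszPot_le_lorentz (n k : ℕ) (hn : 2 < n) (hk : 1 ≤ k) :
    ∃ c : ℝ≥0∞, c ≠ ⊤ ∧
      ∀ (f : EuclideanSpace ℝ (Fin n) → EuclideanSpace ℝ (Fin k)), Measurable f →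
      ∀ (x₀ : EuclideanSpace ℝ (Fin n)) (R : ℝ), 0 < R →
        (modRieszPot f x₀ R ≤ c * lorentzNorm (ball x₀ (2 * R)) f ∧
          (lorentzNorm (ball x₀ (2 * R)) f < ⊤ → modRieszPot f x₀ R < ⊤) ∧
          ∀ y : EuclideanSpace ℝ (Fin n), x₀ ∈ ball y R →
            modRieszPot f x₀ R ≤ c * lorentzNorm (ball y (2 * R)) f) := by
  set c : ℝ≥0∞ := ENNReal.ofReal (n / (n - 2)) *
    (volume (ball (0 : EuclideanSpace ℝ (Fin n)) 1))⁻¹ ^ (1 / (n : ℝ))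
  have hct : c ≠ ⊤ := ENNReal.mul_ne_top ENNReal.ofReal_ne_top <|
    ENNReal.rpow_ne_top_of_nonneg (by positivity) <|
      ENNReal.inv_ne_top.2 (measure_ball_pos volume _ one_pos).ne'
  refine ⟨c, hct, fun f hf x₀ R hR ↦ ?_⟩
  have bound (y : EuclideanSpace ℝ (Fin n)) (hy : x₀ ∈ ball y R) :
      modRieszPot f x₀ R ≤ c * lorentzNorm (ball y (2 * R)) f := by
    refine (modRieszPot_le_lorentzNorm_ball hn hf x₀ R).trans ?_
    gcongr
    refine lorentzNorm_mono (ball_subset_ball' ?_) f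
    linarith [mem_ball.1 hy]
  exact ⟨bound x₀ (mem_ball_self hR),
    fun h ↦ (bound x₀ (mem_ball_self hR)).trans_lt (ENNReal.mul_lt_top hct.lt_top h), bound⟩
end
end

section
/- Let n = 2, x₀ ∈ ℝ², R > 0, α > 2, and let f : ℝ² → ℝ^k (k ≥ 1) be measurable with ∫_{B_{2R}(x₀)} |f|² log^α(e + |f|) dx < ∞. Then the modified Riesz potential is finite: P₁^f(x₀,R) := ∫₀^R (ϱ² ⨍_{B_ϱ(x₀)} |f|² dx)^{1/2} dϱ/ϱ < ∞. -/
open MeasureTheory Set Metric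
open scoped ENNReal NNReal
noncomputable section

/-- Splitting at a threshold `t`: a square is controlled by `t ^ 2` plus its logarithmically
weighted version, normalised at the threshold. -/
theorem sq_le_sq_add_mul_log_rpow {y t α : ℝ} (hy : 0 ≤ y) (ht : 0 ≤ t) (hα : 0 ≤ α) :
    y ^ 2 ≤ t ^ 2 + y ^ 2 * Real.log (Real.exp 1 + y) ^ α *
      (Real.log (Real.exp 1 + t) ^ α)⁻¹ := by
  have one_le_log : ∀ s : ℝ, 0 ≤ s → 1 ≤ Real.log (Real.exp 1 + s) := fun s hs => by
    rw [Real.le_log_iff_exp_le (by positivity)]; linarith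
  have hLy := one_le_log y hy
  have hLt := one_le_log t ht
  have hLt' : 0 < Real.log (Real.exp 1 + t) ^ α := Real.rpow_pos_of_pos (by linarith) _
  have hLy' : 0 < Real.log (Real.exp 1 + y) ^ α := Real.rpow_pos_of_pos (by linarith) _
  rcases le_total y t with h | h
  · have : 0 ≤ y ^ 2 * Real.log (Real.exp 1 + y) ^ α * (Real.log (Real.exp 1 + t) ^ α)⁻¹ := by
      positivity
    nlinarith
  · have hle : Real.log (Real.exp 1 + t) ^ α ≤ Real.log (Real.exp 1 + y) ^ α := by
      refine Real.rpow_le_rpow (by linarith) ?_ hα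
      exact Real.log_le_log (by positivity) (by linarith)
    have : 1 ≤ Real.log (Real.exp 1 + y) ^ α * (Real.log (Real.exp 1 + t) ^ α)⁻¹ := by
      rw [← div_eq_mul_inv]; exact (one_le_div hLt').2 hle
    rw [mul_assoc]
    nlinarith [sq_nonneg y, sq_nonneg t]

/-- `1 / (ρ log^β (e + ρ^{-1/2}))` is integrable near the origin when `β > 1`. -/
theorem integrableOn_inv_log_rpow_div {β R : ℝ} (hβ : 1 < β) (hR : 0 < R) :
    IntegrableOn (fun ρ : ℝ => (Real.log (Real.exp 1 + (√ρ)⁻¹) ^ β)⁻¹ / ρ) (Ioo 0 R) := by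
  set F : ℝ → ℝ := fun ρ => Real.log (Real.exp 1 + (√ρ)⁻¹) ^ (1 - β) with hF
  set F' : ℝ → ℝ := fun ρ => (β - 1) / 2 / (Real.exp 1 * √ρ + 1) *
    ((Real.log (Real.exp 1 + (√ρ)⁻¹) ^ β)⁻¹ / ρ) with hF'
  have log_pos : ∀ ρ : ℝ, 0 < Real.log (Real.exp 1 + (√ρ)⁻¹) := fun ρ => by
    have : 1 ≤ Real.log (Real.exp 1 + (√ρ)⁻¹) := by
      rw [Real.le_log_iff_exp_le (by positivity)]
      linarith [inv_nonneg.2 (Real.sqrt_nonneg ρ)]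
    linarith
  have hderiv : ∀ ρ, 0 < ρ → HasDerivAt F (F' ρ) ρ := fun ρ hρ => by
    have hs : 0 < √ρ := Real.sqrt_pos.2 hρ
    have h := ((((Real.hasDerivAt_sqrt hρ.ne').inv hs.ne').const_add (Real.exp 1)).log
      (add_pos (Real.exp_pos 1) (inv_pos.2 hs)).ne').rpow_const (p := 1 - β) (Or.inl (log_pos ρ).ne')
    refine h.congr_deriv ?_
    have hrpow : Real.log (Real.exp 1 + (√ρ)⁻¹) ^ (1 - β - 1) =
        (Real.log (Real.exp 1 + (√ρ)⁻¹) ^ β)⁻¹ := by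
      rw [← Real.rpow_neg (log_pos ρ).le]; congr 1; ring
    have hsq : √ρ ^ 2 = ρ := Real.sq_sqrt hρ.le
    simp only [hF', Pi.inv_apply]
    rw [hrpow, ← hsq, Real.sqrt_sq hs.le]
    have := (Real.rpow_pos_of_pos (log_pos ρ) β).ne'
    field_simp
    ring
  have hlim : Filter.Tendsto F (nhdsWithin 0 (Ioi 0)) (nhds 0) := by
    have hsqrt : Filter.Tendsto Real.sqrt (nhdsWithin 0 (Ioi 0)) (nhdsWithin 0 (Ioi 0)) := by
      refine tendsto_nhdsWithin_iff.2 ⟨?_, ?_⟩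
      · simpa using (Real.continuous_sqrt.tendsto 0).mono_left nhdsWithin_le_nhds
      · filter_upwards [self_mem_nhdsWithin] with x hx using Real.sqrt_pos.2 hx
    have hlog := Real.tendsto_log_atTop.comp
      (Filter.tendsto_atTop_add_const_left _ (Real.exp 1) (tendsto_inv_nhdsGT_zero.comp hsqrt))
    have := (tendsto_rpow_neg_atTop (sub_pos.2 hβ)).comp hlog
    simpa [hF, Function.comp_def] using this
  have hupd : ContinuousOn (Function.update F 0 0) (Icc 0 R) := by
    intro x hx
    rcases hx.1.eq_or_lt with rfl | h0
    · rw [continuousWithinAt_update_same]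
      exact hlim.mono_left (nhdsWithin_mono _ fun y hy => lt_of_le_of_ne hy.1.1 (Ne.symm hy.2))
    · exact ((continuousAt_update_of_ne h0.ne').2
        (hderiv x h0).continuousAt).continuousWithinAt
  have hF_int : IntegrableOn F' (Ioc 0 R) := by
    refine intervalIntegral.integrableOn_deriv_of_nonneg hupd
      (fun x hx => ?_) (fun x hx => ?_)
    · refine (hderiv x hx.1).congr_of_eventuallyEq ?_
      filter_upwards [isOpen_ne.mem_nhds hx.1.ne'] with y hy
      exact Function.update_of_ne hy _ _
    · have := Real.rpow_pos_of_pos (log_pos x) β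
      have := hx.1
      have := sub_pos.2 hβ
      positivity
  refine ((hF_int.mono_set Ioo_subset_Ioc_self).const_mul
    ((β - 1) / 2 / (Real.exp 1 * √R + 1))⁻¹).mono' ?_ ?_
  · exact Measurable.aestronglyMeasurable (by fun_prop)
  · filter_upwards [ae_restrict_mem measurableSet_Ioo] with ρ hρ
    have hL := Real.rpow_pos_of_pos (log_pos ρ) β
    have h0 := hρ.1
    have hβ' := sub_pos.2 hβ
    rw [Real.norm_of_nonneg (by positivity)]
    simp only [hF']
    rw [← mul_assoc]
    refine le_mul_of_one_le_left (by positivity) ?_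
    rw [inv_mul_eq_div, one_le_div (by positivity)]
    have := hρ.2.le
    gcongr

/-- Decay of the local `L²` mass on small discs under an `L² (Log L)^α` bound. -/
theorem setLIntegral_ball_sq_le {E : Type*} [NormedAddCommGroup E]
    (f : EuclideanSpace ℝ (Fin 2) → E) (x₀ : EuclideanSpace ℝ (Fin 2)) {ρ α : ℝ}
    (hρ : 0 < ρ) (hα : 0 ≤ α) :
    ∫⁻ x in ball x₀ ρ, (‖f x‖₊ : ℝ≥0∞) ^ 2 ≤
      ENNReal.ofReal ρ⁻¹ * volume (ball x₀ ρ) +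
        (∫⁻ x in ball x₀ ρ, (‖f x‖₊ : ℝ≥0∞) ^ 2 *
          ENNReal.ofReal (Real.log (Real.exp 1 + ‖f x‖) ^ α)) *
        ENNReal.ofReal (Real.log (Real.exp 1 + (√ρ)⁻¹) ^ α)⁻¹ := by
  have hpt : ∀ x, (‖f x‖₊ : ℝ≥0∞) ^ 2 ≤ ENNReal.ofReal ρ⁻¹ +
      (‖f x‖₊ : ℝ≥0∞) ^ 2 * ENNReal.ofReal (Real.log (Real.exp 1 + ‖f x‖) ^ α) *
        ENNReal.ofReal (Real.log (Real.exp 1 + (√ρ)⁻¹) ^ α)⁻¹ := fun x => by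
    have hlog : ∀ s : ℝ, 0 ≤ s → 0 ≤ Real.log (Real.exp 1 + s) ^ α := fun s hs =>
      Real.rpow_nonneg (Real.log_nonneg (by linarith [Real.add_one_le_exp (1 : ℝ)])) _
    have hy := hlog _ (norm_nonneg (f x))
    have ht := hlog _ (inv_nonneg.2 (Real.sqrt_nonneg ρ))
    have hnorm : (‖f x‖₊ : ℝ≥0∞) ^ 2 = ENNReal.ofReal (‖f x‖ ^ 2) := by
      rw [ENNReal.ofReal_pow (norm_nonneg _), ofReal_norm, enorm_eq_nnnorm]
    rw [hnorm, ← ENNReal.ofReal_mul (by positivity), ← ENNReal.ofReal_mul (by positivity),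
      ← ENNReal.ofReal_add (by positivity) (by positivity)]
    refine ENNReal.ofReal_le_ofReal ?_
    have := sq_le_sq_add_mul_log_rpow (norm_nonneg (f x))
      (inv_nonneg.2 (Real.sqrt_nonneg ρ)) hα
    rwa [inv_pow, Real.sq_sqrt hρ.le] at this
  refine (lintegral_mono hpt).trans ?_
  rw [lintegral_add_left measurable_const, setLIntegral_const,
    lintegral_mul_const' _ _ ENNReal.ofReal_ne_top]

/-- In dimension `n = 2`, if `f ∈ L²(Log L)^α(B_{2R}(x₀))` for some `α > 2`,
i.e. `∫_{B_{2R}(x₀)} |f|² log^α(e + |f|) dx < ∞`, then the modified Riesz potential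
`P₁^f(x₀,R)` is finite. -/
theorem modRieszPot_finite_of_LlogL (k : ℕ) (hk : 1 ≤ k)
    (x₀ : EuclideanSpace ℝ (Fin 2)) (R : ℝ) (hR : 0 < R) (α : ℝ) (hα : 2 < α)
    (f : EuclideanSpace ℝ (Fin 2) → EuclideanSpace ℝ (Fin k)) (hf : Measurable f)
    (hOrlicz : (∫⁻ x in ball x₀ (2 * R),
        (‖f x‖₊ : ℝ≥0∞) ^ 2 *
          ENNReal.ofReal (Real.log (Real.exp 1 + ‖f x‖) ^ α)) < ⊤) :
    modRieszPot f x₀ R < ⊤ := by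
  set A := ∫⁻ x in ball x₀ (2 * R), (‖f x‖₊ : ℝ≥0∞) ^ 2 *
    ENNReal.ofReal (Real.log (Real.exp 1 + ‖f x‖) ^ α) with hA
  have hF_int : IntegrableOn (fun ρ : ℝ => ρ ^ (-(1/2) : ℝ) + A.toReal ^ (1/2 : ℝ) *
      ((Real.log (Real.exp 1 + (√ρ)⁻¹) ^ (α / 2))⁻¹ / ρ)) (Ioo 0 R) := by
    refine Integrable.add ?_
      ((integrableOn_inv_log_rpow_div (by linarith) hR).const_mul _)
    have h := intervalIntegral.intervalIntegrable_rpow' (a := 0) (b := R)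
      (r := -(1/2)) (by norm_num)
    exact ((intervalIntegrable_iff_integrableOn_Ioc_of_le hR.le).1 h).mono_set
      Ioo_subset_Ioc_self
  refine lt_of_le_of_lt (setLIntegral_mono' measurableSet_Ioo fun ρ hρ => ?_)
    hF_int.lintegral_lt_top
  have h0 := hρ.1
  set L := Real.log (Real.exp 1 + (√ρ)⁻¹) with hL
  have hLpos : 0 < L := Real.log_pos (by
    linarith [Real.add_one_le_exp (1 : ℝ), inv_nonneg.2 (Real.sqrt_nonneg ρ)])
  have hLα := Real.rpow_pos_of_pos hLpos α
  have hvol : volume (ball x₀ ρ) = ENNReal.ofReal (Real.pi * ρ ^ 2) := by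
    rw [EuclideanSpace.volume_ball_fin_two, mul_comm, ENNReal.ofReal_mul Real.pi_pos.le,
      ENNReal.ofReal_pow h0.le, ← NNReal.coe_real_pi, ENNReal.ofReal_coe_nnreal]
  have hmass : ∫⁻ x in ball x₀ ρ, (‖f x‖₊ : ℝ≥0∞) ^ 2 ≤
      ENNReal.ofReal (Real.pi * ρ + A.toReal * (L ^ α)⁻¹) := by
    refine (setLIntegral_ball_sq_le f x₀ h0 (by linarith : 0 ≤ α)).trans ?_
    rw [hvol, ← ENNReal.ofReal_mul (by positivity), ENNReal.ofReal_add (by positivity)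
      (by positivity), ENNReal.ofReal_mul ENNReal.toReal_nonneg,
      ENNReal.ofReal_toReal hOrlicz.ne]
    refine add_le_add (le_of_eq ?_) (mul_le_mul_left ?_ _)
    · congr 1; field_simp
    · exact lintegral_mono_set (ball_subset_ball (by linarith [hρ.2]))
  calc _ ≤ (ENNReal.ofReal (ρ ^ 2) * (ENNReal.ofReal (Real.pi * ρ + A.toReal * (L ^ α)⁻¹) /
          ENNReal.ofReal (Real.pi * ρ ^ 2))) ^ (1/2 : ℝ) / ENNReal.ofReal ρ := by
        rw [hvol]; gcongr
    _ = ENNReal.ofReal ((ρ + A.toReal * (L ^ α)⁻¹ / Real.pi) ^ (1/2 : ℝ) / ρ) := by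
        rw [← ENNReal.ofReal_div_of_pos (by positivity), ← ENNReal.ofReal_mul (by positivity),
          ENNReal.ofReal_rpow_of_nonneg (by positivity) (by norm_num),
          ← ENNReal.ofReal_div_of_pos h0]
        congr 3
        field_simp
    _ ≤ _ := by
        refine ENNReal.ofReal_le_ofReal ?_
        have hρ' : ρ ^ (-(1/2) : ℝ) = ρ ^ (1/2 : ℝ) / ρ := by
          rw [← Real.rpow_sub_one h0.ne']; norm_num
        have hLhalf : (L ^ (α / 2))⁻¹ = ((L ^ α)⁻¹) ^ (1/2 : ℝ) := by
          rw [Real.inv_rpow hLα.le, ← Real.rpow_mul hLpos.le]; congr 2; ring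
        rw [hρ', hLhalf, ← mul_div_assoc, ← add_div,
          ← Real.mul_rpow ENNReal.toReal_nonneg (by positivity)]
        gcongr
        refine (Real.rpow_add_le_add_rpow h0.le (by positivity) (by norm_num)
          (by norm_num)).trans ?_
        gcongr
        exact div_le_self (by positivity) (by linarith [Real.pi_gt_three])
end
end

section
/- Let n > 2, let Ω ⊂ ℝⁿ be open, and let F : ℝⁿ → ℝ be convex and C² on ℝⁿ∖{0}, satisfying for exponents 1 < p ≤ q, constants 0 < ν ≤ 1 ≤ L, μ ∈ [0,1], and all z ≠ 0, ξ ∈ ℝⁿ: ν(|z|²+μ²)^{p/2} ≤ F(z) ≤ L(|z|²+μ²)^{q/2} + L(|z|²+μ²)^{p/2}; (|z|²+μ²)|∂²F(z)| ≤ L(|z|²+μ²)^{q/2} + L(|z|²+μ²)^{p/2}; and ν(|z|²+μ²)^{(p−2)/2}|ξ|² ≤ ⟨∂²F(z)ξ,ξ⟩. Assume Marcellini's gap bound q/p < 1 + 2/n. Let u : Ω → ℝ be locally Lipschitz and a local minimizer of w ↦ ∫ F(Dw) dx. Then there is a constant c = c(n,p,q,ν,L) such that for every ball B = B_r(x₀)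 with B ⋐ Ω one has ‖Du‖_{L^∞(B_{r/2}(x₀))} ≤ c·(⨍_B F(Du) dx)^{2/((n+2)p−nq)} + c. -/
open MeasureTheory Metric Set
open scoped ENNReal NNReal
noncomputable section

/-- `u` is locally Lipschitz on `s`: Lipschitz on every compact subset of `s`. -/
def LocLipOn {n : ℕ} {F : Type*} [PseudoMetricSpace F]
    (s : Set (EuclideanSpace ℝ (Fin n))) (u : EuclideanSpace ℝ (Fin n) → F) : Prop :=
  ∀ K : Set (EuclideanSpace ℝ (Fin n)), IsCompact K → K ⊆ s → ∃ C : ℝ≥0, LipschitzOnWith C u K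

/-- `u` is a local minimizer of `w ↦ ∫ Fi(Dw) dx` on `Ω` among locally Lipschitz maps. -/
def IsLocMinimizerH {n : ℕ} (Ω : Set (EuclideanSpace ℝ (Fin n)))
    (Fi : EuclideanSpace ℝ (Fin n) → ℝ) (u : EuclideanSpace ℝ (Fin n) → ℝ) : Prop :=
  ∀ B' : Set (EuclideanSpace ℝ (Fin n)), IsOpen B' → IsCompact (closure B') →
    closure B' ⊆ Ω →
    ∀ w : EuclideanSpace ℝ (Fin n) → ℝ, LocLipOn Ω w →
      IsCompact (closure {x | w x ≠ u x}) → closure {x | w x ≠ u x} ⊆ B' →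
      ∫ x in B', Fi (gradient u x) ≤ ∫ x in B', Fi (gradient w x)

section HelperLemmas

open Filter Topology InnerProductSpace

section ConvexFunctions

variable {V : Type*} [NormedAddCommGroup V] [InnerProductSpace ℝ V] [FiniteDimensional ℝ V]

omit [FiniteDimensional ℝ V] in
/-- A convex function lies above its tangent hyperplanes. -/
lemma ConvexOn.add_fderiv_sub_le {F : V → ℝ} (hF : ConvexOn ℝ univ F) {x : V}
    (hx : DifferentiableAt ℝ F x) (y : V) : F x + fderiv ℝ F x (y - x) ≤ F y := by
  have hg : ConvexOn ℝ univ (fun t : ℝ => F (x + t • (y - x))) := by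
    refine ⟨convex_univ, fun s _ t _ a b ha hb hab => ?_⟩
    have := hF.2 (mem_univ (x + s • (y - x))) (mem_univ (x + t • (y - x))) ha hb hab
    refine le_trans (le_of_eq ?_) this
    refine congrArg F ?_
    obtain rfl : b = 1 - a := by linarith
    simp only [smul_eq_mul]
    module
  have hd : HasDerivAt (fun t : ℝ => F (x + t • (y - x))) (fderiv ℝ F x (y - x)) 0 := by
    have h0 : HasFDerivAt F (fderiv ℝ F x) (x + (0 : ℝ) • (y - x)) := by
      simpa using hx.hasFDerivAt
    have h1 : HasDerivAt (fun t : ℝ => x + t • (y - x)) (y - x) 0 := by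
      simpa using ((hasDerivAt_id (0 : ℝ)).smul_const (y - x)).const_add x
    exact h0.comp_hasDerivAt 0 h1
  have := hg.le_slope_of_hasDerivAt (mem_univ _) (mem_univ _) one_pos hd
  rw [slope_def_field] at this
  simp only [sub_zero, div_one, one_smul, zero_smul, add_zero, add_sub_cancel] at this
  linarith

/-- The gradient of a convex function is bounded on bounded sets. -/
lemma ConvexOn.exists_lipschitzOnWith_closedBall {F : V → ℝ} (hF : ConvexOn ℝ univ F) (R : ℝ) :
    ∃ C : ℝ≥0, LipschitzOnWith C F (closedBall 0 R) :=
  LocallyLipschitzOn.exists_lipschitzOnWith_of_compact (isCompact_closedBall 0 R)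
    (hF.locallyLipschitz.locallyLipschitzOn)

/-- A convex function which is `C²` with bounded second derivatives off the origin is
differentiable at the origin. -/
lemma ConvexOn.differentiableAt_zero {F : V → ℝ} (hF : ConvexOn ℝ univ F)
    (hC2 : ContDiffOn ℝ 2 F {(0 : V)}ᶜ) (hV : 1 < Module.finrank ℝ V) {K : ℝ}
    (hK : ∀ z : V, z ≠ 0 → ‖z‖ ≤ 1 → ‖fderiv ℝ (fderiv ℝ F) z‖ ≤ K) :
    DifferentiableAt ℝ F 0 := by
  have hopen : IsOpen ({(0 : V)}ᶜ) := isOpen_compl_singleton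
  have hd : ∀ z : V, z ≠ 0 → DifferentiableAt ℝ F z := fun z hz =>
    (hC2.contDiffAt (hopen.mem_nhds hz)).differentiableAt (by norm_num)
  have hd2 : ∀ z : V, z ≠ 0 → DifferentiableAt ℝ (fderiv ℝ F) z := fun z hz =>
    ((hC2.contDiffAt (hopen.mem_nhds hz)).fderiv_right (m := 1) (by norm_num)).differentiableAt
      (by norm_num)
  have hcont : Continuous F := hF.locallyLipschitz.continuous
  have : Nontrivial V := Module.nontrivial_of_finrank_pos (R := ℝ) (by omega)
  -- a subgradient at the origin
  obtain ⟨l, hl⟩ : ∃ l : V →L[ℝ] ℝ, ∀ z, F 0 + l z ≤ F z := by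
    obtain ⟨C, hC⟩ := hF.exists_lipschitzOnWith_closedBall 2
    obtain ⟨ζ, hζ⟩ := exists_ne (0 : V)
    obtain ⟨ζ, hζ1⟩ : ∃ ζ : V, ‖ζ‖ = 1 := ⟨‖ζ‖⁻¹ • ζ, norm_smul_inv_norm hζ⟩
    have hζ0 : ζ ≠ 0 := by rintro rfl; simp at hζ1
    set e : ℕ → V := fun j => ((1 : ℝ) / (j + 1)) • ζ with he
    have he0 : ∀ j, e j ≠ 0 := fun j => smul_ne_zero (by positivity) hζ0
    have helim : Tendsto e atTop (𝓝 0) := by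
      have := (tendsto_one_div_add_atTop_nhds_zero_nat (𝕜 := ℝ)).smul_const ζ
      simpa [he] using this
    have hb : ∀ j, fderiv ℝ F (e j) ∈ closedBall (0 : V →L[ℝ] ℝ) C := by
      intro j
      have hej : ‖e j‖ ≤ 1 := by
        rw [he, norm_smul, hζ1, mul_one, Real.norm_of_nonneg (by positivity), div_le_one (by positivity)]
        linarith [(Nat.cast_nonneg j : (0:ℝ) ≤ j)]
      rw [mem_closedBall_zero_iff]
      refine norm_fderiv_le_of_lipschitzOn ℝ (s := closedBall 0 2) ?_ hC
      refine Filter.mem_of_superset (ball_mem_nhds (e j) one_pos) fun y hy => ?_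
      rw [mem_closedBall_zero_iff]
      have : ‖y - e j‖ < 1 := by simpa [dist_eq_norm] using hy
      calc ‖y‖ = ‖(y - e j) + e j‖ := by simp
        _ ≤ ‖y - e j‖ + ‖e j‖ := norm_add_le _ _
        _ ≤ 2 := by linarith
    obtain ⟨l, -, φ, hφ, hlim⟩ := (isCompact_closedBall (0 : V →L[ℝ] ℝ) C).tendsto_subseq hb
    refine ⟨l, fun z => ?_⟩
    have hlim2 : Tendsto (fun j => F (e (φ j)) + fderiv ℝ F (e (φ j)) (z - e (φ j))) atTop
        (𝓝 (F 0 + l (z - 0))) := by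
      have h1 : Tendsto (fun j => e (φ j)) atTop (𝓝 0) := helim.comp hφ.tendsto_atTop
      refine ((hcont.tendsto 0).comp h1).add ?_
      exact (isBoundedBilinearMap_apply.continuous.tendsto (l, z - 0)).comp
        (hlim.prodMk_nhds (h1.const_sub z))
    rw [sub_zero] at hlim2
    exact le_of_tendsto' hlim2 fun j => hF.add_fderiv_sub_le (hd _ (he0 _)) z
  -- symmetric second differences
  have hsym : ∀ z : V, ‖z‖ ≤ 1 / 2 → F z + F (-z) - 2 * F 0 ≤ 2 * K * ‖z‖ ^ 2 := by
    intro z hz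
    obtain ⟨y, hy⟩ : ∃ y : V, y ∉ Submodule.span ℝ {z} := by
      by_contra! h
      have htop : Submodule.span ℝ {z} = ⊤ := by ext x; simp [h x]
      have := finrank_span_le_card (R := ℝ) ({z} : Set V)
      rw [htop, finrank_top] at this
      simp at this
      omega
    have hne : ∀ t : ℝ, ∀ ε : ℝ, ε ≠ 0 → t • z + ε • y ≠ 0 := by
      intro t ε hε h
      apply hy
      rw [Submodule.mem_span_singleton]
      refine ⟨-(ε⁻¹ * t), ?_⟩
      have : ε⁻¹ • (t • z + ε • y) = 0 := by rw [h, smul_zero]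
      rw [smul_add, smul_smul, smul_smul, inv_mul_cancel₀ hε, one_smul] at this
      rw [neg_smul]
      exact (eq_neg_of_add_eq_zero_right this).symm
    have hstep : ∀ s : ℝ, |s| = 1 → ∀ ε : ℝ, ε ≠ 0 → ‖ε • y‖ ≤ 1 / 2 →
        F (s • z + ε • y) ≤ F (ε • y) + s * fderiv ℝ F (ε • y) z + K * ‖z‖ ^ 2 := by
      intro s hs ε hε hε2
      have h1 := hF.add_fderiv_sub_le (hd _ (hne s ε hε)) (ε • y)
      have hmv : ‖fderiv ℝ F (s • z + ε • y) - fderiv ℝ F (ε • y)‖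
          ≤ K * ‖(s • z + ε • y) - ε • y‖ := by
        have hseg : ∀ x ∈ segment ℝ (ε • y) (s • z + ε • y), x ≠ 0 ∧ ‖x‖ ≤ 1 := by
          intro x hx
          obtain ⟨a, b, ha, hb, hab, rfl⟩ := hx
          have e1 : a • ε • y + b • (s • z + ε • y) = (b * s) • z + ε • y := by
            obtain rfl : b = 1 - a := by linarith
            module
          rw [e1]
          refine ⟨hne _ _ hε, (norm_add_le _ _).trans ?_⟩
          have : ‖(b * s) • z‖ ≤ 1 / 2 := by
            rw [norm_smul, norm_mul, Real.norm_eq_abs s, hs, mul_one, Real.norm_of_nonneg hb]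
            nlinarith [norm_nonneg z]
          linarith
        refine Convex.norm_image_sub_le_of_norm_fderiv_le (𝕜 := ℝ) (fun x hx => hd2 x (hseg x hx).1)
          (fun x hx => hK x (hseg x hx).1 (hseg x hx).2) (convex_segment _ _)
          (left_mem_segment _ _ _) (right_mem_segment _ _ _)
      have h2 : |(fderiv ℝ F (s • z + ε • y) - fderiv ℝ F (ε • y)) (s • z)| ≤ K * ‖z‖ ^ 2 := by
        have := ContinuousLinearMap.le_opNorm
          (fderiv ℝ F (s • z + ε • y) - fderiv ℝ F (ε • y)) (s • z)
        have hn : ‖s • z‖ = ‖z‖ := by rw [norm_smul, Real.norm_eq_abs, hs, one_mul]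
        rw [add_sub_cancel_right, hn] at hmv
        rw [hn] at this
        calc _ ≤ _ := this
          _ ≤ K * ‖z‖ * ‖z‖ := by gcongr
          _ = _ := by ring
      have e2 : ε • y - (s • z + ε • y) = -(s • z) := by abel
      rw [e2, map_neg] at h1
      have h3 := (abs_le.1 h2).2
      rw [sub_apply, map_smul, map_smul, smul_eq_mul, smul_eq_mul] at h3
      rw [map_smul, smul_eq_mul] at h1
      linarith
    have hlim : Tendsto (fun ε : ℝ => F ((1 : ℝ) • z + ε • y) + F ((-1 : ℝ) • z + ε • y)
        - 2 * F (ε • y)) (𝓝[≠] 0) (𝓝 (F z + F (-z) - 2 * F 0)) := by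
      have : Continuous (fun ε : ℝ => F ((1 : ℝ) • z + ε • y) + F ((-1 : ℝ) • z + ε • y)
        - 2 * F (ε • y)) := by fun_prop
      have h := this.tendsto 0
      simp only [one_smul, neg_smul, zero_smul, add_zero] at h
      simpa using h.mono_left nhdsWithin_le_nhds
    refine le_of_tendsto hlim ?_
    have hsmall : ∀ᶠ ε : ℝ in 𝓝[≠] 0, ‖ε • y‖ ≤ 1 / 2 := by
      have : Tendsto (fun ε : ℝ => ‖ε • y‖) (𝓝 0) (𝓝 0) :=
        Continuous.tendsto' (by fun_prop) 0 0 (by simp)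
      exact (this.mono_left nhdsWithin_le_nhds).eventually (eventually_le_nhds (by norm_num))
    filter_upwards [hsmall, self_mem_nhdsWithin] with ε h1 h2
    have a1 := hstep 1 (by simp) ε h2 h1
    have a2 := hstep (-1) (by simp) ε h2 h1
    linarith
  have hbig : (fun z => F z - F 0 - l z) =O[𝓝 0] fun z => ‖z - 0‖ ^ 2 := by
    refine Asymptotics.IsBigO.of_bound (2 * K) ?_
    filter_upwards [closedBall_mem_nhds (0 : V) (by norm_num : (0 : ℝ) < 1 / 2)] with z hz
    have hz' : ‖z‖ ≤ 1 / 2 := by simpa using hz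
    have h1 := hl z
    have h2 := hl (-z)
    have h3 := hsym z hz'
    rw [map_neg] at h2
    rw [sub_zero, norm_pow, norm_norm, Real.norm_of_nonneg (by linarith)]
    linarith
  have h0 := Asymptotics.IsBigO.hasFDerivAt (𝕜 := ℝ) hbig (by norm_num)
  have h1 : HasFDerivAt F (0 + l) 0 := by
    have := (h0.add l.hasFDerivAt).const_add (F 0)
    refine this.congr_of_eventuallyEq (Eventually.of_forall fun z => ?_)
    simp
  exact h1.differentiableAt

end ConvexFunctions

section Growth

variable {V : Type*} [NormedAddCommGroup V] [InnerProductSpace ℝ V] [FiniteDimensional ℝ V]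

/-- Convex integrands with nonstandard `(p,q)`-growth. -/
structure PQGrowth (p q ν L μ : ℝ) (F : V → ℝ) : Prop where
  mem : μ ∈ Icc (0 : ℝ) 1
  convex : ConvexOn ℝ univ F
  contDiff : ContDiffOn ℝ 2 F {(0 : V)}ᶜ
  growth : ∀ z : V, z ≠ 0 →
    ν * (‖z‖ ^ 2 + μ ^ 2) ^ (p / 2) ≤ F z ∧
      F z ≤ L * (‖z‖ ^ 2 + μ ^ 2) ^ (q / 2) + L * (‖z‖ ^ 2 + μ ^ 2) ^ (p / 2)
  hessian_le : ∀ z : V, z ≠ 0 →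
    (‖z‖ ^ 2 + μ ^ 2) * ‖fderiv ℝ (fderiv ℝ F) z‖ ≤
      L * (‖z‖ ^ 2 + μ ^ 2) ^ (q / 2) + L * (‖z‖ ^ 2 + μ ^ 2) ^ (p / 2)
  le_hessian : ∀ z : V, z ≠ 0 → ∀ ξ : V,
    ν * (‖z‖ ^ 2 + μ ^ 2) ^ ((p - 2) / 2) * ‖ξ‖ ^ 2 ≤ fderiv ℝ (fderiv ℝ F) z ξ ξ

lemma rpow_comparable {S M α : ℝ} (hM : 0 < M) (h1 : M ^ 2 / 64 ≤ S) (h2 : S ≤ 64 * M ^ 2) :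
    (64 : ℝ) ^ (-|α|) * M ^ (2 * α) ≤ S ^ α ∧ S ^ α ≤ (64 : ℝ) ^ |α| * M ^ (2 * α) := by
  have hM2 : 0 < M ^ 2 := by positivity
  obtain ⟨x, hx⟩ : ∃ x, x = S / M ^ 2 := ⟨_, rfl⟩
  have hS : S = x * M ^ 2 := by rw [hx]; field_simp
  have hx1 : 64⁻¹ ≤ x := by rw [hx, le_div_iff₀ hM2]; linarith
  have hx2 : x ≤ 64 := by rw [hx, div_le_iff₀ hM2]; linarith
  have hx0 : 0 < x := lt_of_lt_of_le (by norm_num) hx1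
  have hlog : |Real.log x| ≤ Real.log 64 := by
    rw [abs_le, ← Real.log_inv]
    exact ⟨Real.log_le_log (by norm_num) hx1, Real.log_le_log hx0 hx2⟩
  have hxα : |Real.log x * α| ≤ Real.log 64 * |α| := by
    rw [abs_mul]; gcongr
  have hSα : S ^ α = x ^ α * M ^ (2 * α) := by
    rw [hS, Real.mul_rpow hx0.le hM2.le, ← Real.rpow_natCast M 2, ← Real.rpow_mul hM.le]
    norm_num
  have hMα : 0 < M ^ (2 * α) := Real.rpow_pos_of_pos hM _
  rw [hSα, Real.rpow_def_of_pos hx0, Real.rpow_def_of_pos (by norm_num : (0 : ℝ) < 64),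
    Real.rpow_def_of_pos (by norm_num : (0 : ℝ) < 64)]
  have := abs_le.1 hxα
  constructor
  · exact mul_le_mul_of_nonneg_right (Real.exp_le_exp.2 (by linarith)) hMα.le
  · exact mul_le_mul_of_nonneg_right (Real.exp_le_exp.2 (by linarith)) hMα.le

namespace PQGrowth

variable {p q ν L μ : ℝ} {F : V → ℝ}

lemma differentiable (h : PQGrowth p q ν L μ F) (hp : 1 < p) (hpq : p ≤ q) (hν : 0 < ν)
    (hL : 1 ≤ L) (hV : 1 < Module.finrank ℝ V) : Differentiable ℝ F := by
  intro z
  by_cases hz : z = 0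
  swap
  · exact (h.contDiff.contDiffAt (isOpen_compl_singleton.mem_nhds hz)).differentiableAt
      (by norm_num)
  subst hz
  have hμ0 := h.mem.1
  have hμ1 := h.mem.2
  rcases hμ0.eq_or_lt with hμ | hμ
  · -- the singular case
    have hb : ∀ z : V, z ≠ 0 → ‖z‖ ≤ 1 → |F z| ≤ 2 * L * ‖z‖ ^ p := by
      intro z hz hz1
      have hz0 : 0 < ‖z‖ := norm_pos_iff.2 hz
      have := h.growth z hz
      have e : ∀ s : ℝ, (‖z‖ ^ 2 + μ ^ 2) ^ (s / 2) = ‖z‖ ^ s := by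
        intro s
        rw [← hμ, zero_pow two_ne_zero, add_zero, ← Real.rpow_natCast ‖z‖ 2,
          ← Real.rpow_mul hz0.le]
        congr 1; push_cast; ring
      rw [e, e] at this
      have hpos : 0 < ‖z‖ ^ p := Real.rpow_pos_of_pos hz0 _
      have hle : ‖z‖ ^ q ≤ ‖z‖ ^ p := Real.rpow_le_rpow_of_exponent_ge hz0 hz1 hpq
      rw [abs_of_nonneg (le_trans (by positivity) this.1)]
      nlinarith [this.2]
    have hcont : Continuous F := h.convex.locallyLipschitz.continuous
    have : Nontrivial V := Module.nontrivial_of_finrank_pos (R := ℝ) (by omega)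
    have hlim0 : Tendsto (fun z : V => 2 * L * ‖z‖ ^ p) (𝓝 0) (𝓝 0) := by
      have : Continuous (fun z : V => 2 * L * ‖z‖ ^ p) :=
        continuous_const.mul (continuous_norm.rpow_const fun _ => Or.inr (by linarith))
      simpa [Real.zero_rpow (by linarith : p ≠ 0)] using this.tendsto 0
    have hsm : ∀ᶠ z : V in 𝓝 0, ‖z‖ ≤ 1 := by
      filter_upwards [closedBall_mem_nhds (0 : V) one_pos] with z hz using by simpa using hz
    have hF0 : F 0 = 0 := by
      have h1 : Tendsto F (𝓝[≠] 0) (𝓝 (F 0)) := (hcont.tendsto 0).mono_left nhdsWithin_le_nhds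
      have h2 : Tendsto F (𝓝[≠] 0) (𝓝 0) := by
        refine squeeze_zero_norm' ?_ (hlim0.mono_left nhdsWithin_le_nhds)
        filter_upwards [self_mem_nhdsWithin, hsm.filter_mono nhdsWithin_le_nhds] with z hz hz1
        exact hb z hz hz1
      exact tendsto_nhds_unique h1 h2
    refine HasFDerivAt.differentiableAt (f' := (0 : V →L[ℝ] ℝ)) ?_
    rw [hasFDerivAt_iff_isLittleO_nhds_zero]
    simp only [zero_add, hF0, sub_zero, zero_apply]
    have hlim1 : Tendsto (fun z : V => 2 * L * ‖z‖ ^ (p - 1)) (𝓝 0) (𝓝 0) := by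
      have : Continuous (fun z : V => 2 * L * ‖z‖ ^ (p - 1)) :=
        continuous_const.mul (continuous_norm.rpow_const fun _ => Or.inr (by linarith))
      simpa [Real.zero_rpow (by linarith : p - 1 ≠ 0)] using this.tendsto 0
    rw [Asymptotics.isLittleO_iff]
    intro c hc
    filter_upwards [hsm, hlim1.eventually (eventually_le_nhds hc)] with z hz1 hz2
    by_cases hz : z = 0
    · simp [hz, hF0]
    · have hz0 : 0 < ‖z‖ := norm_pos_iff.2 hz
      have e : ‖z‖ ^ p = ‖z‖ ^ (p - 1) * ‖z‖ := by
        rw [← Real.rpow_add_one hz0.ne']; congr 1; ring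
      calc ‖F z‖ ≤ 2 * L * ‖z‖ ^ p := hb z hz hz1
        _ = 2 * L * ‖z‖ ^ (p - 1) * ‖z‖ := by rw [e]; ring
        _ ≤ c * ‖z‖ := by gcongr
  · -- the regular case
    refine h.convex.differentiableAt_zero h.contDiff hV
      (K := (L * 2 ^ (q / 2) + L * 2 ^ (p / 2)) / μ ^ 2) fun z hz hz1 => ?_
    rw [le_div_iff₀ (by positivity)]
    have hS : ‖z‖ ^ 2 + μ ^ 2 ≤ 2 := by nlinarith [norm_nonneg z]
    calc ‖fderiv ℝ (fderiv ℝ F) z‖ * μ ^ 2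
        ≤ (‖z‖ ^ 2 + μ ^ 2) * ‖fderiv ℝ (fderiv ℝ F) z‖ := by
          nlinarith [norm_nonneg (fderiv ℝ (fderiv ℝ F) z), sq_nonneg ‖z‖]
      _ ≤ _ := h.hessian_le z hz
      _ ≤ _ := by
        gcongr
        linarith

lemma le_apply (h : PQGrowth p q ν L μ F) (hp : 1 < p) (hν : 0 < ν)
    (hV : 1 < Module.finrank ℝ V) (z : V) : ν * ‖z‖ ^ p ≤ F z := by
  have key : ∀ z : V, z ≠ 0 → ν * ‖z‖ ^ p ≤ F z := by
    intro z hz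
    refine le_trans ?_ (h.growth z hz).1
    have hz0 : 0 < ‖z‖ := norm_pos_iff.2 hz
    have e : ‖z‖ ^ p = (‖z‖ ^ 2) ^ (p / 2) := by
      rw [← Real.rpow_natCast ‖z‖ 2, ← Real.rpow_mul hz0.le]
      congr 1; push_cast; ring
    rw [e]
    gcongr
    nlinarith [sq_nonneg μ]
  by_cases hz : z = 0
  · subst hz
    have : Nontrivial V := Module.nontrivial_of_finrank_pos (R := ℝ) (by omega)
    have hcont : Continuous F := h.convex.locallyLipschitz.continuous
    have h1 : Tendsto F (𝓝[≠] 0) (𝓝 (F 0)) := (hcont.tendsto 0).mono_left nhdsWithin_le_nhds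
    rw [norm_zero, Real.zero_rpow (by linarith), mul_zero]
    refine ge_of_tendsto h1 ?_
    filter_upwards [self_mem_nhdsWithin] with z hz
    exact le_trans (by positivity) (key z hz)
  · exact key z hz

lemma nonneg (h : PQGrowth p q ν L μ F) (hp : 1 < p) (hν : 0 < ν)
    (hV : 1 < Module.finrank ℝ V) (z : V) : 0 ≤ F z :=
  le_trans (by positivity) (h.le_apply hp hν hV z)

omit [FiniteDimensional ℝ V] in
lemma apply_le (h : PQGrowth p q ν L μ F) (hp : 1 < p) (hpq : p ≤ q) (hL : 1 ≤ L)
    (hV : 1 < Module.finrank ℝ V) {M : ℝ} (hM : 8 ≤ M) {z : V} (hz : ‖z‖ ≤ 2 * M) :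
    F z ≤ 2 * L * (64 : ℝ) ^ (q / 2) * M ^ q := by
  have hM0 : 0 < M := by linarith
  have hμ0 := h.mem.1
  have hμ1 := h.mem.2
  have e : (64 : ℝ) ^ (q / 2) * M ^ q = (64 * M ^ 2) ^ (q / 2) := by
    rw [Real.mul_rpow (by norm_num) (by positivity), ← Real.rpow_natCast M 2,
      ← Real.rpow_mul hM0.le]
    congr 2; push_cast; ring
  rw [mul_assoc, e]
  have key : ∀ z : V, ‖z‖ ≤ 2 * M → z ≠ 0 → F z ≤ 2 * L * (64 * M ^ 2) ^ (q / 2) := by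
    intro z hz hz0
    refine (h.growth z hz0).2.trans ?_
    have hS : ‖z‖ ^ 2 + μ ^ 2 ≤ 64 * M ^ 2 := by nlinarith [norm_nonneg z]
    have h1 : (‖z‖ ^ 2 + μ ^ 2) ^ (q / 2) ≤ (64 * M ^ 2) ^ (q / 2) := by
      gcongr; linarith
    have h2 : (‖z‖ ^ 2 + μ ^ 2) ^ (p / 2) ≤ (64 * M ^ 2) ^ (q / 2) := by
      calc _ ≤ (64 * M ^ 2) ^ (p / 2) := by gcongr
        _ ≤ _ := by
          apply Real.rpow_le_rpow_of_exponent_le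
          · nlinarith
          · linarith
    nlinarith
  by_cases hz0 : z = 0
  · subst hz0
    have : Nontrivial V := Module.nontrivial_of_finrank_pos (R := ℝ) (by omega)
    obtain ⟨ζ, hζ⟩ := exists_ne (0 : V)
    obtain ⟨ζ, hζ1⟩ : ∃ ζ : V, ‖ζ‖ = 1 := ⟨‖ζ‖⁻¹ • ζ, norm_smul_inv_norm hζ⟩
    have hζ0 : ζ ≠ 0 := by rintro rfl; simp at hζ1
    have h1 := key ζ (by linarith) hζ0
    have h2 := key (-ζ) (by rw [norm_neg]; linarith) (neg_ne_zero.2 hζ0)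
    have := h.convex.2 (mem_univ ζ) (mem_univ (-ζ)) (by norm_num : (0 : ℝ) ≤ 1 / 2)
      (by norm_num : (0 : ℝ) ≤ 1 / 2) (by norm_num)
    rw [smul_neg, add_neg_cancel, smul_eq_mul, smul_eq_mul] at this
    linarith
  · exact key z hz hz0

lemma norm_gradient_le (h : PQGrowth p q ν L μ F) (hp : 1 < p) (hpq : p ≤ q) (hν : 0 < ν)
    (hL : 1 ≤ L) (hV : 1 < Module.finrank ℝ V) {M : ℝ} (hM : 8 ≤ M) {z : V} (hz : ‖z‖ ≤ M) :
    ‖gradient F z‖ ≤ 2 * L * (64 : ℝ) ^ (q / 2) * M ^ (q - 1) := by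
  have hM0 : 0 < M := by linarith
  by_cases hg : gradient F z = 0
  · rw [hg, norm_zero]; positivity
  have hg0 : 0 < ‖gradient F z‖ := norm_pos_iff.2 hg
  set y : V := (M * ‖gradient F z‖⁻¹) • gradient F z with hy
  have hyn : ‖y‖ = M := by
    rw [hy, norm_smul, norm_mul, norm_inv, norm_norm, Real.norm_of_nonneg hM0.le]
    field_simp
  have h1 := h.convex.add_fderiv_sub_le (h.differentiable hp hpq hν hL hV z) (z + y)
  rw [add_sub_cancel_left, ← inner_gradient_left, hy, inner_smul_right,
    real_inner_self_eq_norm_sq, ← hy] at h1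
  have h2 := h.apply_le hp hpq hL hV hM (z := z + y) (by
    refine (norm_add_le _ _).trans ?_; rw [hyn]; linarith)
  have h3 := h.nonneg hp hν hV z
  have e : M ^ q = M ^ (q - 1) * M := by
    rw [← Real.rpow_add_one hM0.ne']; congr 1; ring
  have e2 : M * ‖gradient F z‖⁻¹ * ‖gradient F z‖ ^ 2 = ‖gradient F z‖ * M := by
    field_simp
  rw [e2] at h1
  rw [e] at h2
  refine le_of_mul_le_mul_right ?_ hM0
  linarith

/-- Ellipticity and cocoercivity of the gradient of an integrand with `(p,q)`-growth, when one
of the two points is away from the origin. -/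
lemma exists_monotone_bounds (V : Type*) [NormedAddCommGroup V] [InnerProductSpace ℝ V]
    [FiniteDimensional ℝ V] (hV : 1 < Module.finrank ℝ V) (hp : 1 < p)
    (hpq : p ≤ q) (hν : 0 < ν) (hL : 1 ≤ L) :
    ∃ c > 0, ∃ C > 0, ∀ (F : V → ℝ) (μ : ℝ), PQGrowth p q ν L μ F →
      ∀ M : ℝ, 8 ≤ M → ∀ a b : V, ‖a‖ ≤ M → ‖b‖ ≤ M → M / 4 ≤ ‖a‖ →
        c * M ^ (p - 2) * ‖a - b‖ ^ 2 ≤ inner ℝ (gradient F a - gradient F b) (a - b) ∧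
        ‖gradient F a - gradient F b‖ ^ 2 ≤
          C * M ^ (q - 2) * inner ℝ (gradient F a - gradient F b) (a - b) := by
  set Λ₀ : ℝ := 2 * L * (64 : ℝ) ^ |q / 2 - 1| with hΛ₀
  set C₄ : ℝ := 2 * L * (64 : ℝ) ^ (q / 2) with hC₄
  have hΛ₀0 : 0 < Λ₀ := by positivity
  have hC₄0 : 0 < C₄ := by positivity
  refine ⟨ν * (64 : ℝ) ^ (-|(p - 2) / 2|) / 32, by positivity, 2 * (2 * Λ₀ + 32 * C₄), by positivity,
    fun F μ h M hM a b ha hb ha4 => ?_⟩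
  have hM0 : 0 < M := by linarith
  have hμ0 := h.mem.1
  have hμ1 := h.mem.2
  have hdiff := h.differentiable hp hpq hν hL hV
  -- the Hessian near `a`
  have hnear : ∀ z ∈ closedBall a (M / 16), z ≠ 0 ∧ M ^ 2 / 64 ≤ ‖z‖ ^ 2 + μ ^ 2 ∧
      ‖z‖ ^ 2 + μ ^ 2 ≤ 64 * M ^ 2 ∧ 1 ≤ ‖z‖ ^ 2 + μ ^ 2 := by
    intro z hz
    have hz' : ‖z - a‖ ≤ M / 16 := by simpa [dist_eq_norm] using hz
    have h1 : 3 * M / 16 ≤ ‖z‖ := by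
      have := norm_sub_norm_le a z
      rw [norm_sub_rev] at this
      linarith
    have h2 : ‖z‖ ≤ 2 * M := by
      have := norm_sub_norm_le z a
      linarith
    refine ⟨norm_pos_iff.1 (by linarith), ?_, ?_, ?_⟩ <;> nlinarith
  have hd2 : ∀ z ∈ closedBall a (M / 16), DifferentiableAt ℝ (fderiv ℝ F) z := fun z hz =>
    ((h.contDiff.contDiffAt (isOpen_compl_singleton.mem_nhds (hnear z hz).1)).fderiv_right
      (m := 1) (by norm_num)).differentiableAt (by norm_num)
  have hup : ∀ z ∈ closedBall a (M / 16), ‖fderiv ℝ (fderiv ℝ F) z‖ ≤ Λ₀ * M ^ (q - 2) := by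
    intro z hz
    obtain ⟨hz0, hS1, hS2, hS3⟩ := hnear z hz
    have h1 := h.hessian_le z hz0
    set S := ‖z‖ ^ 2 + μ ^ 2
    have hS0 : 0 < S := by linarith
    have h2 : S ^ (p / 2) ≤ S ^ (q / 2) :=
      Real.rpow_le_rpow_of_exponent_le hS3 (by linarith)
    have h3 : S ^ (q / 2) = S ^ (q / 2 - 1) * S := by
      rw [← Real.rpow_add_one hS0.ne']; congr 1; ring
    have h4 := (rpow_comparable (α := q / 2 - 1) hM0 hS1 hS2).2
    have e : (2 * (q / 2 - 1)) = q - 2 := by ring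
    rw [e] at h4
    have h5 : S * ‖fderiv ℝ (fderiv ℝ F) z‖ ≤ S * (2 * L * S ^ (q / 2 - 1)) := by
      refine h1.trans ?_
      have : L * S ^ (p / 2) ≤ L * S ^ (q / 2) := by gcongr
      rw [h3] at this ⊢
      linarith
    have h6 := le_of_mul_le_mul_left h5 hS0
    refine h6.trans ?_
    rw [hΛ₀, mul_assoc (2 * L)]
    gcongr
  set G := gradient F a - gradient F b with hG
  have hGi : ∀ ξ, inner ℝ G ξ = fderiv ℝ F a ξ - fderiv ℝ F b ξ := fun ξ => by
    rw [hG, inner_sub_left, inner_gradient_left, inner_gradient_left]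
  constructor
  · -- lower bound
    set lam : ℝ := ν * (64 : ℝ) ^ (-|(p - 2) / 2|) * M ^ (p - 2) with hlam
    have hcurve : ∀ s ∈ Icc (0 : ℝ) (1 / 32), a + s • (b - a) ∈ closedBall a (M / 16) := by
      intro s hs
      rw [mem_closedBall, dist_eq_norm, add_sub_cancel_left, norm_smul, Real.norm_of_nonneg hs.1]
      have : ‖b - a‖ ≤ 2 * M := (norm_sub_le _ _).trans (by linarith)
      have := hs.2
      nlinarith [norm_nonneg (b - a), hs.1]
    set g : ℝ → ℝ := fun s => fderiv ℝ F (a + s • (b - a)) (a - b) with hg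
    have hgd : ∀ s ∈ Icc (0 : ℝ) (1 / 32), HasDerivAt g
        (fderiv ℝ (fderiv ℝ F) (a + s • (b - a)) (b - a) (a - b)) s := by
      intro s hs
      have h1 : HasDerivAt (fun s : ℝ => a + s • (b - a)) (b - a) s := by
        simpa using ((hasDerivAt_id s).smul_const (b - a)).const_add a
      have h2 := (hd2 _ (hcurve s hs)).hasFDerivAt.comp_hasDerivAt s h1
      exact h2.clm_apply (hasDerivAt_const s (a - b)) |>.congr_deriv (by simp)
    have hgd' : ∀ s ∈ Icc (0 : ℝ) (1 / 32),
        fderiv ℝ (fderiv ℝ F) (a + s • (b - a)) (b - a) (a - b) ≤ -(lam * ‖a - b‖ ^ 2) := by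
      intro s hs
      obtain ⟨hz0, hS1, hS2, hS3⟩ := hnear _ (hcurve s hs)
      have h1 := h.le_hessian _ hz0 (a - b)
      have h2 := (rpow_comparable (α := (p - 2) / 2) hM0 hS1 hS2).1
      have e : 2 * ((p - 2) / 2) = p - 2 := by ring
      rw [e] at h2
      have e2 : b - a = -(a - b) := by abel
      have h3 : lam * ‖a - b‖ ^ 2 ≤
          fderiv ℝ (fderiv ℝ F) (a + s • (b - a)) (a - b) (a - b) := by
        refine le_trans ?_ h1
        rw [hlam, mul_assoc ν]
        gcongr
      have h4 : fderiv ℝ (fderiv ℝ F) (a + s • (b - a)) (b - a) (a - b) =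
          -(fderiv ℝ (fderiv ℝ F) (a + s • (b - a)) (a - b) (a - b)) := by
        have : (fderiv ℝ (fderiv ℝ F) (a + s • (b - a))) (b - a)
            = -(fderiv ℝ (fderiv ℝ F) (a + s • (b - a))) (a - b) := by
          rw [← map_neg, e2]
        rw [this]; rfl
      rw [h4]
      linarith
    have hmv : g (1 / 32) - g 0 ≤ -(lam * ‖a - b‖ ^ 2) * (1 / 32 - 0) := by
      refine Convex.image_sub_le_mul_sub_of_deriv_le (convex_Icc (0 : ℝ) (1 / 32))
        (fun s hs => (hgd s hs).continuousAt.continuousWithinAt)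
        (fun s hs => (hgd s (interior_subset hs)).differentiableAt.differentiableWithinAt)
        (fun s hs => ?_) 0 (by norm_num) (1 / 32) (by norm_num) (by norm_num)
      rw [(hgd s (interior_subset hs)).deriv]
      exact hgd' s (interior_subset hs)
    have hmono : fderiv ℝ F b (a - b) ≤ g (1 / 32) := by
      set b' := a + (1 / 32 : ℝ) • (b - a) with hb'
      have h1 := h.convex.add_fderiv_sub_le (hdiff b) b'
      have h2 := h.convex.add_fderiv_sub_le (hdiff b') b
      have e1 : b' - b = (31 / 32 : ℝ) • (a - b) := by rw [hb']; module
      have e2 : b - b' = -((31 / 32 : ℝ) • (a - b)) := by rw [hb']; module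
      rw [e1, map_smul, smul_eq_mul] at h1
      rw [e2, map_neg, map_smul, smul_eq_mul] at h2
      have : g (1 / 32) = fderiv ℝ F b' (a - b) := rfl
      rw [this]
      linarith
    have hg0 : g 0 = fderiv ℝ F a (a - b) := by simp [hg]
    rw [hGi, ← hg0]
    have : ν * (64 : ℝ) ^ (-|(p - 2) / 2|) / 32 * M ^ (p - 2) * ‖a - b‖ ^ 2
        = lam * ‖a - b‖ ^ 2 * (1 / 32) := by rw [hlam]; ring
    rw [this]
    linarith
  · -- cocoercivity
    set Λ : ℝ := (2 * Λ₀ + 32 * C₄) * M ^ (q - 2) with hΛ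
    have hMq : 0 < M ^ (q - 2) := Real.rpow_pos_of_pos hM0 _
    have hΛ0 : 0 < Λ := by positivity
    have hGn : ‖G‖ ≤ 2 * (C₄ * M ^ (q - 1)) := by
      refine (norm_sub_le _ _).trans ?_
      have h1 := h.norm_gradient_le hp hpq hν hL hV hM ha
      have h2 := h.norm_gradient_le hp hpq hν hL hV hM hb
      linarith
    have e : M ^ (q - 1) = M ^ (q - 2) * M := by
      rw [← Real.rpow_add_one hM0.ne']; congr 1; ring
    set t : ℝ := Λ⁻¹ with ht
    have ht0 : 0 < t := by positivity
    have htG : ‖t • G‖ ≤ M / 16 := by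
      rw [norm_smul, Real.norm_of_nonneg ht0.le, ht, inv_mul_le_iff₀ hΛ0]
      refine hGn.trans ?_
      rw [e, hΛ]
      have : 0 ≤ Λ₀ * M ^ (q - 2) * M := by positivity
      linarith
    set y := a - t • G with hy
    have hyb : y ∈ closedBall a (M / 16) := by
      rw [mem_closedBall, dist_eq_norm, hy, sub_sub_cancel_left, norm_neg]; exact htG
    have hab : a ∈ closedBall a (M / 16) := mem_closedBall_self (by positivity)
    have hmv : ‖fderiv ℝ F a - fderiv ℝ F y‖ ≤ Λ₀ * M ^ (q - 2) * ‖a - y‖ :=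
      Convex.norm_image_sub_le_of_norm_fderiv_le (𝕜 := ℝ) hd2 hup (convex_closedBall _ _) hyb hab
    have hay : a - y = t • G := by rw [hy]; abel
    have h1 := h.convex.add_fderiv_sub_le (hdiff y) a
    have h2 := h.convex.add_fderiv_sub_le (hdiff b) y
    have h3 := h.convex.add_fderiv_sub_le (hdiff a) b
    have h4 : |(fderiv ℝ F a - fderiv ℝ F y) (t • G)| ≤ Λ₀ * M ^ (q - 2) * ‖t • G‖ ^ 2 := by
      have := ContinuousLinearMap.le_opNorm (fderiv ℝ F a - fderiv ℝ F y) (t • G)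
      rw [hay] at hmv
      calc _ ≤ _ := this
        _ ≤ Λ₀ * M ^ (q - 2) * ‖t • G‖ * ‖t • G‖ := by gcongr
        _ = _ := by ring
    have h5 := (abs_le.1 h4).2
    rw [sub_apply] at h5
    rw [hay] at h1
    have e3 : y - b = (a - b) - t • G := by rw [hy]; abel
    have e4 : b - a = -(a - b) := by abel
    rw [e3, map_sub] at h2
    rw [e4, map_neg] at h3
    have h6 : fderiv ℝ F a (t • G) - fderiv ℝ F b (t • G) = t * ‖G‖ ^ 2 := by
      rw [← hGi, inner_smul_right, real_inner_self_eq_norm_sq]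
    have h7 : Λ₀ * M ^ (q - 2) * ‖t • G‖ ^ 2 ≤ t * ‖G‖ ^ 2 / 2 := by
      rw [norm_smul, Real.norm_of_nonneg ht0.le, mul_pow]
      have : Λ₀ * M ^ (q - 2) * t ≤ 1 / 2 := by
        rw [ht, ← div_eq_mul_inv, div_le_iff₀ hΛ0, hΛ]
        have : 0 ≤ C₄ * M ^ (q - 2) := by positivity
        linarith
      calc Λ₀ * M ^ (q - 2) * (t ^ 2 * ‖G‖ ^ 2) = (Λ₀ * M ^ (q - 2) * t) * (t * ‖G‖ ^ 2) := by ring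
        _ ≤ 1 / 2 * (t * ‖G‖ ^ 2) := by gcongr
        _ = _ := by ring
    have h8 : t * ‖G‖ ^ 2 / 2 ≤ inner ℝ G (a - b) := by
      rw [hGi]
      linarith
    have e5 : 2 * (2 * Λ₀ + 32 * C₄) * M ^ (q - 2) = 2 * Λ := by rw [hΛ]; ring
    rw [e5]
    have h9 : ‖G‖ ^ 2 = 2 * Λ * (t * ‖G‖ ^ 2 / 2) := by rw [ht]; field_simp
    rw [h9]
    gcongr

end PQGrowth

end Growth

section Lip

/-- Globally Lipschitz real functions. -/
def IsLip {X : Type*} [PseudoMetricSpace X] (f : X → ℝ) : Prop := ∃ C : ℝ≥0, LipschitzWith C f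

namespace IsLip

variable {X : Type*} [PseudoMetricSpace X] {f g : X → ℝ}

lemma continuous (hf : IsLip f) : Continuous f := hf.choose_spec.continuous

lemma sup (hf : IsLip f) (hg : IsLip g) : IsLip (fun x => f x ⊔ g x) := by
  obtain ⟨C, hC⟩ := hf
  obtain ⟨D, hD⟩ := hg
  exact ⟨_, hC.max hD⟩

lemma inf (hf : IsLip f) (hg : IsLip g) : IsLip (fun x => f x ⊓ g x) := by
  obtain ⟨C, hC⟩ := hf
  obtain ⟨D, hD⟩ := hg
  exact ⟨_, hC.min hD⟩

lemma add (hf : IsLip f) (hg : IsLip g) : IsLip (fun x => f x + g x) := by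
  obtain ⟨C, hC⟩ := hf
  obtain ⟨D, hD⟩ := hg
  exact ⟨_, hC.add hD⟩

lemma sub (hf : IsLip f) (hg : IsLip g) : IsLip (fun x => f x - g x) := by
  obtain ⟨C, hC⟩ := hf
  obtain ⟨D, hD⟩ := hg
  exact ⟨_, hC.sub hD⟩

lemma const (c : ℝ) : IsLip (fun _ : X => c) := ⟨0, LipschitzWith.const c⟩

lemma mul {A B : ℝ} (hf : IsLip f) (hg : IsLip g) (hA : ∀ x, |f x| ≤ A) (hB : ∀ x, |g x| ≤ B) :
    IsLip (fun x => f x * g x) := by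
  obtain ⟨C, hC⟩ := hf
  obtain ⟨D, hD⟩ := hg
  refine ⟨(A * D + B * C).toNNReal, LipschitzWith.of_dist_le' fun x y => ?_⟩
  have h1 := hC.dist_le_mul x y
  have h2 := hD.dist_le_mul x y
  rw [Real.dist_eq] at h1 h2 ⊢
  have e : f x * g x - f y * g y = f x * (g x - g y) + g y * (f x - f y) := by ring
  calc |f x * g x - f y * g y| ≤ |f x| * |g x - g y| + |g y| * |f x - f y| := by
        rw [e, ← abs_mul, ← abs_mul]; exact abs_add_le _ _
    _ ≤ A * (D * dist x y) + B * (C * dist x y) :=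
        add_le_add
          (mul_le_mul (hA x) h2 (abs_nonneg _) ((abs_nonneg _).trans (hA x)))
          (mul_le_mul (hB y) h1 (abs_nonneg _) ((abs_nonneg _).trans (hB y)))
    _ = _ := by ring

lemma const_mul (c : ℝ) (hf : IsLip f) : IsLip (fun x => c * f x) := by
  obtain ⟨C, hC⟩ := hf
  refine ⟨(|c| * C).toNNReal, LipschitzWith.of_dist_le' fun x y => ?_⟩
  have h1 := hC.dist_le_mul x y
  rw [Real.dist_eq] at h1 ⊢
  rw [← mul_sub, abs_mul, mul_assoc]
  gcongr

end IsLip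

end Lip

section Energy

variable {V : Type*} [NormedAddCommGroup V] [InnerProductSpace ℝ V] [FiniteDimensional ℝ V]

lemma gradient_eq_of_le {f g : V → ℝ} {x : V} (hf : DifferentiableAt ℝ f x)
    (hg : DifferentiableAt ℝ g x) (hle : ∀ y, f y ≤ g y) (hx : f x = g x) :
    gradient f x = gradient g x := by
  have hmin : IsLocalMin (fun y => g y - f y) x := by
    refine Filter.Eventually.of_forall fun y => ?_
    have := hle y
    simp only [hx, sub_self, sub_nonneg]
    exact this
  have h := hmin.fderiv_eq_zero
  rw [fderiv_fun_sub hg hf, sub_eq_zero] at h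
  simp only [gradient, h]

lemma norm_gradient (f : V → ℝ) (x : V) : ‖gradient f x‖ = ‖fderiv ℝ f x‖ := by
  simp [gradient]

lemma gradient_sub {f g : V → ℝ} {x : V} (hf : DifferentiableAt ℝ f x)
    (hg : DifferentiableAt ℝ g x) :
    gradient (fun y => f y - g y) x = gradient f x - gradient g x := by
  simp only [gradient, fderiv_fun_sub hf hg, map_sub]

lemma gradient_add_smul {f g : V → ℝ} {x : V} (hf : DifferentiableAt ℝ f x)
    (hg : DifferentiableAt ℝ g x) (t : ℝ) :
    gradient (fun y => f y + t * g y) x = gradient f x + t • gradient g x := by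
  simp only [gradient, fderiv_fun_add hf (hg.const_mul t), fderiv_const_mul hg t, map_add,
    map_smul]

lemma LipschitzWith.norm_gradient_le {f : V → ℝ} {C : ℝ≥0} (hf : LipschitzWith C f) (x : V) :
    ‖gradient f x‖ ≤ C := by
  rw [norm_gradient]
  exact norm_fderiv_le_of_lipschitz ℝ hf

variable [MeasureSpace V] [BorelSpace V]

lemma measurable_gradient (f : V → ℝ) : Measurable (gradient f) :=
  (LinearIsometryEquiv.continuous _).measurable.comp (measurable_fderiv ℝ f)

variable [(volume : Measure V).IsAddHaarMeasure]

lemma IsLip.ae_differentiableAt {f : V → ℝ} (hf : IsLip f) : ∀ᵐ x, DifferentiableAt ℝ f x :=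
  hf.choose_spec.ae_differentiableAt

/-- The gradients of the maximum and of the minimum of two Lipschitz functions. -/
lemma ae_gradient_sup_inf {f g : V → ℝ} (hf : IsLip f) (hg : IsLip g) :
    ∀ᵐ x, (g x ≤ f x → gradient (fun y => f y ⊔ g y) x = gradient f x ∧
        gradient (fun y => f y ⊓ g y) x = gradient g x) ∧
      (f x ≤ g x → gradient (fun y => f y ⊔ g y) x = gradient g x ∧
        gradient (fun y => f y ⊓ g y) x = gradient f x) := by
  filter_upwards [hf.ae_differentiableAt, hg.ae_differentiableAt,
    (hf.sup hg).ae_differentiableAt, (hf.inf hg).ae_differentiableAt] with x h1 h2 h3 h4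
  refine ⟨fun h => ⟨?_, ?_⟩, fun h => ⟨?_, ?_⟩⟩
  · exact (gradient_eq_of_le h1 h3 (fun y => le_sup_left) (sup_eq_left.2 h).symm).symm
  · exact gradient_eq_of_le h4 h2 (fun y => inf_le_right) (inf_eq_right.2 h)
  · exact (gradient_eq_of_le h2 h3 (fun y => le_sup_right) (sup_eq_right.2 h).symm).symm
  · exact gradient_eq_of_le h4 h1 (fun y => inf_le_left) (inf_eq_left.2 h)

/-- The energy `∫_B F(Dv)`. -/
def energy (F : V → ℝ) (B : Set V) (v : V → ℝ) : ℝ := ∫ x in B, F (gradient v x)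

/-- `v` minimizes the energy among Lipschitz competitors with compactly contained
perturbations. -/
def IsLipMin (F : V → ℝ) (B : Set V) (v : V → ℝ) : Prop :=
  ∀ w : V → ℝ, IsLip w → ∀ K : Set V, IsCompact K → K ⊆ B → (∀ x ∉ K, w x = v x) →
    energy F B v ≤ energy F B w

/-- `v` minimizes the energy among Lipschitz competitors below `v`. -/
def IsSubMin (F : V → ℝ) (B : Set V) (v : V → ℝ) : Prop :=
  ∀ w : V → ℝ, IsLip w → (∀ x, w x ≤ v x) → ∀ K : Set V, IsCompact K → K ⊆ B →
    (∀ x ∉ K, w x = v x) → energy F B v ≤ energy F B w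

variable {F : V → ℝ} {B : Set V}

omit [(volume : Measure V).IsAddHaarMeasure] in
lemma integrableOn_comp_gradient {W : Type*} [NormedAddCommGroup W] [MeasurableSpace W]
    [BorelSpace W] [SecondCountableTopology W] {G : V → W} (hGm : Measurable G)
    (hG : ∀ C : ℝ, ∃ D : ℝ, ∀ z, ‖z‖ ≤ C → ‖G z‖ ≤ D) {v : V → ℝ}
    (hv : IsLip v) (hB : volume B ≠ ∞) : IntegrableOn (fun x => G (gradient v x)) B := by
  obtain ⟨C, hC⟩ := hv
  obtain ⟨D, hD⟩ := hG C
  refine IntegrableOn.of_bound hB.lt_top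
    (hGm.comp (measurable_gradient v)).aestronglyMeasurable D ?_
  exact Filter.Eventually.of_forall fun x => hD _ (hC.norm_gradient_le x)

omit [MeasureSpace V] [BorelSpace V] [(volume : Measure V).IsAddHaarMeasure] in
lemma Continuous.exists_bound_closedBall {W : Type*} [NormedAddCommGroup W] {G : V → W}
    (hG : Continuous G) (C : ℝ) : ∃ D : ℝ, ∀ z, ‖z‖ ≤ C → ‖G z‖ ≤ D := by
  obtain ⟨D, hD⟩ := (isCompact_closedBall (0 : V) C).exists_bound_of_continuousOn hG.continuousOn
  exact ⟨D, fun z hz => hD z (by simpa using hz)⟩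

omit [(volume : Measure V).IsAddHaarMeasure] in
lemma integrableOn_energy (hF : Continuous F) {v : V → ℝ} (hv : IsLip v)
    (hB : volume B ≠ ∞) : IntegrableOn (fun x => F (gradient v x)) B :=
  integrableOn_comp_gradient hF.measurable hF.exists_bound_closedBall hv hB

lemma energy_sup_add_energy_inf (hF : Continuous F) (hB : volume B ≠ ∞) {f g : V → ℝ}
    (hf : IsLip f) (hg : IsLip g) :
    energy F B (fun x => f x ⊔ g x) + energy F B (fun x => f x ⊓ g x) =
      energy F B f + energy F B g := by
  unfold energy
  rw [← integral_add (integrableOn_energy hF (hf.sup hg) hB)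
    (integrableOn_energy hF (hf.inf hg) hB), ← integral_add (integrableOn_energy hF hf hB)
    (integrableOn_energy hF hg hB)]
  refine integral_congr_ae (ae_restrict_of_ae ?_)
  filter_upwards [ae_gradient_sup_inf hf hg] with x hx
  rcases le_total (g x) (f x) with h | h
  · rw [(hx.1 h).1, (hx.1 h).2]
  · rw [(hx.2 h).1, (hx.2 h).2, add_comm]

omit [BorelSpace V] [(volume : Measure V).IsAddHaarMeasure] in
lemma IsLipMin.isSubMin {v : V → ℝ} (h : IsLipMin F B v) : IsSubMin F B v :=
  fun w hw _ K hK hKB hwv => h w hw K hK hKB hwv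

lemma IsSubMin.energy_sup_le (hF : Continuous F) (hB : volume B ≠ ∞) {v w : V → ℝ}
    (h : IsSubMin F B v) (hv : IsLip v) (hw : IsLip w) {K : Set V} (hK : IsCompact K)
    (hKB : K ⊆ B) (hvw : ∀ x ∉ K, v x ≤ w x) :
    energy F B (fun x => w x ⊔ v x) ≤ energy F B w := by
  have h1 := h (fun x => w x ⊓ v x) (hw.inf hv) (fun x => inf_le_right) K hK hKB
    (fun x hx => inf_eq_right.2 (hvw x hx))
  have h2 := energy_sup_add_energy_inf hF hB hw hv
  linarith

lemma tendsto_integral_lineDeriv_mul {g : ℕ → V → ℝ} {C : ℝ≥0}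
    (hg : ∀ N, LipschitzWith C (g N)) (hlim : ∀ x, Tendsto (fun N => g N x) atTop (𝓝 0))
    (e : V) {ψ : V → ℝ} (hψ : Integrable ψ) :
    Tendsto (fun N => ∫ x, lineDeriv ℝ (g N) x e * ψ x) atTop (𝓝 0) := by
  obtain ⟨A, hA⟩ : ∃ A : ℝ, ∀ N, |g N 0| ≤ A := by
    obtain ⟨A, hA⟩ := ((hlim 0).abs).bddAbove_range
    exact ⟨A, fun N => hA ⟨N, rfl⟩⟩
  have hbd : ∀ N x, ‖lineDeriv ℝ (g N) x e‖ ≤ C * ‖e‖ := fun N x =>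
    norm_lineDeriv_le_of_lipschitz ℝ (hg N)
  have hmeas : ∀ N, AEStronglyMeasurable (fun x => lineDeriv ℝ (g N) x e) := fun N =>
    aestronglyMeasurable_lineDeriv (hg N).continuous _
  rw [Metric.tendsto_atTop]
  intro ε hε
  set δ : ℝ := ε / (2 * (C * ‖e‖ + 1)) with hδ
  have hpos : 0 < C * ‖e‖ + 1 := by positivity
  have hδ0 : 0 < δ := by positivity
  obtain ⟨Θ, hΘc, hΘs, hΘ⟩ := (memLp_one_iff_integrable.2 hψ).exist_eLpNorm_sub_le
    ENNReal.one_ne_top le_rfl hδ0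
  have hΘi : Integrable Θ := hΘs.continuous.integrable_of_hasCompactSupport hΘc
  have hΘ' : ∫ x, ‖ψ x - Θ x‖ ≤ δ := by
    change ∫ x, ‖(ψ - Θ) x‖ ≤ δ
    rw [integral_norm_eq_lintegral_enorm (hψ.sub hΘi).aestronglyMeasurable]
    refine ENNReal.toReal_le_of_le_ofReal hδ0.le ?_
    rw [eLpNorm_one_eq_lintegral_enorm] at hΘ
    exact hΘ
  obtain ⟨D, hD⟩ := hΘs.lipschitzWith_of_hasCompactSupport hΘc (by norm_num)
  have hΘlim : Tendsto (fun N => ∫ x, lineDeriv ℝ (g N) x e * Θ x) atTop (𝓝 0) := by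
    have e1 : ∀ N, ∫ x, lineDeriv ℝ (g N) x e * Θ x = ∫ x, lineDeriv ℝ Θ x (-e) * g N x :=
      fun N => (hg N).integral_lineDeriv_mul_eq hD hΘc e
    simp_rw [e1]
    have e2 : ∀ x, lineDeriv ℝ Θ x (-e) = fderiv ℝ Θ x (-e) := fun x =>
      (hΘs.differentiable (by norm_num) x).lineDeriv_eq_fderiv
    simp_rw [e2]
    have hcont : Continuous fun x => fderiv ℝ Θ x (-e) :=
      (hΘs.continuous_fderiv (by norm_num)).clm_apply continuous_const
    have hcs : HasCompactSupport fun x => fderiv ℝ Θ x (-e) := hΘc.fderiv_apply ℝ (-e)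
    rw [show (0 : ℝ) = ∫ x : V, (0 : ℝ) by simp]
    refine tendsto_integral_of_dominated_convergence
      (fun x => ‖fderiv ℝ Θ x (-e)‖ * (A + C * ‖x‖))
      (fun N => (hcont.mul (hg N).continuous).aestronglyMeasurable) ?_ (fun N => ?_) ?_
    · refine Continuous.integrable_of_hasCompactSupport (by fun_prop) ?_
      exact hcs.norm.mul_right
    · refine Filter.Eventually.of_forall fun x => ?_
      rw [norm_mul]
      gcongr
      have h1 := (hg N).dist_le_mul x 0
      rw [Real.dist_eq, dist_zero_right] at h1
      have h2 := abs_sub_abs_le_abs_sub (g N x) (g N 0)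
      have := hA N
      rw [Real.norm_eq_abs]
      linarith
    · refine Filter.Eventually.of_forall fun x => ?_
      simpa using (hlim x).const_mul (fderiv ℝ Θ x (-e))
  obtain ⟨N₀, hN₀⟩ := (Metric.tendsto_atTop.1 hΘlim) (ε / 2) (by positivity)
  refine ⟨N₀, fun N hN => ?_⟩
  have h1 := hN₀ N hN
  rw [dist_zero_right] at h1 ⊢
  have i1 : Integrable fun x => lineDeriv ℝ (g N) x e * Θ x :=
    hΘi.bdd_mul (hmeas N) (Filter.Eventually.of_forall (hbd N))
  have i2 : Integrable fun x => lineDeriv ℝ (g N) x e * (ψ x - Θ x) :=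
    (hψ.sub hΘi).bdd_mul (hmeas N) (Filter.Eventually.of_forall (hbd N))
  have e3 : ∫ x, lineDeriv ℝ (g N) x e * ψ x =
      (∫ x, lineDeriv ℝ (g N) x e * Θ x) + ∫ x, lineDeriv ℝ (g N) x e * (ψ x - Θ x) := by
    rw [← integral_add i1 i2]
    congr 1; ext x; ring
  have h2 : ‖∫ x, lineDeriv ℝ (g N) x e * (ψ x - Θ x)‖ ≤ C * ‖e‖ * δ := by
    calc _ ≤ ∫ x, ‖lineDeriv ℝ (g N) x e * (ψ x - Θ x)‖ := norm_integral_le_integral_norm _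
      _ ≤ ∫ x, C * ‖e‖ * ‖ψ x - Θ x‖ := by
          refine integral_mono i2.norm ((hψ.sub hΘi).norm.const_mul _) fun x => ?_
          simp only [norm_mul]
          gcongr
          exact hbd N x
      _ ≤ _ := by rw [integral_const_mul]; gcongr
  have h3 : C * ‖e‖ * δ < ε / 2 := by
    rw [hδ, mul_div_assoc', div_lt_div_iff₀ (by positivity) (by positivity)]
    nlinarith
  rw [e3]
  exact (norm_add_le _ _).trans_lt (by linarith)

lemma tendsto_integral_inner_gradient {g : ℕ → V → ℝ} {C : ℝ≥0}
    (hg : ∀ N, LipschitzWith C (g N)) (hlim : ∀ x, Tendsto (fun N => g N x) atTop (𝓝 0))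
    {ψ : V → V} (hψ : Integrable ψ) :
    Tendsto (fun N => ∫ x, inner ℝ (ψ x) (gradient (g N) x)) atTop (𝓝 0) := by
  set b := stdOrthonormalBasis ℝ V
  have hψi : ∀ i, Integrable fun x => inner ℝ (ψ x) (b i) := fun i => hψ.inner_const (b i)
  have e1 : ∀ N, ∫ x, inner ℝ (ψ x) (gradient (g N) x) =
      ∑ i, ∫ x, lineDeriv ℝ (g N) x (b i) * inner ℝ (ψ x) (b i) := by
    intro N
    rw [← integral_finsetSum]
    · refine integral_congr_ae ?_
      filter_upwards [(hg N).ae_differentiableAt] with x hx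
      rw [← b.sum_inner_mul_inner]
      refine Finset.sum_congr rfl fun i _ => ?_
      rw [hx.lineDeriv_eq_fderiv, ← inner_gradient_left, real_inner_comm (gradient (g N) x),
        mul_comm]
    · intro i _
      exact (hψi i).bdd_mul (aestronglyMeasurable_lineDeriv (hg N).continuous _)
        (Filter.Eventually.of_forall fun x => norm_lineDeriv_le_of_lipschitz ℝ (hg N))
  simp_rw [e1]
  rw [show (0 : ℝ) = ∑ i : Fin (Module.finrank ℝ V), (0 : ℝ) by simp]
  exact tendsto_finsetSum _ fun i _ => tendsto_integral_lineDeriv_mul hg hlim (b i) (hψi i)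

/-- Lower semicontinuity of the energy along uniformly Lipschitz sequences. -/
lemma energy_le_of_tendsto (hF : ConvexOn ℝ univ F) (hd : Differentiable ℝ F)
    (hgb : ∀ C : ℝ, ∃ D : ℝ, ∀ z, ‖z‖ ≤ C → ‖gradient F z‖ ≤ D)
    (hB : volume B ≠ ∞) (hBm : MeasurableSet B) {m : ℕ → V → ℝ} {v : V → ℝ} {C : ℝ≥0}
    (hm : ∀ N, LipschitzWith C (m N))
    (hv : LipschitzWith C v) (hlim : ∀ x, Tendsto (fun N => m N x) atTop (𝓝 (v x)))
    {A : ℝ} (hA : ∀ N, energy F B (m N) ≤ A) : energy F B v ≤ A := by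
  set ψ : V → V := B.indicator fun x => gradient F (gradient v x) with hψ
  have hψi : IntegrableOn (fun x => gradient F (gradient v x)) B :=
    integrableOn_comp_gradient (measurable_gradient F) hgb ⟨C, hv⟩ hB
  have hψi' : Integrable ψ := (integrable_indicator_iff hBm).2 hψi
  have hg : ∀ N, LipschitzWith (C + C) (fun x => m N x - v x) := fun N => (hm N).sub hv
  have h1 := tendsto_integral_inner_gradient hg (fun x => by
    simpa using (hlim x).sub_const (v x)) hψi'
  have h2 : ∀ N, energy F B v + ∫ x, inner ℝ (ψ x) (gradient (fun x => m N x - v x) x) ≤ A := by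
    intro N
    refine le_trans ?_ (hA N)
    have e1 : ∫ x, inner ℝ (ψ x) (gradient (fun x => m N x - v x) x) =
        ∫ x in B, inner ℝ (gradient F (gradient v x)) (gradient (fun x => m N x - v x) x) := by
      rw [← integral_indicator hBm]
      congr 1; ext x
      by_cases hx : x ∈ B <;> simp [hψ, hx]
    have i1 : IntegrableOn (fun x =>
        inner ℝ (gradient F (gradient v x)) (gradient (fun x => m N x - v x) x)) B := by
      refine Integrable.mono' (hψi.norm.const_mul ((C : ℝ) + C))
        (hψi.aestronglyMeasurable.inner (measurable_gradient _).aestronglyMeasurable) ?_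
      refine Filter.Eventually.of_forall fun x => (norm_inner_le_norm _ _).trans ?_
      rw [mul_comm]
      gcongr
      exact_mod_cast (hg N).norm_gradient_le x
    rw [e1]
    unfold energy
    have hFc := hd.continuous
    rw [← integral_add (integrableOn_energy hFc ⟨C, hv⟩ hB) i1]
    refine integral_mono_ae ((integrableOn_energy hFc ⟨C, hv⟩ hB).add i1)
      (integrableOn_energy hFc ⟨C, hm N⟩ hB) (ae_restrict_of_ae ?_)
    filter_upwards [(hm N).ae_differentiableAt, hv.ae_differentiableAt] with x h3 h4
    rw [gradient_sub h3 h4, inner_gradient_left]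
    exact hF.add_fderiv_sub_le (hd _) _
  have h3 := (h1.const_add (energy F B v))
  rw [add_zero] at h3
  exact le_of_tendsto' h3 h2

/-- A supremum of countably many sub-minimizers is a sub-minimizer. -/
lemma IsSubMin.iSup (hF : ConvexOn ℝ univ F) (hd : Differentiable ℝ F)
    (hgb : ∀ C : ℝ, ∃ D : ℝ, ∀ z, ‖z‖ ≤ C → ‖gradient F z‖ ≤ D)
    (hB : volume B ≠ ∞) (hBm : MeasurableSet B) {v : ℕ → V → ℝ} {u : V → ℝ} {C : ℝ≥0}
    (hv : ∀ N, LipschitzWith C (v N)) (hu : LipschitzWith C u)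
    (hvs : ∀ N, IsSubMin F B (v N)) (hle : ∀ N x, v N x ≤ u x)
    (hsup : ∀ x, ∀ ε > 0, ∃ N, u x - ε < v N x) : IsSubMin F B u := by
  intro w hw hwu K hK hKB hwK
  obtain ⟨D, hD⟩ := hw
  let m : ℕ → V → ℝ := fun N => Nat.rec w (fun N f x => f x ⊔ v N x) N
  have hm0 : m 0 = w := rfl
  have hmS : ∀ N, m (N + 1) = fun x => m N x ⊔ v N x := fun N => rfl
  have hmono : ∀ x, Monotone fun N => m N x := fun x => monotone_nat_of_le_succ fun N => by
    rw [hmS]; exact le_sup_left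
  have hmL : ∀ N, LipschitzWith (max C D) (m N) := by
    intro N
    induction N with
    | zero => rw [hm0]; exact hD.weaken (le_max_right _ _)
    | succ N ih =>
      rw [hmS]
      simpa using ih.max ((hv N).weaken (le_max_left C D))
  have hmu : ∀ N x, m N x ≤ u x := by
    intro N
    induction N with
    | zero => exact hwu
    | succ N ih => intro x; rw [hmS]; exact sup_le (ih x) (hle N x)
  have hmE : ∀ N, energy F B (m N) ≤ energy F B w := by
    intro N
    induction N with
    | zero => exact le_rfl
    | succ N ih =>
      rw [hmS]
      refine ((hvs N).energy_sup_le hd.continuous hB ⟨C, hv N⟩ ⟨_, hmL N⟩ hK hKB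
        fun x hx => ?_).trans ih
      calc v N x ≤ u x := hle N x
        _ = m 0 x := (hwK x hx).symm
        _ ≤ m N x := hmono x (Nat.zero_le N)
  refine energy_le_of_tendsto hF hd hgb hB hBm hmL (hu.weaken (le_max_left _ _))
    (fun x => ?_) hmE
  rw [Metric.tendsto_atTop]
  intro ε hε
  obtain ⟨N, hN⟩ := hsup x ε hε
  refine ⟨N + 1, fun n hn => ?_⟩
  have h1 : v N x ≤ m n x := le_trans le_sup_right (hmono x hn)
  have h2 := hmu n x
  rw [Real.dist_eq, abs_sub_comm, abs_of_nonneg (by linarith)]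
  linarith

/-- The one-sided Euler-Lagrange inequality. -/
lemma integral_inner_nonneg_of_energy_le (hd : Differentiable ℝ F) (hFc : ConvexOn ℝ univ F)
    (hB : volume B ≠ ∞) {v η : V → ℝ} (hv : IsLip v) (hη : IsLip η)
    (h : ∀ t : ℝ, 0 < t → energy F B v ≤ energy F B (fun x => v x + t * η x)) :
    0 ≤ ∫ x in B, inner ℝ (gradient F (gradient v x)) (gradient η x) := by
  obtain ⟨C, hC⟩ := hv
  obtain ⟨D, hD⟩ := hη
  obtain ⟨A, hA⟩ := hFc.exists_lipschitzOnWith_closedBall (C + D : ℝ)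
  have hFc' := hd.continuous
  have hlim : Tendsto (fun t : ℝ => ∫ x in B,
      t⁻¹ * (F (gradient v x + t • gradient η x) - F (gradient v x))) (𝓝[>] 0)
      (𝓝 (∫ x in B, inner ℝ (gradient F (gradient v x)) (gradient η x))) := by
    refine tendsto_integral_filter_of_dominated_convergence (fun _ => (A : ℝ) * D) ?_ ?_ ?_ ?_
    · refine Filter.Eventually.of_forall fun t => ?_
      refine Measurable.aestronglyMeasurable ?_
      have h1 := measurable_gradient v
      have h2 := measurable_gradient η
      have h3 : Measurable fun x => F (gradient v x + t • gradient η x) :=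
        hFc'.measurable.comp (h1.add (h2.const_smul t))
      exact (h3.sub (hFc'.measurable.comp h1)).const_mul _
    · filter_upwards [Ioo_mem_nhdsGT (zero_lt_one' ℝ)] with t ht
      refine Filter.Eventually.of_forall fun x => ?_
      have h1 := hC.norm_gradient_le x
      have h2 := hD.norm_gradient_le x
      have h3 := hA.dist_le_mul (gradient v x + t • gradient η x)
        (by
          rw [mem_closedBall_zero_iff]
          refine (norm_add_le _ _).trans (add_le_add h1 ?_)
          rw [norm_smul, Real.norm_of_nonneg ht.1.le]
          nlinarith [ht.2, norm_nonneg (gradient η x)])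
        (gradient v x) (by
          rw [mem_closedBall_zero_iff]
          linarith [D.coe_nonneg])
      rw [dist_eq_norm, dist_eq_norm, add_sub_cancel_left, norm_smul,
        Real.norm_of_nonneg ht.1.le] at h3
      rw [norm_mul, norm_inv, Real.norm_of_nonneg ht.1.le, inv_mul_le_iff₀ ht.1]
      refine h3.trans ?_
      have : (A : ℝ) * (t * ‖gradient η x‖) ≤ A * (t * D) := by
        have := ht.1.le
        gcongr
      linarith
    · exact integrableOn_const hB
    · refine Filter.Eventually.of_forall fun x => ?_
      rw [inner_gradient_left]
      have h1 : HasDerivAt (fun t : ℝ => F (gradient v x + t • gradient η x))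
          (fderiv ℝ F (gradient v x) (gradient η x)) 0 := by
        have h0 : HasFDerivAt F (fderiv ℝ F (gradient v x))
            (gradient v x + (0 : ℝ) • gradient η x) := by
          simpa using (hd (gradient v x)).hasFDerivAt
        have h1 : HasDerivAt (fun t : ℝ => gradient v x + t • gradient η x) (gradient η x) 0 := by
          simpa using ((hasDerivAt_id (0 : ℝ)).smul_const (gradient η x)).const_add (gradient v x)
        exact h0.comp_hasDerivAt 0 h1
      have h2 := h1.tendsto_slope_zero_right
      simpa using h2
  refine ge_of_tendsto hlim ?_
  filter_upwards [self_mem_nhdsWithin] with t ht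
  have ht0 : 0 < t := ht
  rw [integral_const_mul]
  refine mul_nonneg (inv_nonneg.2 ht0.le) ?_
  have hvt : IsLip fun x => v x + t * η x := IsLip.add ⟨C, hC⟩ (IsLip.const_mul t ⟨D, hD⟩)
  have i1 := integrableOn_energy hFc' hvt hB
  have hae : ∀ᵐ x ∂(volume.restrict B), F (gradient (fun y => v y + t * η y) x) =
      F (gradient v x + t • gradient η x) := by
    refine ae_restrict_of_ae ?_
    filter_upwards [hC.ae_differentiableAt, hD.ae_differentiableAt] with x h1 h2
    rw [gradient_add_smul h1 h2]
  have h1 := h t ht0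
  unfold energy at h1
  rw [integral_congr_ae hae] at h1
  rw [integral_sub (i1.congr hae) (integrableOn_energy hFc' ⟨C, hC⟩ hB)]
  linarith

end Energy

section SupConvolution

variable {V : Type*} [NormedAddCommGroup V] [InnerProductSpace ℝ V]

/-- The maximum over `s ∈ [0, h]` of the translates `U (x + s e) - k s`. -/
def supConv (U : V → ℝ) (e : V) (k h : ℝ) (x : V) : ℝ :=
  sSup ((fun s : ℝ => U (x + s • e) - k * s) '' Icc 0 h)

variable {U : V → ℝ} {e : V} {k h : ℝ}

lemma le_supConv_and_exists (hU : Continuous U) (hh : 0 ≤ h) (x : V) :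
    (∀ s ∈ Icc 0 h, U (x + s • e) - k * s ≤ supConv U e k h x) ∧
      ∃ s ∈ Icc 0 h, supConv U e k h x = U (x + s • e) - k * s := by
  have hc : Continuous fun s : ℝ => U (x + s • e) - k * s := by fun_prop
  have hcpt := (isCompact_Icc (a := (0 : ℝ)) (b := h)).image hc
  have hne : ((fun s : ℝ => U (x + s • e) - k * s) '' Icc 0 h).Nonempty :=
    (nonempty_Icc.2 hh).image _
  refine ⟨fun s hs => le_csSup hcpt.bddAbove ⟨s, hs, rfl⟩, ?_⟩
  obtain ⟨s, hs, hse⟩ := hcpt.sSup_mem hne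
  exact ⟨s, hs, hse.symm⟩

lemma le_supConv (hU : Continuous U) (hh : 0 ≤ h) (x : V) : U x ≤ supConv U e k h x := by
  simpa using (le_supConv_and_exists (e := e) (k := k) hU hh x).1 0 ⟨le_rfl, hh⟩

lemma supConv_lipschitzOnWith (hU : Continuous U) (hh : 0 ≤ h) {M : ℝ≥0} {S S' : Set V}
    (hM : LipschitzOnWith M U S') (hS : ∀ x ∈ S, ∀ s ∈ Icc 0 h, x + s • e ∈ S') :
    LipschitzOnWith M (supConv U e k h) S := by
  refine LipschitzOnWith.of_le_add_mul M fun x hx y hy => ?_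
  obtain ⟨s, hs, hse⟩ := (le_supConv_and_exists (e := e) (k := k) hU hh x).2
  have h1 := (le_supConv_and_exists (e := e) (k := k) hU hh y).1 s hs
  have h2 := hM.le_add_mul (hS x hx s hs) (hS y hy s hs)
  rw [dist_add_right] at h2
  linarith

lemma supConv_sub_le (hU : Continuous U) (hh : 0 ≤ h) (hk : 0 ≤ k) (he : ‖e‖ = 1) {M : ℝ≥0}
    {S' : Set V} (hM : LipschitzOnWith M U S') {x : V} (hS : ∀ s ∈ Icc 0 h, x + s • e ∈ S') :
    supConv U e k h x - U x ≤ M * h := by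
  obtain ⟨s, hs, hse⟩ := (le_supConv_and_exists (e := e) (k := k) hU hh x).2
  have h2 := hM.le_add_mul (hS s hs) (by simpa using hS 0 ⟨le_rfl, hh⟩)
  rw [dist_eq_norm, add_sub_cancel_left, norm_smul, he, mul_one, Real.norm_of_nonneg hs.1] at h2
  have h3 : (M : ℝ) * s ≤ M * h := by gcongr; exact hs.2
  have h4 := mul_nonneg hk hs.1
  linarith

lemma le_norm_gradient_supConv [CompleteSpace V] (hU : Continuous U) (hh : 0 ≤ h) (he : ‖e‖ = 1)
    {x : V} (hd : DifferentiableAt ℝ (supConv U e k h) x) (hx : U x < supConv U e k h x) :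
    k ≤ ‖gradient (supConv U e k h) x‖ := by
  obtain ⟨s, hs, hse⟩ := (le_supConv_and_exists (e := e) (k := k) hU hh x).2
  have hs0 : 0 < s := by
    rcases hs.1.eq_or_lt with h0 | h0
    · rw [← h0] at hse
      simp only [zero_smul, add_zero, mul_zero, sub_zero] at hse
      linarith
    · exact h0
  have h1 : HasDerivAt (fun t : ℝ => supConv U e k h (x + t • e))
      (inner ℝ (gradient (supConv U e k h) x) e) 0 := by
    rw [inner_gradient_left]
    have h0 : HasFDerivAt (supConv U e k h) (fderiv ℝ (supConv U e k h) x)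
        (x + (0 : ℝ) • e) := by
      simpa using hd.hasFDerivAt
    have h1 : HasDerivAt (fun t : ℝ => x + t • e) e 0 := by
      simpa using ((hasDerivAt_id (0 : ℝ)).smul_const e).const_add x
    exact h0.comp_hasDerivAt 0 h1
  have h2 : k ≤ inner ℝ (gradient (supConv U e k h) x) e := by
    refine ge_of_tendsto h1.tendsto_slope_zero_right ?_
    filter_upwards [Ioo_mem_nhdsGT hs0] with t ht
    have h3 := (le_supConv_and_exists (e := e) (k := k) hU hh (x + t • e)).1 (s - t)
      ⟨by linarith [ht.2], by linarith [ht.1, hs.2]⟩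
    have e1 : x + t • e + (s - t) • e = x + s • e := by module
    rw [e1] at h3
    simp only [zero_add, zero_smul, add_zero, smul_eq_mul]
    rw [le_inv_mul_iff₀ ht.1]
    linarith
  refine h2.trans ((real_inner_le_norm _ _).trans ?_)
  rw [he, mul_one]

lemma supConv_sub_lt (hU : Continuous U) (hh : 0 ≤ h) (x : V) {d : ℝ}
    (hx : supConv U e k h x - U x ≤ d) : U (x + h • e) - U x ≤ k * h + d := by
  have := (le_supConv_and_exists (e := e) (k := k) hU hh x).1 h ⟨hh, le_rfl⟩
  linarith

end SupConvolution

lemma integrableOn_of_bounded {X : Type*} [MeasureSpace X] {B : Set X} {f : X → ℝ}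
    (hf : Measurable f) (hB : volume B ≠ ∞) {A : ℝ} (h : ∀ x, |f x| ≤ A) : IntegrableOn f B :=
  IntegrableOn.of_bound hB.lt_top hf.aestronglyMeasurable A (Filter.Eventually.of_forall h)

section Minimizers

variable {V : Type*} [NormedAddCommGroup V] [InnerProductSpace ℝ V] [FiniteDimensional ℝ V]

lemma gradient_mul {f g : V → ℝ} {x : V} (hf : DifferentiableAt ℝ f x)
    (hg : DifferentiableAt ℝ g x) :
    gradient (fun y => f y * g y) x = f x • gradient g x + g x • gradient f x := by
  simp only [gradient, fderiv_fun_mul hf hg, map_add, map_smul]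

lemma gradient_neg (f : V → ℝ) (x : V) : gradient (fun y => -f y) x = -gradient f x := by
  simp only [gradient, fderiv_fun_neg, map_neg]

lemma gradient_eq_of_eq_off {f g : V → ℝ} {K : Set V} (hK : IsCompact K)
    (h : ∀ x ∉ K, f x = g x) {x : V} (hx : x ∉ K) : gradient f x = gradient g x := by
  refine Filter.EventuallyEq.gradient_eq ?_
  filter_upwards [hK.isClosed.isOpen_compl.mem_nhds hx] with y hy using h y hy

variable [MeasureSpace V] [BorelSpace V] [(volume : Measure V).IsAddHaarMeasure]
variable {F : V → ℝ} {B : Set V}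

omit [(volume : Measure V).IsAddHaarMeasure] in
lemma IsLipMin.mono (hF : Continuous F) {B' : Set V} {U : V → ℝ} (h : IsLipMin F B U)
    (hU : IsLip U) (hB : volume B ≠ ∞) (hBm : MeasurableSet B)
    (hB' : MeasurableSet B') (hsub : B' ⊆ B) :
    IsLipMin F B' U := by
  intro w hw K hK hKB hwK
  have h1 := h w hw K hK (hKB.trans hsub) hwK
  have key : ∀ v, IsLip v → energy F B v = energy F B' v + ∫ x in B \ B', F (gradient v x) := by
    intro v hv
    have h2 := integral_inter_add_sdiff hB' (integrableOn_energy hF hv hB)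
    rw [inter_eq_right.2 hsub] at h2
    exact h2.symm
  rw [key U hU, key w hw] at h1
  have h3 : ∫ x in B \ B', F (gradient w x) = ∫ x in B \ B', F (gradient U x) := by
    refine setIntegral_congr_fun (hBm.diff hB') fun x hx => ?_
    simp only [gradient_eq_of_eq_off hK hwK fun hxK => hx.2 (hKB hxK)]
  linarith

lemma energy_translate (x₀ a : V) (ρ k : ℝ) (v : V → ℝ) :
    energy F (ball x₀ ρ) (fun x => v (x + a) - k) = energy F (ball (x₀ + a) ρ) v := by
  unfold energy
  have e1 : ∀ x, gradient (fun x => v (x + a) - k) x = gradient v (x + a) := by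
    intro x
    simp only [gradient, fderiv_sub_const]
    rw [fderiv_comp_add_right]
  simp_rw [e1]
  have h := (measurePreserving_add_right (volume : Measure V) a).setIntegral_preimage_emb
    (measurableEmbedding_addRight a) (fun x => F (gradient v x)) (ball (x₀ + a) ρ)
  rw [← h]
  congr 2
  ext x
  simp [dist_eq_norm]

lemma IsLipMin.translate {x₀ a : V} {ρ : ℝ} {U : V → ℝ} (k : ℝ)
    (h : IsLipMin F (ball (x₀ + a) ρ) U) :
    IsLipMin F (ball x₀ ρ) (fun x => U (x + a) - k) := by
  intro w hw K hK hKB hwK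
  have e1 : w = fun x => (fun y => w (y - a) + k) (x + a) - k := by ext x; simp
  rw [energy_translate, e1, energy_translate x₀ a ρ k fun y => w (y - a) + k]
  obtain ⟨C, hC⟩ := hw
  refine h _ ⟨C, ?_⟩ ((fun x => x + a) '' K) (hK.image (by fun_prop)) ?_ ?_
  · refine LipschitzWith.of_dist_le_mul fun x y => ?_
    simpa using hC.dist_le_mul (x - a) (y - a)
  · rintro _ ⟨x, hx, rfl⟩
    simpa using hKB hx
  · intro y hy
    have : y - a ∉ K := fun hya => hy ⟨y - a, hya, by simp⟩
    simp [hwK _ this]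

lemma supConv_isSubMin (hF : ConvexOn ℝ univ F) (hd : Differentiable ℝ F)
    (hgb : ∀ C : ℝ, ∃ D : ℝ, ∀ z, ‖z‖ ≤ C → ‖gradient F z‖ ≤ D) {U : V → ℝ} (hU : IsLip U)
    {x₀ e : V} (he : ‖e‖ = 1) {R k h : ℝ} (hh : 0 ≤ h) (hmin : IsLipMin F (ball x₀ R) U) :
    IsSubMin F (ball x₀ (R - h)) (supConv U e k h) := by
  have hUc := hU.continuous
  obtain ⟨C, hC⟩ := hU
  have : Nonempty (Icc (0 : ℝ) h) := ⟨⟨0, le_rfl, hh⟩⟩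
  set σ : ℕ → Icc (0 : ℝ) h := TopologicalSpace.denseSeq (Icc (0 : ℝ) h) with hσ
  refine IsSubMin.iSup hF hd hgb measure_ball_lt_top.ne measurableSet_ball (C := C)
    (v := fun N x => U (x + (σ N : ℝ) • e) - k * (σ N : ℝ)) (fun N => ?_) ?_ (fun N => ?_)
    (fun N x => (le_supConv_and_exists hUc hh x).1 _ (σ N).2) fun x ε hε => ?_
  · refine LipschitzWith.of_dist_le_mul fun x y => ?_
    simpa using hC.dist_le_mul (x + (σ N : ℝ) • e) (y + (σ N : ℝ) • e)
  · rw [← lipschitzOnWith_univ]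
    exact supConv_lipschitzOnWith hUc hh (lipschitzOnWith_univ.2 hC) fun _ _ _ _ => mem_univ _
  · refine IsLipMin.isSubMin (IsLipMin.translate _ (hmin.mono hd.continuous ⟨C, hC⟩
      measure_ball_lt_top.ne measurableSet_ball measurableSet_ball ?_))
    intro y hy
    rw [mem_ball, dist_eq_norm] at hy ⊢
    have h1 : y - x₀ = (y - (x₀ + (σ N : ℝ) • e)) + (σ N : ℝ) • e := by module
    rw [h1]
    refine (norm_add_le _ _).trans_lt ?_
    rw [norm_smul, he, mul_one, Real.norm_of_nonneg (σ N).2.1]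
    linarith [(σ N).2.2]
  · obtain ⟨s, hs, hse⟩ := (le_supConv_and_exists (e := e) (k := k) hUc hh x).2
    rw [hse]
    have hc : Continuous fun s : Icc (0 : ℝ) h => U (x + (s : ℝ) • e) - k * (s : ℝ) := by
      fun_prop
    have hopen : IsOpen {s' : Icc (0 : ℝ) h | U (x + s • e) - k * s - ε <
        U (x + (s' : ℝ) • e) - k * (s' : ℝ)} := isOpen_lt continuous_const hc
    obtain ⟨N, h1⟩ := (TopologicalSpace.denseRange_denseSeq (Icc (0 : ℝ) h)).exists_mem_open
      hopen ⟨⟨s, hs⟩, by simp [hε]⟩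
    exact ⟨N, h1⟩


/-- The weak inequality obtained by testing a sub-minimizer and a minimizer with the same
nonnegative function. -/
lemma integral_inner_gradient_sub_nonpos (hF : ConvexOn ℝ univ F) (hd : Differentiable ℝ F)
    (hgb : ∀ C : ℝ, ∃ D : ℝ, ∀ z, ‖z‖ ≤ C → ‖gradient F z‖ ≤ D)
    (hB : volume B ≠ ∞) {U v η : V → ℝ} (hU : IsLip U) (hv : IsLip v)
    (hUmin : IsLipMin F B U) (hvmin : IsSubMin F B v) (hη : IsLip η) (hη0 : ∀ x, 0 ≤ η x)
    {K : Set V} (hK : IsCompact K) (hKB : K ⊆ B) (hηK : ∀ x ∉ K, η x = 0) :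
    IntegrableOn (fun x => inner ℝ (gradient F (gradient v x) - gradient F (gradient U x))
        (gradient η x)) B ∧
      ∫ x in B, inner ℝ (gradient F (gradient v x) - gradient F (gradient U x))
        (gradient η x) ≤ 0 := by
  have hηn : IsLip fun x => -η x := by simpa using hη.const_mul (-1)
  have h1 := integral_inner_nonneg_of_energy_le hd hF hB hv hηn fun t ht =>
    hvmin _ (hv.add (hηn.const_mul t))
      (fun x => by nlinarith [hη0 x, mul_nonneg ht.le (hη0 x)]) K hK hKB
      (fun x hx => by simp [hηK x hx])
  have h2 := integral_inner_nonneg_of_energy_le hd hF hB hU hη fun t ht =>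
    hUmin _ (hU.add (hη.const_mul t)) K hK hKB (fun x hx => by simp [hηK x hx])
  have hi : ∀ w, IsLip w →
      IntegrableOn (fun x => inner ℝ (gradient F (gradient w x)) (gradient η x)) B := by
    intro w hw
    have hψi : IntegrableOn (fun x => gradient F (gradient w x)) B :=
      integrableOn_comp_gradient (measurable_gradient F) hgb hw hB
    obtain ⟨C, hC⟩ := hη
    refine Integrable.mono' (hψi.norm.const_mul (C : ℝ))
      (hψi.aestronglyMeasurable.inner (measurable_gradient _).aestronglyMeasurable) ?_
    refine Filter.Eventually.of_forall fun x => (norm_inner_le_norm _ _).trans ?_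
    rw [mul_comm]
    gcongr
    exact hC.norm_gradient_le x
  simp_rw [gradient_neg, inner_neg_right] at h1
  rw [integral_neg] at h1
  simp_rw [inner_sub_left]
  refine ⟨(hi v hv).sub (hi U hU), ?_⟩
  rw [integral_sub (hi v hv) (hi U hU)]
  linarith

/-- Caccioppoli inequality for the truncations of `v - U`, where `v` is a sub-minimizer and `U`
a minimizer. -/
lemma caccioppoli (hF : ConvexOn ℝ univ F) (hd : Differentiable ℝ F)
    (hgb : ∀ C : ℝ, ∃ D : ℝ, ∀ z, ‖z‖ ≤ C → ‖gradient F z‖ ≤ D)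
    (hB : volume B ≠ ∞) {U v φ : V → ℝ} (hU : IsLip U) (hv : IsLip v)
    (hUmin : IsLipMin F B U) (hvmin : IsSubMin F B v) {lam Lam A l : ℝ} (hlam : 0 < lam)
    (hLam : 0 < Lam) (hl : 0 ≤ l) (hA : ∀ x, |v x - U x| ≤ A)
    (hmono : ∀ᵐ x ∂(volume.restrict B), U x < v x →
      lam * ‖gradient v x - gradient U x‖ ^ 2 ≤
          inner ℝ (gradient F (gradient v x) - gradient F (gradient U x))
            (gradient v x - gradient U x) ∧
        ‖gradient F (gradient v x) - gradient F (gradient U x)‖ ^ 2 ≤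
          Lam * inner ℝ (gradient F (gradient v x) - gradient F (gradient U x))
            (gradient v x - gradient U x))
    (hφ : IsLip φ) (hφ0 : ∀ x, 0 ≤ φ x) (hφ1 : ∀ x, φ x ≤ 1) {K : Set V} (hK : IsCompact K)
    (hKB : K ⊆ B) (hφK : ∀ x ∉ K, φ x = 0) :
    ∫ x in B, ‖gradient (fun y => φ y * ((v y - U y - l) ⊔ 0)) x‖ ^ 2 ≤
      (2 + 8 * (Lam / lam)) * ∫ x in B, ((v x - U x - l) ⊔ 0) ^ 2 * ‖gradient φ x‖ ^ 2 := by
  have hd0 : IsLip fun x => v x - U x - l := (hv.sub hU).sub (IsLip.const l)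
  set g : V → ℝ := fun x => (v x - U x - l) ⊔ 0 with hg
  have hgL : IsLip g := hd0.sup (IsLip.const 0)
  have hg0 : ∀ x, 0 ≤ g x := fun x => le_sup_right
  have hgA : ∀ x, |g x| ≤ A := fun x => by
    rw [abs_of_nonneg (hg0 x)]
    have := hA x
    have h2 := le_abs_self (v x - U x)
    exact sup_le (by linarith) ((abs_nonneg _).trans this)
  have hφA : ∀ x, |φ x| ≤ 1 := fun x => by rw [abs_of_nonneg (hφ0 x)]; exact hφ1 x
  have hφg : IsLip fun x => φ x * g x := hφ.mul hgL hφA hgA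
  have hφgA : ∀ x, |φ x * g x| ≤ A := fun x => by
    rw [abs_mul]
    calc _ ≤ 1 * A := mul_le_mul (hφA x) (hgA x) (abs_nonneg _) zero_le_one
      _ = A := one_mul A
  have hη : IsLip fun x => φ x * (φ x * g x) := hφ.mul hφg hφA hφgA
  obtain ⟨hi1, hi2⟩ := integral_inner_gradient_sub_nonpos hF hd hgb hB hU hv hUmin hvmin hη
    (fun x => mul_nonneg (hφ0 x) (mul_nonneg (hφ0 x) (hg0 x))) hK hKB
    (fun x hx => by simp [hφK x hx])
  have hA0 : 0 ≤ A := (abs_nonneg _).trans (hA 0)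
  have hgφi : IntegrableOn (fun x => g x ^ 2 * ‖gradient φ x‖ ^ 2) B := by
    obtain ⟨C, hC⟩ := hφ
    refine integrableOn_of_bounded ((hgL.continuous.measurable.pow_const 2).mul
      ((measurable_gradient φ).norm.pow_const 2)) hB (A := A ^ 2 * C ^ 2) fun x => ?_
    rw [abs_of_nonneg (by positivity), ← sq_abs (g x)]
    gcongr
    · exact hgA x
    · exact hC.norm_gradient_le x
  have hGi : IntegrableOn (fun x => ‖gradient (fun y => φ y * g y) x‖ ^ 2) B := by
    obtain ⟨C, hC⟩ := hφg
    refine integrableOn_of_bounded ((measurable_gradient _).norm.pow_const 2) hB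
      (A := C ^ 2) fun x => ?_
    rw [abs_of_nonneg (by positivity)]
    gcongr
    exact hC.norm_gradient_le x
  have hpt : ∀ᵐ x ∂(volume.restrict B), ‖gradient (fun y => φ y * g y) x‖ ^ 2 -
      (2 + 8 * (Lam / lam)) * (g x ^ 2 * ‖gradient φ x‖ ^ 2) ≤
      4 / lam * inner ℝ (gradient F (gradient v x) - gradient F (gradient U x))
        (gradient (fun y => φ y * (φ y * g y)) x) := by
    filter_upwards [hmono, ae_restrict_of_ae (ae_gradient_sup_inf hd0 (IsLip.const 0)),
      ae_restrict_of_ae hφ.ae_differentiableAt, ae_restrict_of_ae hgL.ae_differentiableAt,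
      ae_restrict_of_ae hφg.ae_differentiableAt, ae_restrict_of_ae hU.ae_differentiableAt,
      ae_restrict_of_ae hv.ae_differentiableAt] with x h1 h2 h3 h4 h5 h6 h7
    rw [gradient_mul h3 h5, gradient_mul h3 h4]
    have h8 : gradient (fun y => v y - U y - l) x = gradient v x - gradient U x := by
      rw [← gradient_sub h7 h6]
      simp only [gradient, fderiv_sub_const]
    have h9 : gradient (fun _ : V => (0 : ℝ)) x = 0 := gradient_fun_const x 0
    set G := gradient F (gradient v x) - gradient F (gradient U x)
    set f := gradient v x - gradient U x
    set P := gradient φ x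
    rcases le_or_gt (v x - U x - l) 0 with h | h
    · have hgx : g x = 0 := sup_eq_right.2 h
      have hgg : gradient g x = 0 := by rw [← h9]; exact (h2.2 h).1
      simp [hgx, hgg]
    · have hgg : gradient g x = f := by rw [← h8]; exact (h2.1 h.le).1
      obtain ⟨h10, h11⟩ := h1 (by linarith)
      rw [hgg]
      simp only [inner_add_right, inner_smul_right]
      set Q := inner ℝ G f
      have h12 : -(‖G‖ * ‖P‖) ≤ inner ℝ G P := by
        have := abs_real_inner_le_norm G P
        rw [abs_le] at this
        exact this.1
      have h13 : ‖φ x • f + g x • P‖ ^ 2 ≤ 2 * (φ x ^ 2 * ‖f‖ ^ 2) + 2 * (g x ^ 2 * ‖P‖ ^ 2) := by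
        have h14 : ‖φ x • f + g x • P‖ ≤ φ x * ‖f‖ + g x * ‖P‖ := by
          refine (norm_add_le _ _).trans ?_
          rw [norm_smul, norm_smul, Real.norm_of_nonneg (hφ0 x), Real.norm_of_nonneg (hg0 x)]
        calc _ ≤ (φ x * ‖f‖ + g x * ‖P‖) ^ 2 := by gcongr
          _ ≤ _ := by nlinarith [sq_nonneg (φ x * ‖f‖ - g x * ‖P‖)]
      have h15 : φ x ^ 2 * ‖f‖ ^ 2 ≤ 1 / lam * (φ x ^ 2 * Q) := by
        rw [one_div, le_inv_mul_iff₀ hlam]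
        nlinarith [mul_le_mul_of_nonneg_left h10 (sq_nonneg (φ x))]
      have h16 : 2 * (φ x * g x * (‖G‖ * ‖P‖)) ≤
          φ x ^ 2 * Q / 2 + 2 * Lam * (g x ^ 2 * ‖P‖ ^ 2) := by
        have h17 : φ x ^ 2 * (‖G‖ ^ 2 / Lam) ≤ φ x ^ 2 * Q := by
          refine mul_le_mul_of_nonneg_left ?_ (sq_nonneg _)
          rw [div_le_iff₀ hLam]; linarith
        have h18 : 0 ≤ (φ x * ‖G‖ / 2 - Lam * (g x * ‖P‖)) ^ 2 * (2 / Lam) := by positivity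
        have h19 : (φ x * ‖G‖ / 2 - Lam * (g x * ‖P‖)) ^ 2 * (2 / Lam) =
            φ x ^ 2 * (‖G‖ ^ 2 / Lam) / 2 - 2 * (φ x * g x * (‖G‖ * ‖P‖)) +
              2 * Lam * (g x ^ 2 * ‖P‖ ^ 2) := by
          field_simp
          ring
        linarith
      have h20 : φ x * g x * -(‖G‖ * ‖P‖) ≤ φ x * g x * inner ℝ G P :=
        mul_le_mul_of_nonneg_left h12 (mul_nonneg (hφ0 x) (hg0 x))
      have h21 : φ x ^ 2 * Q / 2 - 2 * Lam * (g x ^ 2 * ‖P‖ ^ 2) ≤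
          φ x * (φ x * Q + g x * inner ℝ G P) + φ x * g x * inner ℝ G P := by
        nlinarith
      have h22 := mul_le_mul_of_nonneg_left h21 (by positivity : 0 ≤ 4 / lam)
      have h23 : 4 / lam * (φ x ^ 2 * Q / 2 - 2 * Lam * (g x ^ 2 * ‖P‖ ^ 2)) =
          2 * (1 / lam * (φ x ^ 2 * Q)) - 8 * (Lam / lam) * (g x ^ 2 * ‖P‖ ^ 2) := by
        field_simp
        ring
      linarith
  have h1 := integral_mono_ae (hGi.sub (hgφi.const_mul _)) (hi1.const_mul _) hpt
  rw [integral_const_mul] at h1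
  have h2 : 4 / lam * ∫ x in B, inner ℝ (gradient F (gradient v x) - gradient F (gradient U x))
        (gradient (fun y => φ y * (φ y * g y)) x) ≤ 0 :=
    mul_nonpos_of_nonneg_of_nonpos (by positivity) hi2
  have h3 := h1.trans h2
  simp only [Pi.sub_apply] at h3
  rw [integral_sub hGi (hgφi.const_mul _), integral_const_mul] at h3
  linarith

end Minimizers

section Sobolev

open ContinuousLinearMap

variable {V : Type*} [NormedAddCommGroup V] [InnerProductSpace ℝ V] [FiniteDimensional ℝ V]
variable [MeasureSpace V] [BorelSpace V] [(volume : Measure V).IsAddHaarMeasure]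

lemma LipschitzWith.hasFDerivAt_convolution {f ρ : V → ℝ} {C : ℝ≥0} (hf : LipschitzWith C f)
    (hρ : Continuous ρ) (hρc : HasCompactSupport ρ) (x : V) :
    HasFDerivAt (convolution ρ f (lsmul ℝ ℝ) volume)
      (convolution ρ (fderiv ℝ f) (lsmul ℝ ℝ) volume x) x := by
  have hρi : Integrable ρ := hρ.integrable_of_hasCompactSupport hρc
  have hmp : Measure.QuasiMeasurePreserving (fun t : V => x - t) volume volume :=
    quasiMeasurePreserving_sub_left volume x
  refine (hasFDerivAt_integral_of_dominated_loc_of_lip (F := fun x t => lsmul ℝ ℝ (ρ t) (f (x - t)))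
    (F' := fun t => lsmul ℝ ℝ (ρ t) (fderiv ℝ f (x - t))) (bound := fun t => C * ρ t)
    univ_mem ?_ ?_ ?_ ?_ ?_ ?_).2
  · refine Filter.Eventually.of_forall fun y => Continuous.aestronglyMeasurable ?_
    have := hf.continuous
    simp only [lsmul_apply]
    fun_prop
  · have := hf.continuous
    simp only [lsmul_apply]
    exact (by fun_prop : Continuous fun t => ρ t • f (x - t)).integrable_of_hasCompactSupport
      hρc.smul_right
  · simp only [lsmul_apply]
    exact hρ.aestronglyMeasurable.smul
      ((measurable_fderiv ℝ f).comp (measurable_const.sub measurable_id)).aestronglyMeasurable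
  · refine Filter.Eventually.of_forall fun t => LipschitzWith.lipschitzOnWith ?_
    refine LipschitzWith.of_dist_le_mul fun y z => ?_
    simp only [lsmul_apply, smul_eq_mul, Real.coe_nnabs, Real.dist_eq]
    rw [← mul_sub, abs_mul, abs_mul, NNReal.abs_eq]
    have := hf.dist_le_mul (y - t) (z - t)
    rw [dist_sub_right, Real.dist_eq] at this
    nlinarith [abs_nonneg (ρ t)]
  · exact hρi.const_mul _
  · filter_upwards [hmp.ae hf.ae_differentiableAt] with t ht
    simp only [lsmul_apply]
    have h1 : HasFDerivAt (fun y => f (y - t)) (fderiv ℝ f (x - t)) x :=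
      (hasFDerivAt_comp_sub t).2 ht.hasFDerivAt
    exact h1.const_smul (ρ t)

/-- The Sobolev inequality for Lipschitz functions with compact support. -/
lemma LipschitzWith.eLpNorm_le_eLpNorm_fderiv {f : V → ℝ} {C : ℝ≥0} (hf : LipschitzWith C f)
    (hfc : HasCompactSupport f) {p p' : ℝ≥0} (hp : 1 ≤ p) (hn : 0 < Module.finrank ℝ V)
    (hp' : (p' : ℝ)⁻¹ = p⁻¹ - (Module.finrank ℝ V : ℝ)⁻¹) :
    eLpNorm f p' volume ≤
      eLpNormLESNormFDerivOfEqInnerConst (volume : Measure V) p * eLpNorm (fderiv ℝ f) p volume := by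
  have hp0 : (p : ℝ) ≠ 0 := by
    have : (1 : ℝ) ≤ p := hp
    positivity
  let φ : ℕ → ContDiffBump (0 : V) := fun k =>
    ⟨1 / (2 * ((k : ℝ) + 1)), 1 / ((k : ℝ) + 1), by positivity, by
      apply one_div_lt_one_div_of_lt <;> linarith [(Nat.cast_nonneg k : (0 : ℝ) ≤ k)]⟩
  have hφr : ∀ k, (φ k).rOut = 1 / ((k : ℝ) + 1) := fun k => rfl
  have hφ0 : Tendsto (fun k => (φ k).rOut) atTop (𝓝 0) := tendsto_one_div_add_atTop_nhds_zero_nat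
  have hφK : ∀ᶠ k in atTop, (φ k).rOut ≤ 2 * (φ k).rIn := by
    refine Filter.Eventually.of_forall fun k => le_of_eq ?_
    change 1 / ((k : ℝ) + 1) = 2 * (1 / (2 * ((k : ℝ) + 1)))
    field_simp
  have hφ1 : ∀ k, (φ k).rOut ≤ 1 := fun k => by
    rw [hφr, div_le_one (by positivity)]
    linarith [(Nat.cast_nonneg k : (0 : ℝ) ≤ k)]
  set g : ℕ → V → ℝ := fun k => convolution ((φ k).normed volume) f (lsmul ℝ ℝ) volume with hg
  set G : ℕ → V → (V →L[ℝ] ℝ) :=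
    fun k => convolution ((φ k).normed volume) (fderiv ℝ f) (lsmul ℝ ℝ) volume with hG
  have hgd : ∀ k x, fderiv ℝ (g k) x = G k x := fun k x =>
    (hf.hasFDerivAt_convolution (φ k).continuous_normed (φ k).hasCompactSupport_normed x).fderiv
  have hgc : ∀ k, HasCompactSupport (g k) := fun k =>
    (φ k).hasCompactSupport_normed.convolution _ hfc
  have hgs : ∀ k, ContDiff ℝ 1 (g k) := fun k =>
    (φ k).hasCompactSupport_normed.contDiff_convolution_left _ (φ k).contDiff_normed
      hf.continuous.locallyIntegrable
  have hglim : ∀ x, Tendsto (fun k => g k x) atTop (𝓝 (f x)) := fun x =>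
    ContDiffBump.convolution_tendsto_right_of_continuous hφ0 hf.continuous x
  have hfl : LocallyIntegrable (fderiv ℝ f) volume :=
    (memLp_top_of_bound (measurable_fderiv ℝ f).aestronglyMeasurable C
      (Filter.Eventually.of_forall fun x => norm_fderiv_le_of_lipschitz ℝ hf)).locallyIntegrable
      le_top
  have hGlim : ∀ᵐ x, Tendsto (fun k => G k x) atTop (𝓝 (fderiv ℝ f x)) :=
    ContDiffBump.ae_convolution_tendsto_right_of_locallyIntegrable hφ0 hφK hfl
  have hGb : ∀ k x, ‖G k x‖ ≤ C := by
    intro k x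
    calc ‖G k x‖ ≤ ∫ t, C * (φ k).normed volume t := by
          refine norm_integral_le_of_norm_le ((φ k).integrable_normed.const_mul _) ?_
          refine Filter.Eventually.of_forall fun t => ?_
          rw [lsmul_apply, norm_smul, Real.norm_of_nonneg ((φ k).nonneg_normed t), mul_comm]
          exact mul_le_mul_of_nonneg_right (norm_fderiv_le_of_lipschitz ℝ hf)
            ((φ k).nonneg_normed t)
      _ = C := by rw [integral_const_mul, (φ k).integral_normed, mul_one]
  obtain ⟨R, hR⟩ := hfc.isCompact.isBounded.subset_closedBall (0 : V)
  have hGs : ∀ k x, x ∉ closedBall (0 : V) (R + 1) → G k x = 0 := by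
    intro k x hx
    rw [hG]
    simp only [convolution_def, lsmul_apply]
    rw [← integral_zero V (V →L[ℝ] ℝ) (μ := volume)]
    congr 1
    ext1 t
    by_cases ht : t ∈ ball (0 : V) (φ k).rOut
    · have h1 : x - t ∉ tsupport f := by
        intro h
        apply hx
        have h2 := hR h
        have h3 := hφ1 k
        simp only [mem_closedBall_zero_iff, mem_ball_zero_iff] at ht h2 ⊢
        have := norm_add_le (x - t) t
        rw [sub_add_cancel] at this
        linarith
      have h2 : fderiv ℝ f (x - t) = 0 := by
        by_contra h
        exact h1 (support_fderiv_subset ℝ h)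
      rw [h2, smul_zero]
    · have : (φ k).normed volume t = 0 := by
        rw [← Function.notMem_support, (φ k).support_normed_eq]
        exact ht
      rw [this, zero_smul]
  have hstep : ∀ k, eLpNorm (g k) p' volume ≤
      eLpNormLESNormFDerivOfEqInnerConst (volume : Measure V) p * eLpNorm (G k) p volume := by
    intro k
    have := eLpNorm_le_eLpNorm_fderiv_of_eq_inner (μ := (volume : Measure V)) (hgs k) (hgc k) hp hn hp'
    rwa [show fderiv ℝ (g k) = G k from funext (hgd k)] at this
  have hGm : ∀ k, AEStronglyMeasurable (G k) volume := fun k => by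
    rw [← show fderiv ℝ (g k) = G k from funext (hgd k)]
    exact (measurable_fderiv ℝ (g k)).aestronglyMeasurable
  have hnorm : Tendsto (fun k => eLpNorm (G k) p volume) atTop
      (𝓝 (eLpNorm (fderiv ℝ f) p volume)) := by
    have hpE : (p : ℝ≥0∞) ≠ 0 := by
      have : p ≠ 0 := by exact_mod_cast hp0
      exact_mod_cast this
    simp_rw [eLpNorm_eq_lintegral_rpow_enorm_toReal hpE ENNReal.coe_ne_top]
    refine ((ENNReal.continuous_rpow_const).tendsto _).comp ?_
    refine tendsto_lintegral_of_dominated_convergence'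
      ((closedBall (0 : V) (R + 1)).indicator fun _ => (C : ℝ≥0∞) ^ (p : ℝ)) (fun k => ?_)
      (fun k => ?_) ?_ ?_
    · exact (hGm k).enorm.pow_const _
    · refine Filter.Eventually.of_forall fun x => ?_
      by_cases hx : x ∈ closedBall (0 : V) (R + 1)
      · rw [indicator_of_mem hx]
        simp only [ENNReal.coe_toReal]
        gcongr
        have := hGb k x
        rw [← coe_nnnorm, NNReal.coe_le_coe] at this
        rw [enorm_eq_nnnorm]
        exact_mod_cast this
      · rw [indicator_of_notMem hx]
        beta_reduce
        rw [hGs k x hx]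
        have h0 : ‖(0 : V →L[ℝ] ℝ)‖ₑ ^ ((p : ℝ≥0∞)).toReal = 0 := by
          have h1 : ‖(0 : V →L[ℝ] ℝ)‖ₑ = 0 := by
            rw [enorm_eq_nnnorm, nnnorm_zero, ENNReal.coe_zero]
          rw [h1, ENNReal.coe_toReal, ENNReal.zero_rpow_of_pos]
          exact lt_of_le_of_ne p.coe_nonneg hp0.symm
        exact h0.le
    · rw [lintegral_indicator measurableSet_closedBall, setLIntegral_const]
      refine ENNReal.mul_ne_top ?_ measure_closedBall_lt_top.ne
      exact ENNReal.rpow_ne_top_of_nonneg p.coe_nonneg ENNReal.coe_ne_top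
    · filter_upwards [hGlim] with x hx
      exact ((ENNReal.continuous_rpow_const).tendsto _).comp
        ((continuous_enorm.tendsto _).comp hx)
  have hliminf := Lp.eLpNorm_lim_le_liminf_eLpNorm (p := (p' : ℝ≥0∞))
    (fun k => (hgs k).continuous.aestronglyMeasurable (μ := volume)) f
    (Filter.Eventually.of_forall hglim)
  refine hliminf.trans ?_
  have h2 := ENNReal.Tendsto.const_mul
    (a := (eLpNormLESNormFDerivOfEqInnerConst (volume : Measure V) p : ℝ≥0∞)) hnorm
    (Or.inr ENNReal.coe_ne_top)
  rw [← h2.liminf_eq]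
  exact liminf_le_liminf (Filter.Eventually.of_forall hstep)

end Sobolev

lemma MeasureTheory.MemLp.toReal_eLpNorm_two_sq {α H : Type*} [MeasurableSpace α] {μ : Measure α}
    [NormedAddCommGroup H] {f : α → H} (hf : MemLp f 2 μ) :
    (eLpNorm f 2 μ).toReal ^ 2 = ∫ x, ‖f x‖ ^ 2 ∂μ := by
  have h0 : 0 ≤ ∫ x, ‖f x‖ ^ (2 : ℝ) ∂μ := integral_nonneg fun x => by positivity
  rw [hf.eLpNorm_eq_integral_rpow_norm two_ne_zero ENNReal.ofNat_ne_top, ENNReal.toReal_ofNat,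
    ENNReal.toReal_ofReal (Real.rpow_nonneg h0 _), ← Real.rpow_natCast, ← Real.rpow_mul h0]
  norm_num

section FaberKrahn

variable {V : Type*} [NormedAddCommGroup V] [InnerProductSpace ℝ V] [FiniteDimensional ℝ V]
variable [MeasureSpace V] [BorelSpace V] [(volume : Measure V).IsAddHaarMeasure]

variable (V) in
/-- The Faber–Krahn inequality for Lipschitz functions with compact support. -/
lemma exists_integral_sq_le (hn : 2 < Module.finrank ℝ V) :
    ∃ C : ℝ, 0 < C ∧ ∀ f : V → ℝ, IsLip f → HasCompactSupport f → ∀ S : Set V,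
      volume S ≠ ∞ → Function.support f ⊆ S →
      ∫ x, f x ^ 2 ≤ C * (volume S).toReal ^ (2 / (Module.finrank ℝ V : ℝ)) *
        ∫ x, ‖gradient f x‖ ^ 2 := by
  set n : ℝ := (Module.finrank ℝ V : ℝ) with hn_def
  have hn2 : (2 : ℝ) < n := by rw [hn_def]; exact_mod_cast hn
  have hn0 : 0 < n - 2 := by linarith
  set c : ℝ := (eLpNormLESNormFDerivOfEqInnerConst (volume : Measure V) ((2 : ℝ≥0) : ℝ) : ℝ) with hc
  have hc0 : 0 ≤ c := NNReal.coe_nonneg _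
  refine ⟨c ^ 2 + 1, by positivity, fun f hf hfc S hS hfS => ?_⟩
  obtain ⟨C, hC⟩ := hf
  set p' : ℝ≥0 := ⟨2 * n / (n - 2), by positivity⟩ with hp'
  have hp'c : (p' : ℝ) = 2 * n / (n - 2) := rfl
  have hsob := hC.eLpNorm_le_eLpNorm_fderiv hfc (p := 2) (p' := p') (by norm_num) (by lia) (by
    rw [hp'c, ← hn_def]
    push_cast
    field_simp)
  have hf2 : MemLp f 2 volume := hC.continuous.memLp_of_hasCompactSupport hfc
  have hgr : eLpNorm (fderiv ℝ f) ((2 : ℝ≥0) : ℝ≥0∞) volume = eLpNorm (gradient f) 2 volume :=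
    eLpNorm_congr_norm_ae (Filter.Eventually.of_forall fun x => (norm_gradient f x).symm)
  rw [hgr] at hsob
  have hd2 : MemLp (gradient f) 2 volume := by
    have h1 : MemLp (gradient f) ⊤ volume :=
      memLp_top_of_bound (measurable_gradient f).aestronglyMeasurable C
        (Filter.Eventually.of_forall fun x => hC.norm_gradient_le x)
    have h2 : ∀ x ∉ tsupport f, gradient f x = 0 := fun x hx => by
      by_contra h
      refine hx (support_fderiv_subset ℝ (f := f) fun h0 => h ?_)
      rw [← norm_eq_zero, norm_gradient, h0, norm_zero]
    exact MemLp.mono_exponent_of_measure_support_ne_top (p := 2) (q := ⊤) h1 h2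
      hfc.isCompact.measure_ne_top le_top
  have hH : eLpNorm f 2 volume ≤ eLpNorm f p' volume * volume S ^ (1 / n) := by
    have h1 := eLpNorm_le_eLpNorm_mul_rpow_measure_univ (μ := volume.restrict S) (f := f)
      (p := 2) (q := p') (by
        have : (2 : ℝ≥0) ≤ p' := by
          rw [← NNReal.coe_le_coe, hp'c, le_div_iff₀ hn0]
          push_cast
          linarith
        exact_mod_cast this) hC.continuous.aestronglyMeasurable
    rw [eLpNorm_restrict_eq_of_support_subset hfS, eLpNorm_restrict_eq_of_support_subset hfS,
      Measure.restrict_apply_univ] at h1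
    convert h1 using 3
    rw [ENNReal.toReal_ofNat, ENNReal.coe_toReal, hp'c]
    field_simp
    ring
  have hfin : eLpNorm (gradient f) 2 volume ≠ ∞ := hd2.eLpNorm_ne_top
  have hSr : volume S ^ (1 / n) ≠ ∞ := ENNReal.rpow_ne_top_of_nonneg (by positivity) hS
  have hall := hH.trans (mul_le_mul_left hsob _)
  have htr := ENNReal.toReal_mono (ENNReal.mul_ne_top (ENNReal.mul_ne_top ENNReal.coe_ne_top
    hfin) hSr) hall
  rw [ENNReal.toReal_mul, ENNReal.toReal_mul, ← ENNReal.toReal_rpow, ENNReal.coe_toReal, ← hc] at htr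
  have hsq := pow_le_pow_left₀ ENNReal.toReal_nonneg htr 2
  rw [hf2.toReal_eLpNorm_two_sq, mul_pow, mul_pow] at hsq
  have h3 := hd2.toReal_eLpNorm_two_sq
  have h4 : ((volume S).toReal ^ (1 / n)) ^ 2 = (volume S).toReal ^ (2 / n) := by
    rw [← Real.rpow_natCast, ← Real.rpow_mul ENNReal.toReal_nonneg]
    congr 1
    push_cast
    ring
  rw [h3, h4] at hsq
  simp only [Real.norm_eq_abs, sq_abs] at hsq
  have h5 : 0 ≤ ∫ x, ‖gradient f x‖ ^ 2 := integral_nonneg fun x => by positivity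
  have h6 : 0 ≤ (volume S).toReal ^ (2 / n) := Real.rpow_nonneg ENNReal.toReal_nonneg _
  calc ∫ x, f x ^ 2 ≤ c ^ 2 * (∫ x, ‖gradient f x‖ ^ 2) * (volume S).toReal ^ (2 / n) := hsq
    _ ≤ (c ^ 2 + 1) * (∫ x, ‖gradient f x‖ ^ 2) * (volume S).toReal ^ (2 / n) := by
        gcongr; linarith
    _ = _ := by ring

end FaberKrahn

/-- Superlinear recursive inequalities force decay when started from a small enough value. -/
lemma tendsto_zero_of_superlinear_recursion {y : ℕ → ℝ} {A b a : ℝ} (hy : ∀ j, 0 ≤ y j) (hb : 1 < b)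
    (ha : 0 < a) (hA : 0 ≤ A) (h : ∀ j, y (j + 1) ≤ A * b ^ j * y j ^ a * y j)
    (h0 : A * y 0 ^ a ≤ b ^ (-1 / a)) : Tendsto y atTop (𝓝 0) := by
  set τ : ℝ := b ^ (-1 / a) with hτ
  have hb0 : 0 < b := by linarith
  have hτ0 : 0 < τ := Real.rpow_pos_of_pos hb0 _
  have hτ1 : τ < 1 := Real.rpow_lt_one_of_one_lt_of_neg hb (div_neg_of_neg_of_pos (by norm_num) ha)
  have hτa : τ ^ a = b⁻¹ := by
    rw [hτ, ← Real.rpow_mul hb0.le, div_mul_cancel₀ _ ha.ne', Real.rpow_neg_one]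
  have key : ∀ j, y j ≤ y 0 * τ ^ j := by
    intro j
    induction j with
    | zero => simp
    | succ j ih =>
      have h1 : y j ^ a ≤ y 0 ^ a * (b⁻¹) ^ j := by
        calc y j ^ a ≤ (y 0 * τ ^ j) ^ a := Real.rpow_le_rpow (hy j) ih ha.le
          _ = y 0 ^ a * (b⁻¹) ^ j := by
            rw [Real.mul_rpow (hy 0) (by positivity), ← hτa, ← Real.rpow_natCast, ← Real.rpow_natCast,
              ← Real.rpow_mul hτ0.le, ← Real.rpow_mul hτ0.le, mul_comm (j : ℝ)]
      calc y (j + 1) ≤ A * b ^ j * y j ^ a * y j := h j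
        _ ≤ A * b ^ j * (y 0 ^ a * (b⁻¹) ^ j) * (y 0 * τ ^ j) :=
          mul_le_mul (mul_le_mul_of_nonneg_left h1 (by positivity)) ih (hy j)
            (mul_nonneg (by positivity) (mul_nonneg (Real.rpow_nonneg (hy 0) _) (by positivity)))
        _ = (A * y 0 ^ a) * (y 0 * τ ^ j) := by
          have : b ^ j * (b⁻¹) ^ j = 1 := by rw [← mul_pow, mul_inv_cancel₀ hb0.ne', one_pow]
          linear_combination (A * y 0 ^ a * (y 0 * τ ^ j)) * this
        _ ≤ τ * (y 0 * τ ^ j) :=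
          mul_le_mul_of_nonneg_right h0 (mul_nonneg (hy 0) (by positivity))
        _ = y 0 * τ ^ (j + 1) := by ring
  refine squeeze_zero hy key ?_
  simpa using (tendsto_pow_atTop_nhds_zero_of_lt_one hτ0.le hτ1).const_mul (y 0)

section Cutoff

variable {V : Type*} [NormedAddCommGroup V] [InnerProductSpace ℝ V] [FiniteDimensional ℝ V]
variable [MeasureSpace V] [BorelSpace V] [(volume : Measure V).IsAddHaarMeasure]

/-- A Lipschitz cutoff between concentric balls. -/
def cutoff (x₀ : V) (a s : ℝ) (x : V) : ℝ := (0 ⊔ (a + s - dist x x₀) / s) ⊓ 1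

variable {x₀ x : V} {a s : ℝ}

omit [InnerProductSpace ℝ V] [FiniteDimensional ℝ V] [MeasureSpace V] [BorelSpace V]
  [(volume : Measure V).IsAddHaarMeasure] in
lemma cutoff_nonneg : 0 ≤ cutoff x₀ a s x := le_inf le_sup_left zero_le_one

omit [InnerProductSpace ℝ V] [FiniteDimensional ℝ V] [MeasureSpace V] [BorelSpace V]
  [(volume : Measure V).IsAddHaarMeasure] in
lemma cutoff_le_one : cutoff x₀ a s x ≤ 1 := inf_le_right

omit [InnerProductSpace ℝ V] [FiniteDimensional ℝ V] [MeasureSpace V] [BorelSpace V]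
  [(volume : Measure V).IsAddHaarMeasure] in
lemma cutoff_eq_one (hs : 0 < s) (hx : dist x x₀ ≤ a) : cutoff x₀ a s x = 1 := by
  refine inf_eq_right.2 (le_sup_of_le_right ?_)
  rw [le_div_iff₀ hs]
  linarith

omit [InnerProductSpace ℝ V] [FiniteDimensional ℝ V] [MeasureSpace V] [BorelSpace V]
  [(volume : Measure V).IsAddHaarMeasure] in
lemma cutoff_eq_zero (hs : 0 < s) (hx : a + s ≤ dist x x₀) : cutoff x₀ a s x = 0 := by
  have h : (a + s - dist x x₀) / s ≤ 0 := div_nonpos_of_nonpos_of_nonneg (by linarith) hs.le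
  rw [cutoff, sup_eq_left.2 h]
  exact inf_eq_left.2 zero_le_one

omit [InnerProductSpace ℝ V] [FiniteDimensional ℝ V] [MeasureSpace V] [BorelSpace V]
  [(volume : Measure V).IsAddHaarMeasure] in
lemma lipschitzWith_cutoff (hs : 0 < s) : LipschitzWith (Real.toNNReal s⁻¹) (cutoff x₀ a s) := by
  refine (LipschitzWith.const_max (LipschitzWith.of_dist_le_mul fun x y => ?_) 0).min_const 1
  rw [Real.dist_eq, ← sub_div, abs_div, abs_of_pos hs, Real.coe_toNNReal _ (by positivity),
    div_eq_inv_mul]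
  gcongr
  have := abs_dist_sub_le x y x₀
  rw [show a + s - dist x x₀ - (a + s - dist y x₀) = -(dist x x₀ - dist y x₀) by ring, abs_neg]
  exact this

lemma Continuous.integrableOn_ball {f : V → ℝ} (hf : Continuous f) (x₀ : V) (R : ℝ) :
    IntegrableOn f (ball x₀ R) :=
  (hf.locallyIntegrable.integrableOn_isCompact (isCompact_closedBall x₀ R)).mono_set
    ball_subset_closedBall

end Cutoff

section DeGiorgi

variable {V : Type*} [NormedAddCommGroup V] [InnerProductSpace ℝ V] [FiniteDimensional ℝ V]
variable [MeasureSpace V] [BorelSpace V] [(volume : Measure V).IsAddHaarMeasure]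

/-- The Caccioppoli inequality for the truncations of `w` above nonnegative levels. -/
def HasCaccioppoli (w : V → ℝ) (B : Set V) (K : ℝ) : Prop :=
  ∀ l, 0 ≤ l → ∀ φ : V → ℝ, IsLip φ → (∀ x, 0 ≤ φ x) → (∀ x, φ x ≤ 1) →
    ∀ S, IsCompact S → S ⊆ B → (∀ x ∉ S, φ x = 0) →
    ∫ x in B, ‖gradient (fun y => φ y * ((w y - l) ⊔ 0)) x‖ ^ 2 ≤
      K * ∫ x in B, ((w x - l) ⊔ 0) ^ 2 * ‖gradient φ x‖ ^ 2

variable (V) in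
lemma exists_deGiorgi_step (hn : 2 < Module.finrank ℝ V) :
    ∃ C : ℝ, 0 < C ∧ ∀ (w : V → ℝ) (A K R R' ρ l m : ℝ) (x₀ : V), IsLip w → (∀ x, |w x| ≤ A) →
      0 ≤ K → HasCaccioppoli w (ball x₀ R) K → R' ≤ R → ρ < R' → 0 ≤ l → l < m →
      ∫ x in ball x₀ ρ, ((w x - m) ⊔ 0) ^ 2 ≤ C * K * (R' - ρ)⁻¹ ^ 2 *
        ((∫ x in ball x₀ R', ((w x - l) ⊔ 0) ^ 2) / (m - l) ^ 2) ^
          (2 / (Module.finrank ℝ V : ℝ)) * ∫ x in ball x₀ R', ((w x - l) ⊔ 0) ^ 2 := by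
  obtain ⟨C, hC, hFK⟩ := exists_integral_sq_le V hn
  refine ⟨4 * C, by positivity, fun w A K R R' ρ l m x₀ hw hA hK hcac hR' hρ hl hlm => ?_⟩
  set s : ℝ := (R' - ρ) / 2 with hs
  have hs0 : 0 < s := by rw [hs]; linarith
  set φ : V → ℝ := cutoff x₀ ρ s with hφ
  have hφL : IsLip φ := ⟨_, lipschitzWith_cutoff hs0⟩
  set T : Set V := closedBall x₀ (ρ + s) with hT
  have hTR' : T ⊆ ball x₀ R' := closedBall_subset_ball (by linarith)
  have hTR : T ⊆ ball x₀ R := hTR'.trans (ball_subset_ball hR')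
  have hφT : ∀ x ∉ T, φ x = 0 := fun x hx => by
    refine cutoff_eq_zero hs0 ?_
    rw [hT, mem_closedBall, not_le] at hx
    exact hx.le
  have htrunc : ∀ k : ℝ, Continuous fun x => ((w x - k) ⊔ 0) ^ 2 := fun k => by
    have := hw.continuous
    fun_prop
  set f : V → ℝ := fun y => φ y * ((w y - m) ⊔ 0) with hf
  have hfL : IsLip f := by
    refine IsLip.mul (A := 1) (B := A + |m|) hφL ((hw.sub (IsLip.const m)).sup (IsLip.const 0)) ?_ ?_
    · intro x
      rw [abs_of_nonneg cutoff_nonneg]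
      exact cutoff_le_one
    · intro x
      rw [abs_of_nonneg le_sup_right]
      have h1 := hA x
      have h2 := le_abs_self (w x)
      have h3 := neg_abs_le m
      refine sup_le (by linarith) ?_
      have := abs_nonneg m
      have := abs_nonneg (w x)
      linarith
  have hfT : ∀ x ∉ T, f x = 0 := fun x hx => by simp only [hf, hφT x hx, zero_mul]
  have hfc : HasCompactSupport f := HasCompactSupport.intro (isCompact_closedBall _ _) hfT
  have hTc : IsClosed T := isClosed_closedBall
  have hgf : ∀ x ∉ T, gradient f x = 0 := fun x hx => by
    have h : f =ᶠ[𝓝 x] fun _ => 0 :=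
      Filter.eventually_of_mem (hTc.isOpen_compl.mem_nhds hx) fun y hy => hfT y hy
    rw [h.gradient_eq]
    exact gradient_const x 0
  have hgφ : ∀ x ∉ T, gradient φ x = 0 := fun x hx => by
    have h : φ =ᶠ[𝓝 x] fun _ => 0 :=
      Filter.eventually_of_mem (hTc.isOpen_compl.mem_nhds hx) fun y hy => hφT y hy
    rw [h.gradient_eq]
    exact gradient_const x 0
  set Y : ℝ := ∫ x in ball x₀ R', ((w x - l) ⊔ 0) ^ 2 with hY
  have hYi : IntegrableOn (fun x => ((w x - l) ⊔ 0) ^ 2) (ball x₀ R') :=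
    (htrunc l).integrableOn_ball x₀ R'
  have hml : 0 < m - l := by linarith
  have hY0 : 0 ≤ Y := integral_nonneg fun x => by positivity
  set S : Set V := ball x₀ R' ∩ {x | m < w x} with hS
  have hSm : MeasurableSet S :=
    measurableSet_ball.inter (measurableSet_lt measurable_const hw.continuous.measurable)
  have hSfin : volume S ≠ ∞ := ((measure_mono inter_subset_left).trans_lt measure_ball_lt_top).ne
  have hfS : Function.support f ⊆ S := by
    intro x hx
    have hx' : f x ≠ 0 := hx
    refine ⟨?_, ?_⟩
    · by_contra h
      exact hx' (hfT x fun h' => h (hTR' h'))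
    · by_contra h
      have h2 : w x - m ≤ 0 := by
        have : ¬ m < w x := h
        linarith
      exact hx' (by simp only [hf, sup_eq_right.2 h2, mul_zero])
  have hcheb : (volume S).toReal ≤ Y / (m - l) ^ 2 := by
    rw [le_div_iff₀ (by positivity)]
    calc (volume S).toReal * (m - l) ^ 2 = ∫ _x in S, (m - l) ^ 2 := by
          rw [setIntegral_const, smul_eq_mul, Measure.real]
      _ ≤ ∫ x in S, ((w x - l) ⊔ 0) ^ 2 := by
          refine setIntegral_mono_on (integrableOn_const hSfin) (hYi.mono_set inter_subset_left) hSm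
            fun x hx => ?_
          have hx2 : m < w x := hx.2
          exact pow_le_pow_left₀ hml.le (le_sup_of_le_left (by linarith)) 2
      _ ≤ Y := setIntegral_mono_set hYi (Filter.Eventually.of_forall fun x => by positivity)
          (Filter.Eventually.of_forall inter_subset_left)
  have h1 : ∫ x in ball x₀ ρ, ((w x - m) ⊔ 0) ^ 2 ≤ ∫ x, f x ^ 2 := by
    have hfi : Integrable (fun x => f x ^ 2) :=
      (hfL.continuous.pow 2).integrable_of_hasCompactSupport
        (HasCompactSupport.intro (isCompact_closedBall x₀ (ρ + s)) fun x hx => by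
          simp only [Pi.pow_apply, hfT x hx, ne_eq, OfNat.ofNat_ne_zero, not_false_eq_true, zero_pow])
    calc ∫ x in ball x₀ ρ, ((w x - m) ⊔ 0) ^ 2 = ∫ x in ball x₀ ρ, f x ^ 2 := by
          refine setIntegral_congr_fun measurableSet_ball fun x hx => ?_
          have : φ x = 1 := cutoff_eq_one hs0 (mem_ball.1 hx).le
          simp only [hf, this, one_mul]
      _ ≤ ∫ x, f x ^ 2 := setIntegral_le_integral hfi
          (Filter.Eventually.of_forall fun x => sq_nonneg _)
  have h2 : ∫ x, ‖gradient f x‖ ^ 2 ≤ K * ((s⁻¹) ^ 2 * Y) := by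
    rw [← setIntegral_eq_integral_of_forall_compl_eq_zero (s := ball x₀ R) fun x hx => by
      rw [hgf x fun h => hx (hTR h), norm_zero]; norm_num]
    refine (hcac m (hl.trans hlm.le) φ hφL (fun x => cutoff_nonneg) (fun x => cutoff_le_one) T
      (isCompact_closedBall _ _) hTR hφT).trans (mul_le_mul_of_nonneg_left ?_ hK)
    have h0 : ∫ x in ball x₀ R, ((w x - m) ⊔ 0) ^ 2 * ‖gradient φ x‖ ^ 2 =
        ∫ x in ball x₀ R', ((w x - m) ⊔ 0) ^ 2 * ‖gradient φ x‖ ^ 2 :=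
      setIntegral_eq_of_subset_of_forall_sdiff_eq_zero measurableSet_ball (ball_subset_ball hR')
        fun x hx => by rw [hgφ x fun h => hx.2 (hTR' h), norm_zero]; ring
    rw [h0, hY, ← integral_const_mul]
    refine integral_mono_of_nonneg (Filter.Eventually.of_forall fun x => by positivity)
      (hYi.const_mul _) (Filter.Eventually.of_forall fun x => ?_)
    have hg := (lipschitzWith_cutoff (x₀ := x₀) (a := ρ) hs0).norm_gradient_le x
    rw [Real.coe_toNNReal _ (by positivity)] at hg
    have h3 : (w x - m) ⊔ 0 ≤ (w x - l) ⊔ 0 := sup_le_sup_right (by linarith) _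
    have h4 : 0 ≤ (w x - m) ⊔ 0 := le_sup_right
    calc ((w x - m) ⊔ 0) ^ 2 * ‖gradient φ x‖ ^ 2 ≤ ((w x - l) ⊔ 0) ^ 2 * s⁻¹ ^ 2 := by gcongr
      _ = _ := mul_comm _ _
  have h5 := hFK f hfL hfc S hSfin hfS
  have h6 : (volume S).toReal ^ (2 / (Module.finrank ℝ V : ℝ)) ≤
      (Y / (m - l) ^ 2) ^ (2 / (Module.finrank ℝ V : ℝ)) :=
    Real.rpow_le_rpow ENNReal.toReal_nonneg hcheb (by positivity)
  calc _ ≤ _ := h1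
    _ ≤ _ := h5
    _ ≤ C * (Y / (m - l) ^ 2) ^ (2 / (Module.finrank ℝ V : ℝ)) * (K * ((s⁻¹) ^ 2 * Y)) := by
      gcongr
    _ = _ := by
      rw [hs]
      field_simp
      ring

variable (V) in
/-- De Giorgi's local boundedness estimate. -/
lemma exists_deGiorgi (hn : 2 < Module.finrank ℝ V) :
    ∃ C : ℝ, 0 < C ∧ ∀ (w : V → ℝ) (A K R ρ D : ℝ) (x₀ : V), IsLip w → (∀ x, 0 ≤ w x) →
      (∀ x, |w x| ≤ A) → 0 ≤ K → HasCaccioppoli w (ball x₀ R) K → ρ < R → 0 < D →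
      C * K ^ ((Module.finrank ℝ V : ℝ) / 2) * ∫ x in ball x₀ R, w x ^ 2 ≤
        D ^ 2 * (R - ρ) ^ (Module.finrank ℝ V) →
      ∀ x ∈ ball x₀ ρ, w x ≤ D := by
  obtain ⟨C₀, hC₀, hstep⟩ := exists_deGiorgi_step V hn
  set d : ℕ := Module.finrank ℝ V with hd
  have hd0 : (0 : ℝ) < d := by
    have : 0 < d := by lia
    exact_mod_cast this
  set a : ℝ := 2 / d with ha
  have ha0 : 0 < a := by positivity
  set b : ℝ := 4 ^ (1 + a) with hb
  have hb1 : 1 < b := Real.one_lt_rpow (by norm_num) (by linarith)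
  set τ : ℝ := b ^ (-1 / a) with hτ
  have hτ0 : 0 < τ := Real.rpow_pos_of_pos (by linarith) _
  set C₁ : ℝ := C₀ * 4 * 4 ^ a with hC₁
  have hC₁0 : 0 < C₁ := by positivity
  refine ⟨(C₁ / τ) ^ ((d : ℝ) / 2), by positivity,
    fun w A K R ρ D x₀ hw hw0 hA hK hcac hρ hD hsmall => ?_⟩
  set g : ℝ := R - ρ with hg
  have hg0 : 0 < g := by rw [hg]; linarith
  set y : ℕ → ℝ := fun j => ∫ x in ball x₀ (ρ + g / 2 ^ j), ((w x - D * (1 - 1 / 2 ^ j)) ⊔ 0) ^ 2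
    with hy
  have hy0 : ∀ j, 0 ≤ y j := fun j => integral_nonneg fun x => by positivity
  have hpow2 : ∀ j : ℕ, (1 : ℝ) ≤ 2 ^ j := fun j => one_le_pow₀ (by norm_num)
  have hrec : ∀ j, y (j + 1) ≤ C₁ * K / g ^ 2 / (D ^ 2) ^ a * b ^ j * y j ^ a * y j := by
    intro j
    have hj : (0 : ℝ) < 2 ^ j := by positivity
    have h := hstep w A K R (ρ + g / 2 ^ j) (ρ + g / 2 ^ (j + 1)) (D * (1 - 1 / 2 ^ j))
      (D * (1 - 1 / 2 ^ (j + 1))) x₀ hw hA hK hcac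
      (by have := div_le_self hg0.le (hpow2 j); linarith)
      (by rw [add_lt_add_iff_left]; gcongr <;> simp)
      (mul_nonneg hD.le (by have := div_le_self zero_le_one (hpow2 j); linarith))
      (by gcongr <;> simp)
    refine h.trans (le_of_eq ?_)
    have e1 : (ρ + g / 2 ^ j - (ρ + g / 2 ^ (j + 1)))⁻¹ ^ 2 = 4 * 4 ^ j / g ^ 2 := by
      have e0 : ρ + g / 2 ^ j - (ρ + g / 2 ^ (j + 1)) = g / (2 * 2 ^ j) := by
        rw [pow_succ]
        field_simp
        ring
      rw [e0, inv_div, div_pow, mul_pow, ← pow_mul, mul_comm j 2, pow_mul]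
      norm_num
    have e2 : (D * (1 - 1 / 2 ^ (j + 1)) - D * (1 - 1 / 2 ^ j)) ^ 2 = D ^ 2 / (4 * 4 ^ j) := by
      rw [show (4 : ℝ) = 2 ^ 2 by norm_num, ← pow_mul, pow_succ, mul_comm 2 j, pow_mul]
      field_simp
      ring
    have e3 : (y j / (D ^ 2 / (4 * 4 ^ j))) ^ a = y j ^ a * (4 ^ a * (4 ^ a) ^ j) / (D ^ 2) ^ a := by
      rw [div_div_eq_mul_div, Real.div_rpow (mul_nonneg (hy0 j) (by positivity)) (by positivity),
        Real.mul_rpow (hy0 j) (by positivity), Real.mul_rpow (by norm_num) (by positivity),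
        ← Real.rpow_natCast (4 ^ a) j, ← Real.rpow_natCast 4 j, ← Real.rpow_mul (by norm_num),
        ← Real.rpow_mul (by norm_num), mul_comm a]
    have e4 : b ^ j = 4 ^ j * (4 ^ a) ^ j := by
      rw [hb, Real.rpow_add (by norm_num), Real.rpow_one, mul_pow]
    rw [e1, e2]
    change C₀ * K * (4 * 4 ^ j / g ^ 2) * (y j / (D ^ 2 / (4 * 4 ^ j))) ^ a * y j = _
    rw [e3, e4, hC₁]
    ring
  have hy00 : y 0 = ∫ x in ball x₀ R, w x ^ 2 := by
    simp only [hy, pow_zero, div_one, sub_self, mul_zero, sub_zero, hg, add_sub_cancel]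
    simp_rw [sup_eq_left.2 (hw0 _)]
  have hsm : C₁ * K / g ^ 2 / (D ^ 2) ^ a * y 0 ^ a ≤ τ := by
    rw [← hy00] at hsmall
    have h1 := Real.rpow_le_rpow (by have := hy0 0; positivity) hsmall ha0.le
    have hda : (d : ℝ) / 2 * a = 1 := by rw [ha]; field_simp
    rw [Real.mul_rpow (by positivity) (hy0 0), Real.mul_rpow (by positivity) (by positivity),
      ← Real.rpow_mul (by positivity), ← Real.rpow_mul hK, hda, Real.rpow_one, Real.rpow_one,
      Real.mul_rpow (by positivity) (by positivity), ← Real.rpow_natCast g d,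
      ← Real.rpow_mul hg0.le, show (d : ℝ) * a = (2 : ℕ) by rw [ha]; push_cast; field_simp,
      Real.rpow_natCast] at h1
    have hDa : 0 < (D ^ 2) ^ a := by positivity
    rw [div_mul_eq_mul_div, div_le_iff₀ hDa, div_mul_eq_mul_div, div_le_iff₀ (by positivity)]
    have h2 : C₁ * K * y 0 ^ a = τ * (C₁ / τ * K * y 0 ^ a) := by field_simp
    rw [h2, mul_assoc τ]
    exact mul_le_mul_of_nonneg_left h1 hτ0.le
  have hlim := tendsto_zero_of_superlinear_recursion hy0 hb1 ha0
    (div_nonneg (div_nonneg (by positivity) (by positivity)) (by positivity)) hrec hsm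
  have hcont : Continuous fun x => ((w x - D) ⊔ 0) ^ 2 := by
    have := hw.continuous
    fun_prop
  have hzero : ∫ x in ball x₀ ρ, ((w x - D) ⊔ 0) ^ 2 = 0 := by
    refine le_antisymm (ge_of_tendsto' hlim fun j => ?_) (integral_nonneg fun x => by positivity)
    have hcj : Continuous fun x => ((w x - D * (1 - 1 / 2 ^ j)) ⊔ 0) ^ 2 := by
      have := hw.continuous
      fun_prop
    have hj : (0 : ℝ) < 2 ^ j := by positivity
    calc ∫ x in ball x₀ ρ, ((w x - D) ⊔ 0) ^ 2
        ≤ ∫ x in ball x₀ ρ, ((w x - D * (1 - 1 / 2 ^ j)) ⊔ 0) ^ 2 := by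
          refine integral_mono (hcont.integrableOn_ball _ _) (hcj.integrableOn_ball _ _) fun x => ?_
          have : D * (1 - 1 / 2 ^ j) ≤ D := mul_le_of_le_one_right hD.le (by
            have : (0 : ℝ) < 1 / 2 ^ j := by positivity
            linarith)
          exact pow_le_pow_left₀ le_sup_right (sup_le_sup_right (by linarith) _) 2
      _ ≤ y j := setIntegral_mono_set (hcj.integrableOn_ball _ _)
          (Filter.Eventually.of_forall fun x => by positivity)
          (Filter.Eventually.of_forall (ball_subset_ball (by
            have : 0 < g / 2 ^ j := by positivity
            linarith)))
  rw [setIntegral_eq_zero_iff_of_nonneg_ae (Filter.Eventually.of_forall fun x => by positivity)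
    (hcont.integrableOn_ball _ _)] at hzero
  have hon := Measure.eqOn_open_of_ae_eq hzero isOpen_ball hcont.continuousOn continuousOn_const
  intro x hx
  have h1 : ((w x - D) ⊔ 0) ^ 2 = 0 := hon hx
  have h2 := pow_eq_zero_iff two_ne_zero |>.1 h1
  have h3 : w x - D ≤ (w x - D) ⊔ 0 := le_sup_left
  linarith

end DeGiorgi

section Translates

variable {V : Type*} [NormedAddCommGroup V] [InnerProductSpace ℝ V] [FiniteDimensional ℝ V]

lemma tendsto_supConv_excess {U : V → ℝ} (hU : Continuous U) {e x : V} (he : ‖e‖ = 1) {k : ℝ}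
    (hx : DifferentiableAt ℝ U x) :
    Tendsto (fun h : ℝ => ((supConv U e k h x - U x) / h - ((‖gradient U x‖ - k) ⊔ 0)) ⊔ 0)
      (𝓝[>] 0) (𝓝 0) := by
  rw [Metric.tendsto_nhds]
  intro ε hε
  have h1 := hx.hasFDerivAt.isLittleO.def (half_pos hε)
  obtain ⟨d, hd, hball⟩ := Metric.eventually_nhds_iff.1 h1
  filter_upwards [Ioo_mem_nhdsGT hd] with h hh
  rw [Real.dist_0_eq_abs, abs_of_nonneg le_sup_right]
  refine (sup_le ?_ (half_pos hε).le).trans_lt (half_lt_self hε)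
  obtain ⟨s, hs, hse⟩ := (le_supConv_and_exists (e := e) (k := k) hU hh.1.le x).2
  have hns : ‖s • e‖ = s := by rw [norm_smul, he, mul_one, Real.norm_of_nonneg hs.1]
  have h2 : ‖U (x + s • e) - U x - fderiv ℝ U x (x + s • e - x)‖ ≤ ε / 2 * ‖x + s • e - x‖ :=
    hball (by rw [dist_self_add_left, hns]; exact hs.2.trans_lt hh.2)
  rw [add_sub_cancel_left, hns] at h2
  have h3 := (fderiv ℝ U x).le_opNorm (s • e)
  rw [hns, ← norm_gradient] at h3
  have h4 := (le_abs_self _).trans h2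
  have h5 := (le_abs_self _).trans h3
  have h6 : ‖gradient U x‖ - k ≤ (‖gradient U x‖ - k) ⊔ 0 := le_sup_left
  have h7 : 0 ≤ (‖gradient U x‖ - k) ⊔ 0 := le_sup_right
  rw [sub_le_iff_le_add, div_le_iff₀ hh.1, hse]
  calc U (x + s • e) - k * s - U x ≤ s * (ε / 2 + (‖gradient U x‖ - k)) := by linarith
    _ ≤ s * (ε / 2 + ((‖gradient U x‖ - k) ⊔ 0)) := by
        have := hs.1
        gcongr
    _ ≤ h * (ε / 2 + ((‖gradient U x‖ - k) ⊔ 0)) := by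
        gcongr
        exact hs.2
    _ = _ := mul_comm _ _

lemma LipschitzOnWith.norm_gradient_le {f : V → ℝ} {C : ℝ≥0} {s : Set V}
    (hf : LipschitzOnWith C f s) {x : V} (hs : s ∈ 𝓝 x) : ‖gradient f x‖ ≤ C := by
  rw [norm_gradient]
  exact norm_fderiv_le_of_lipschitzOn ℝ hs hf

omit [FiniteDimensional ℝ V] in
/-- Control of all sufficiently short translates gives a Lipschitz bound on convex sets. -/
lemma lipschitzOnWith_of_eventually_translate_sub_le {U : V → ℝ} {S : Set V} (hS : Convex ℝ S)
    {N : ℝ≥0}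
    (h : ∀ e : V, ‖e‖ = 1 → ∀ᶠ t : ℝ in 𝓝[>] 0, ∀ x ∈ S, U (x + t • e) - U x ≤ N * t) :
    LipschitzOnWith N U S := by
  refine LipschitzOnWith.of_le_add_mul N fun x hx y hy => ?_
  rcases eq_or_ne x y with rfl | hxy
  · simp
  have hd0 : 0 < dist x y := dist_pos.2 hxy
  set e : V := (dist x y)⁻¹ • (x - y) with he
  have hen : ‖e‖ = 1 := by
    rw [he, norm_smul, norm_inv, dist_eq_norm, norm_norm, inv_mul_cancel₀]
    rw [← dist_eq_norm]
    exact hd0.ne'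
  have hlim : Tendsto (fun m : ℕ => dist x y / ((m : ℝ) + 1)) atTop (𝓝[>] 0) := by
    refine tendsto_nhdsWithin_iff.2 ⟨?_, Filter.Eventually.of_forall fun m => ?_⟩
    · have := (tendsto_one_div_add_atTop_nhds_zero_nat (𝕜 := ℝ)).const_mul (dist x y)
      simpa [div_eq_mul_inv] using this
    · exact mem_Ioi.2 (by positivity)
  obtain ⟨m, hm⟩ := (hlim.eventually (h e hen)).exists
  set t : ℝ := dist x y / ((m : ℝ) + 1) with ht
  have hte : t • e = ((m : ℝ) + 1)⁻¹ • (x - y) := by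
    rw [ht, he, smul_smul]
    congr 1
    field_simp
  have key : ∀ j : ℕ, j ≤ m + 1 → U (y + (j : ℝ) • t • e) - U y ≤ N * (j * t) := by
    intro j
    induction j with
    | zero => simp
    | succ j ih =>
      intro hj
      have hmem : y + (j : ℝ) • t • e ∈ S := by
        rw [hte, smul_smul]
        refine hS.add_smul_sub_mem hy hx ⟨by positivity, ?_⟩
        rw [← div_eq_mul_inv, div_le_one (by positivity)]
        have : j ≤ m + 1 := by lia
        exact_mod_cast this
      have h1 := hm _ hmem
      have h2 := ih (by lia)
      have h3 : y + ((j + 1 : ℕ) : ℝ) • t • e = y + (j : ℝ) • t • e + t • e := by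
        push_cast
        module
      rw [h3]
      push_cast
      linarith
  have hfin := key (m + 1) le_rfl
  have e1 : y + ((m + 1 : ℕ) : ℝ) • t • e = x := by
    rw [hte, smul_smul]
    push_cast
    rw [mul_inv_cancel₀ (by positivity), one_smul, add_sub_cancel]
  have e2 : ((m + 1 : ℕ) : ℝ) * t = dist x y := by
    rw [ht]
    push_cast
    field_simp
  rw [e1, e2] at hfin
  linarith

end Translates

section Improvement

variable {V : Type*} [NormedAddCommGroup V] [InnerProductSpace ℝ V] [FiniteDimensional ℝ V]
variable [MeasureSpace V] [BorelSpace V] [(volume : Measure V).IsAddHaarMeasure]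
variable {p q ν L : ℝ}

omit [MeasureSpace V] [BorelSpace V] [(volume : Measure V).IsAddHaarMeasure] in
lemma PQGrowth.exists_bound_gradient {F : V → ℝ} {μ : ℝ} (hF : PQGrowth p q ν L μ F) (hp : 1 < p)
    (hpq : p ≤ q) (hν : 0 < ν) (hL : 1 ≤ L) (hV : 1 < Module.finrank ℝ V) (C : ℝ) :
    ∃ D : ℝ, ∀ z, ‖z‖ ≤ C → ‖gradient F z‖ ≤ D :=
  ⟨_, fun _ hz => hF.norm_gradient_le hp hpq hν hL hV (le_max_right C 8)
    (hz.trans (le_max_left _ _))⟩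

omit [FiniteDimensional ℝ V] [MeasureSpace V] [BorelSpace V]
  [(volume : Measure V).IsAddHaarMeasure] in
lemma isLip_supConv {U : V → ℝ} (hU : IsLip U) {e : V} {k h : ℝ} (hh : 0 ≤ h) :
    IsLip (supConv U e k h) := by
  obtain ⟨C, hC⟩ := hU
  exact ⟨C, lipschitzOnWith_univ.1
    (supConv_lipschitzOnWith hC.continuous hh hC.lipschitzOnWith fun x _ s _ => mem_univ _)⟩

variable (V) in
/-- The excess of the sup-convolution of a minimizer satisfies a Caccioppoli inequality. -/
lemma exists_hasCaccioppoli_supConv (hV : 1 < Module.finrank ℝ V) (hp : 1 < p) (hpq : p ≤ q)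
    (hν : 0 < ν) (hL : 1 ≤ L) :
    ∃ C : ℝ, 0 < C ∧ ∀ (F : V → ℝ) (μ : ℝ), PQGrowth p q ν L μ F → ∀ (U : V → ℝ) (x₀ e : V)
      (R h : ℝ) (M : ℝ≥0), IsLip U → IsLipMin F (ball x₀ R) U → ‖e‖ = 1 → 0 ≤ h → 8 ≤ (M : ℝ) →
      LipschitzOnWith M U (ball x₀ R) →
      HasCaccioppoli (fun x => supConv U e (M / 4) h x - U x) (ball x₀ (R - h))
        (C * (M : ℝ) ^ (q - p)) := by
  obtain ⟨c, hc, C, hC, hmono⟩ := PQGrowth.exists_monotone_bounds V hV hp hpq hν hL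
  refine ⟨2 + 8 * (C / c), by positivity, fun F μ hF U x₀ e R h M hU hmin he hh hM hUM => ?_⟩
  intro l hl φ hφ hφ0 hφ1 S hS hSB hφS
  have hM0 : 0 < (M : ℝ) := by linarith
  have hd := hF.differentiable hp hpq hν hL hV
  have hgb := hF.exists_bound_gradient hp hpq hν hL hV
  have hUc := hU.continuous
  have hVl : IsLip (supConv U e (M / 4) h) := isLip_supConv hU hh
  obtain ⟨G, hG⟩ := hU
  have hshift : ∀ x ∈ ball x₀ (R - h), ∀ s ∈ Icc 0 h, x + s • e ∈ ball x₀ R := by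
    intro x hx s hs
    rw [mem_ball] at hx ⊢
    have h1 := dist_triangle (x + s • e) x x₀
    rw [dist_self_add_left, norm_smul, he, mul_one, Real.norm_of_nonneg hs.1] at h1
    linarith [hs.2]
  have hVM := supConv_lipschitzOnWith (k := (M : ℝ) / 4) hUc hh hUM hshift
  have hsub : ball x₀ (R - h) ⊆ ball x₀ R := ball_subset_ball (by linarith)
  have hmain := caccioppoli hF.convex hd hgb (measure_ball_lt_top (μ := volume)).ne ⟨G, hG⟩ hVl
    (hmin.mono hd.continuous ⟨G, hG⟩ measure_ball_lt_top.ne measurableSet_ball measurableSet_ball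
      hsub)
    (supConv_isSubMin hF.convex hd hgb ⟨G, hG⟩ he hh hmin) (lam := c * (M : ℝ) ^ (p - 2))
    (Lam := C * (M : ℝ) ^ (q - 2)) (A := G * h) (by positivity) (by positivity) hl
    (fun x => by
      rw [abs_of_nonneg (sub_nonneg.2 (le_supConv hUc hh x))]
      exact supConv_sub_le hUc hh (by positivity) he hG.lipschitzOnWith fun s _ => mem_univ _)
    (by
      rw [ae_restrict_iff' measurableSet_ball]
      filter_upwards [hVl.ae_differentiableAt] with x hx hxB hlt
      exact hmono F μ hF M hM _ _ (hVM.norm_gradient_le (isOpen_ball.mem_nhds hxB))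
        (hUM.norm_gradient_le (isOpen_ball.mem_nhds (hsub hxB)))
        (le_norm_gradient_supConv hUc hh he hx hlt))
    hφ hφ0 hφ1 hS hSB hφS
  refine hmain.trans (mul_le_mul_of_nonneg_right ?_ (integral_nonneg fun x => by positivity))
  have e1 : C * (M : ℝ) ^ (q - 2) / (c * (M : ℝ) ^ (p - 2)) = C / c * (M : ℝ) ^ (q - p) := by
    rw [mul_div_mul_comm, ← Real.rpow_sub hM0]
    congr 2
    ring
  have e2 : 1 ≤ (M : ℝ) ^ (q - p) := Real.one_le_rpow (by linarith) (by linarith)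
  rw [e1]
  linarith

variable (V) in
lemma exists_eventually_translate_sub_le (hn : 2 < Module.finrank ℝ V) (hp : 1 < p) (hpq : p ≤ q)
    (hν : 0 < ν) (hL : 1 ≤ L) :
    ∃ C : ℝ, 0 < C ∧ ∀ (F : V → ℝ) (μ : ℝ), PQGrowth p q ν L μ F → ∀ (U : V → ℝ) (x₀ e : V)
      (R ρ : ℝ) (M : ℝ≥0), IsLip U → IsLipMin F (ball x₀ R) U → ‖e‖ = 1 → 8 ≤ (M : ℝ) →
      LipschitzOnWith M U (ball x₀ R) → ρ < R →
      C * energy F (ball x₀ R) U <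
        (M : ℝ) ^ (p - (q - p) * (Module.finrank ℝ V : ℝ) / 2) *
          (R - ρ) ^ (Module.finrank ℝ V) →
      ∀ᶠ t : ℝ in 𝓝[>] 0, ∀ x ∈ ball x₀ ρ, U (x + t • e) - U x ≤ M / 2 * t := by
  have hV : 1 < Module.finrank ℝ V := by lia
  obtain ⟨K₁, hK₁, hcac⟩ := exists_hasCaccioppoli_supConv V hV hp hpq hν hL
  obtain ⟨C₂, hC₂, hDG⟩ := exists_deGiorgi V hn
  set d : ℕ := Module.finrank ℝ V with hd
  set C₃ : ℝ := 16 * 2 ^ d * C₂ * K₁ ^ ((d : ℝ) / 2) with hC₃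
  have hC₃0 : 0 < C₃ := by positivity
  refine ⟨C₃ * (4 ^ p * ν⁻¹), by positivity,
    fun F μ hF U x₀ e R ρ M hU hmin he hM hUM hρ hsmall => ?_⟩
  have hM0 : 0 < (M : ℝ) := by linarith
  have hUc := hU.continuous
  obtain ⟨G, hG⟩ := hU
  set k : ℝ := (M : ℝ) / 4 with hk
  have hk0 : 0 < k := by positivity
  set b : V → ℝ := fun x => (‖gradient U x‖ - k) ⊔ 0 with hb
  have hb0 : ∀ x, 0 ≤ b x := fun x => le_sup_right
  have hbm : Measurable b := ((measurable_gradient U).norm.sub_const k).sup_const 0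
  have hbG : ∀ x, b x ≤ G := fun x =>
    sup_le (by linarith [hG.norm_gradient_le x]) G.coe_nonneg
  have hFd := hF.differentiable hp hpq hν hL hV
  have hFi : IntegrableOn (fun x => F (gradient U x)) (ball x₀ R) :=
    integrableOn_energy hFd.continuous ⟨G, hG⟩ measure_ball_lt_top.ne
  -- the limiting excess
  have hbint : ∫ x in ball x₀ R, b x ^ 2 ≤
      4 ^ p * ν⁻¹ * (M : ℝ) ^ (2 - p) * energy F (ball x₀ R) U := by
    rw [energy, ← integral_const_mul]
    refine integral_mono_of_nonneg (Filter.Eventually.of_forall fun x => sq_nonneg _)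
      (hFi.const_mul _) ?_
    filter_upwards [ae_restrict_mem measurableSet_ball] with x hx
    have hgM := hUM.norm_gradient_le (isOpen_ball.mem_nhds hx)
    have hFx := hF.le_apply hp hν hV (gradient U x)
    have hF0 := hF.nonneg hp hν hV (gradient U x)
    by_cases hgk : ‖gradient U x‖ ≤ k
    · have : b x = 0 := sup_eq_right.2 (by linarith)
      simp only [this]
      rw [zero_pow two_ne_zero]
      positivity
    · rw [not_le] at hgk
      have h1 : b x ≤ M := sup_le (by linarith) hM0.le
      have h2 : 1 ≤ (4 * ‖gradient U x‖ / M) ^ p := by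
        refine Real.one_le_rpow ?_ (by linarith)
        rw [le_div_iff₀ hM0]
        linarith
      calc b x ^ 2 ≤ (M : ℝ) ^ 2 * 1 := by
            rw [mul_one]
            exact pow_le_pow_left₀ (hb0 x) h1 2
        _ ≤ (M : ℝ) ^ 2 * (4 * ‖gradient U x‖ / M) ^ p := by gcongr
        _ = 4 ^ p * ν⁻¹ * (M : ℝ) ^ (2 - p) * (ν * ‖gradient U x‖ ^ p) := by
            rw [Real.div_rpow (by positivity) hM0.le, Real.mul_rpow (by norm_num) (norm_nonneg _),
              Real.rpow_sub hM0, ← Real.rpow_natCast (M : ℝ) 2]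
            push_cast
            field_simp
        _ ≤ _ := by gcongr
  set target : ℝ := (M : ℝ) ^ 2 * (R - ρ) ^ d / (C₃ * ((M : ℝ) ^ (q - p)) ^ ((d : ℝ) / 2))
    with htarget
  have hlt : ∫ x in ball x₀ R, b x ^ 2 < target := by
    refine hbint.trans_lt ?_
    rw [htarget, lt_div_iff₀ (by positivity)]
    have e1 : (M : ℝ) ^ 2 = (M : ℝ) ^ (2 - p) * (M : ℝ) ^ (p - (q - p) * d / 2) *
        ((M : ℝ) ^ (q - p)) ^ ((d : ℝ) / 2) := by
      rw [← Real.rpow_mul hM0.le, ← Real.rpow_add hM0, ← Real.rpow_add hM0, ← Real.rpow_natCast]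
      congr 1
      push_cast
      ring
    rw [e1]
    have h1 := mul_lt_mul_of_pos_left hsmall
      (by positivity : 0 < (M : ℝ) ^ (2 - p) * ((M : ℝ) ^ (q - p)) ^ ((d : ℝ) / 2))
    calc _ = (M : ℝ) ^ (2 - p) * ((M : ℝ) ^ (q - p)) ^ ((d : ℝ) / 2) *
          (C₃ * (4 ^ p * ν⁻¹) * energy F (ball x₀ R) U) := by ring
      _ < _ := h1
      _ = _ := by ring
  -- convergence of the difference quotients
  set z : ℝ → V → ℝ := fun h x => ((supConv U e k h x - U x) / h - b x) ⊔ 0 with hz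
  have hlim : Tendsto (fun h => ∫ x in ball x₀ R, (b x + z h x) ^ 2) (𝓝[>] 0)
      (𝓝 (∫ x in ball x₀ R, b x ^ 2)) := by
    refine tendsto_integral_filter_of_dominated_convergence (fun _ => ((G : ℝ) + G) ^ 2) ?_ ?_
      (integrableOn_const measure_ball_lt_top.ne) ?_
    · filter_upwards [self_mem_nhdsWithin] with h hh
      have hh0 : (0 : ℝ) ≤ h := (mem_Ioi.1 hh).le
      have h1 : Measurable (supConv U e k h) := (isLip_supConv ⟨G, hG⟩ hh0).continuous.measurable
      exact ((hbm.add ((((h1.sub hUc.measurable).div_const h).sub hbm).sup_const 0)).pow_const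
        2).aestronglyMeasurable
    · filter_upwards [self_mem_nhdsWithin] with h hh
      have hh0 : 0 < h := mem_Ioi.1 hh
      refine Filter.Eventually.of_forall fun x => ?_
      have h1 : (supConv U e k h x - U x) / h ≤ G := by
        rw [div_le_iff₀ hh0]
        exact supConv_sub_le hUc hh0.le hk0.le he hG.lipschitzOnWith fun s _ => mem_univ _
      have h2 : 0 ≤ z h x := le_sup_right
      have h3 : z h x ≤ G := sup_le (by linarith [hb0 x]) G.coe_nonneg
      rw [Real.norm_of_nonneg (sq_nonneg _)]
      have := hb0 x
      have := hbG x
      gcongr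
    · refine ae_restrict_of_ae ?_
      filter_upwards [hG.ae_differentiableAt] with x hx
      have h1 := tendsto_supConv_excess (k := k) hUc he hx
      have h2 := ((tendsto_const_nhds (x := b x)).add h1).pow 2
      rwa [add_zero] at h2
  filter_upwards [hlim.eventually_lt_const hlt, Ioo_mem_nhdsGT (half_pos (sub_pos.2 hρ))]
    with h hh hhI x hx
  have hh0 : 0 < h := hhI.1
  set w : V → ℝ := fun x => supConv U e k h x - U x with hw
  have hw0 : ∀ x, 0 ≤ w x := fun x => sub_nonneg.2 (le_supConv hUc hh0.le x)
  have hwG : ∀ x, w x ≤ G * h := fun x =>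
    supConv_sub_le hUc hh0.le hk0.le he hG.lipschitzOnWith fun s _ => mem_univ _
  have hwL : IsLip w := (isLip_supConv ⟨G, hG⟩ hh0.le).sub ⟨G, hG⟩
  have hw2 : ∫ x in ball x₀ (R - h), w x ^ 2 ≤ h ^ 2 * target := by
    calc ∫ x in ball x₀ (R - h), w x ^ 2 ≤ ∫ x in ball x₀ R, w x ^ 2 :=
          setIntegral_mono_set ((hwL.continuous.pow 2).integrableOn_ball _ _)
            (Filter.Eventually.of_forall fun x => sq_nonneg _)
            (Filter.Eventually.of_forall (ball_subset_ball (by linarith)))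
      _ ≤ ∫ x in ball x₀ R, h ^ 2 * (b x + z h x) ^ 2 := by
          refine integral_mono_of_nonneg (Filter.Eventually.of_forall fun x => sq_nonneg _) ?_
            (Filter.Eventually.of_forall fun x => ?_)
          · refine (integrableOn_of_bounded (A := ((G : ℝ) + G) ^ 2) ?_ measure_ball_lt_top.ne
              fun x => ?_).const_mul _
            · have h1 : Measurable (supConv U e k h) :=
                (isLip_supConv ⟨G, hG⟩ hh0.le).continuous.measurable
              exact (hbm.add ((((h1.sub hUc.measurable).div_const h).sub hbm).sup_const 0)).pow_const
                2
            · have h1 : (supConv U e k h x - U x) / h ≤ G := by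
                rw [div_le_iff₀ hh0]
                exact hwG x
              have h2 : 0 ≤ z h x := le_sup_right
              have h3 : z h x ≤ G := sup_le (by linarith [hb0 x]) G.coe_nonneg
              rw [abs_of_nonneg (sq_nonneg _)]
              have := hb0 x
              have := hbG x
              gcongr
          · have h1 : w x / h - b x ≤ z h x := le_sup_left
            have h2 : w x ≤ h * (b x + z h x) := by
              rw [← div_le_iff₀' hh0]
              linarith
            change w x ^ 2 ≤ h ^ 2 * (b x + z h x) ^ 2
            rw [← mul_pow]
            exact pow_le_pow_left₀ (hw0 x) h2 2
      _ = h ^ 2 * ∫ x in ball x₀ R, (b x + z h x) ^ 2 := integral_const_mul _ _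
      _ ≤ h ^ 2 * target := by gcongr
  have hfin := hDG w (G * h) (K₁ * (M : ℝ) ^ (q - p)) (R - h) ρ (k * h) x₀ hwL hw0
    (fun x => by rw [abs_of_nonneg (hw0 x)]; exact hwG x) (by positivity)
    (hcac F μ hF U x₀ e R h M ⟨G, hG⟩ hmin he hh0.le hM hUM) (by linarith [hhI.2])
    (by positivity) (by
      have hgap : ((R - ρ) / 2) ^ d ≤ (R - h - ρ) ^ d :=
        pow_le_pow_left₀ (by linarith) (by linarith [hhI.2]) d
      calc C₂ * (K₁ * (M : ℝ) ^ (q - p)) ^ ((d : ℝ) / 2) * ∫ x in ball x₀ (R - h), w x ^ 2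
          ≤ C₂ * (K₁ * (M : ℝ) ^ (q - p)) ^ ((d : ℝ) / 2) * (h ^ 2 * target) := by gcongr
        _ = (k * h) ^ 2 * ((R - ρ) / 2) ^ d := by
            rw [htarget, hC₃, hk, Real.mul_rpow hK₁.le (by positivity), div_pow (R - ρ)]
            field_simp
            ring
        _ ≤ _ := by gcongr) x hx
  have := supConv_sub_lt (e := e) (k := k) hUc hh0.le x hfin
  rw [hk] at this
  linarith

variable (V) in
/-- A Lipschitz constant that is large compared with the energy is halved on a smaller ball. -/
lemma exists_lipschitz_improvement (hn : 2 < Module.finrank ℝ V) (hp : 1 < p) (hpq : p ≤ q)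
    (hν : 0 < ν) (hL : 1 ≤ L) :
    ∃ C : ℝ, 0 < C ∧ ∀ (F : V → ℝ) (μ : ℝ), PQGrowth p q ν L μ F → ∀ (U : V → ℝ) (x₀ : V)
      (r R ρ : ℝ) (M : ℝ≥0), IsLip U → IsLipMin F (ball x₀ r) U → 8 ≤ (M : ℝ) → R ≤ r →
      LipschitzOnWith M U (ball x₀ R) → ρ < R →
      C * energy F (ball x₀ r) U <
        (M : ℝ) ^ (p - (q - p) * (Module.finrank ℝ V : ℝ) / 2) *
          (R - ρ) ^ (Module.finrank ℝ V) →
      LipschitzOnWith (M / 2) U (ball x₀ ρ) := by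
  have hV : 1 < Module.finrank ℝ V := by lia
  obtain ⟨C, hC, h⟩ := exists_eventually_translate_sub_le V hn hp hpq hν hL
  refine ⟨C, hC, fun F μ hF U x₀ r R ρ M hU hmin hM hR hUM hρ hsmall => ?_⟩
  have hFd := hF.differentiable hp hpq hν hL hV
  refine lipschitzOnWith_of_eventually_translate_sub_le (convex_ball x₀ ρ) fun e he => ?_
  have hen : energy F (ball x₀ R) U ≤ energy F (ball x₀ r) U :=
    setIntegral_mono_set (integrableOn_energy hFd.continuous hU measure_ball_lt_top.ne)
      (Filter.Eventually.of_forall fun x => hF.nonneg hp hν hV _)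
      (Filter.Eventually.of_forall (ball_subset_ball hR))
  have := h F μ hF U x₀ e R ρ M hU (hmin.mono hFd.continuous hU measure_ball_lt_top.ne
    measurableSet_ball measurableSet_ball (ball_subset_ball hR)) he hM hUM hρ
    ((mul_le_mul_of_nonneg_left hen hC.le).trans_lt hsmall)
  simpa using this

end Improvement

section Iteration

variable {V : Type*} [NormedAddCommGroup V] [InnerProductSpace ℝ V] [FiniteDimensional ℝ V]
variable [MeasureSpace V] [BorelSpace V] [(volume : Measure V).IsAddHaarMeasure]
variable {p q ν L : ℝ}

variable (V) in
lemma exists_lipschitzOnWith_half_ball (hn : 2 < Module.finrank ℝ V) (hp : 1 < p) (hpq : p ≤ q)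
    (hν : 0 < ν) (hL : 1 ≤ L)
    (hδ : 0 < p - (q - p) * (Module.finrank ℝ V : ℝ) / 2) :
    ∃ C : ℝ, 0 < C ∧ ∀ (F : V → ℝ) (μ : ℝ), PQGrowth p q ν L μ F → ∀ (U : V → ℝ) (x₀ : V)
      (r : ℝ), 0 < r → IsLip U → IsLipMin F (ball x₀ r) U →
      LipschitzOnWith (Real.toNNReal (8 + (C * (energy F (ball x₀ r) U / r ^ (Module.finrank ℝ V))) ^
        (1 / (p - (q - p) * (Module.finrank ℝ V : ℝ) / 2)))) U (ball x₀ (r / 2)) := by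
  obtain ⟨C, hC, himp⟩ := exists_lipschitz_improvement V hn hp hpq hν hL
  set d : ℕ := Module.finrank ℝ V with hd
  have hd0 : (0 : ℝ) < d := by
    have : 0 < d := by lia
    exact_mod_cast this
  set δ : ℝ := p - (q - p) * (d : ℝ) / 2 with hδ_def
  set θ : ℝ := 2 ^ (-δ / d) with hθ
  have hθ0 : 0 < θ := by positivity
  have hθ1 : θ < 1 := Real.rpow_lt_one_of_one_lt_of_neg (by norm_num)
    (div_neg_of_neg_of_pos (by linarith) hd0)
  have hθd : θ ^ d * 2 ^ δ = 1 := by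
    rw [hθ, ← Real.rpow_natCast, ← Real.rpow_mul (by norm_num), ← Real.rpow_add (by norm_num),
      div_mul_cancel₀ _ hd0.ne', neg_add_cancel, Real.rpow_zero]
  have h1θ : 0 < (1 - θ) / 2 := by linarith
  refine ⟨C / ((1 - θ) / 2) ^ d, by positivity, fun F μ hF U x₀ r hr hU hmin => ?_⟩
  set E : ℝ := energy F (ball x₀ r) U with hE
  have hE0 : 0 ≤ E := integral_nonneg fun x => hF.nonneg hp hν (by lia) _
  set X : ℝ := C / ((1 - θ) / 2) ^ d * (E / r ^ d) with hX
  have hX0 : 0 ≤ X := by positivity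
  have hXr : 0 ≤ X ^ (1 / δ) := Real.rpow_nonneg hX0 _
  set T : ℝ≥0 := Real.toNNReal (8 + X ^ (1 / δ)) with hT
  have hTc : (T : ℝ) = 8 + X ^ (1 / δ) := Real.coe_toNNReal _ (by positivity)
  have hT8 : 8 ≤ (T : ℝ) := by rw [hTc]; linarith
  have hT0 : 0 < (T : ℝ) := by linarith
  have hTX : X ≤ (T : ℝ) ^ δ := by
    calc X = (X ^ (1 / δ)) ^ δ := by
          rw [← Real.rpow_mul hX0, one_div_mul_cancel hδ.ne', Real.rpow_one]
      _ ≤ _ := Real.rpow_le_rpow hXr (by rw [hTc]; linarith) hδ.le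
  have hXT : X < (T : ℝ) ^ δ * 2 ^ δ := by
    have h1 : (1 : ℝ) < 2 ^ δ := Real.one_lt_rpow (by norm_num) hδ
    have h2 : 0 < (T : ℝ) ^ δ := by positivity
    nlinarith
  have hdescend : ∀ j : ℕ, LipschitzOnWith (T * 2 ^ j) U (ball x₀ (r / 2 + r / 2 * (1 - θ ^ j))) →
      LipschitzOnWith T U (ball x₀ (r / 2)) := by
    intro j
    induction j with
    | zero => intro h; simpa using h
    | succ j ih =>
      intro h
      refine ih ?_
      have hθj : 0 < θ ^ j := by positivity
      have h2j : (1 : ℝ) ≤ 2 ^ (j + 1) := one_le_pow₀ (by norm_num)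
      have hgap : r / 2 + r / 2 * (1 - θ ^ (j + 1)) - (r / 2 + r / 2 * (1 - θ ^ j)) =
          r * ((1 - θ) / 2) * θ ^ j := by
        rw [pow_succ]
        ring
      have h3 := himp F μ hF U x₀ r (r / 2 + r / 2 * (1 - θ ^ (j + 1)))
        (r / 2 + r / 2 * (1 - θ ^ j)) (T * 2 ^ (j + 1)) hU hmin
        (by push_cast; nlinarith)
        (by have : 0 < r / 2 * θ ^ (j + 1) := by positivity
            linarith)
        h
        (by
          have : 0 < r * ((1 - θ) / 2) * θ ^ j := by positivity
          linarith)
        (by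
          rw [hgap]
          push_cast
          rw [Real.mul_rpow hT0.le (by positivity), mul_pow, mul_pow, ← Real.rpow_natCast 2 (j + 1),
            ← Real.rpow_mul (by norm_num), mul_comm ((j + 1 : ℕ) : ℝ) δ, Real.rpow_mul (by norm_num),
            Real.rpow_natCast, pow_succ, ← pow_mul θ, mul_comm j d, pow_mul]
          have e1 : ((2 : ℝ) ^ δ) ^ j * (θ ^ d) ^ j = 1 := by
            rw [← mul_pow, mul_comm, hθd, one_pow]
          calc C * E = X * (r ^ d * ((1 - θ) / 2) ^ d) := by
                rw [hX]
                field_simp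
            _ < (T : ℝ) ^ δ * 2 ^ δ * (r ^ d * ((1 - θ) / 2) ^ d) :=
                mul_lt_mul_of_pos_right hXT (by positivity)
            _ = _ := by
                linear_combination
                  (-((T : ℝ) ^ δ * 2 ^ δ * (r ^ d * ((1 - θ) / 2) ^ d))) * e1)
      have e2 : T * 2 ^ (j + 1) / 2 = T * 2 ^ j := by
        rw [pow_succ, ← mul_assoc, mul_div_cancel_right₀ _ two_ne_zero]
      rwa [e2] at h3
  obtain ⟨G, hG⟩ := hU
  obtain ⟨j, hj⟩ := pow_unbounded_of_one_lt (G : ℝ) (one_lt_two : (1 : ℝ) < 2)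
  refine hdescend j ((hG.weaken ?_).lipschitzOnWith)
  rw [← NNReal.coe_le_coe]
  push_cast
  have : (0 : ℝ) < 2 ^ j := by positivity
  nlinarith

variable (V) in
/-- The a priori Lipschitz estimate for minimizers that are Lipschitz on the whole space. -/
lemma exists_lipschitzOnWith_average (hn : 2 < Module.finrank ℝ V) (hp : 1 < p) (hpq : p ≤ q)
    (hν : 0 < ν) (hL : 1 ≤ L)
    (hδ : 0 < ((Module.finrank ℝ V : ℝ) + 2) * p - (Module.finrank ℝ V : ℝ) * q) :
    ∃ c : ℝ, 0 < c ∧ ∀ (F : V → ℝ) (μ : ℝ), PQGrowth p q ν L μ F → ∀ (U : V → ℝ) (x₀ : V)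
      (r : ℝ), 0 < r → IsLip U → IsLipMin F (ball x₀ r) U →
      LipschitzOnWith (Real.toNNReal (c * (⨍ x in ball x₀ r, F (gradient U x)) ^
        (2 / (((Module.finrank ℝ V : ℝ) + 2) * p - (Module.finrank ℝ V : ℝ) * q)) + c)) U
        (ball x₀ (r / 2)) := by
  have hδ2 : p - (q - p) * (Module.finrank ℝ V : ℝ) / 2 =
      (((Module.finrank ℝ V : ℝ) + 2) * p - (Module.finrank ℝ V : ℝ) * q) / 2 := by ring
  obtain ⟨C, hC, h⟩ := exists_lipschitzOnWith_half_ball V hn hp hpq hν hL (by rw [hδ2]; linarith)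
  rw [hδ2, one_div_div] at h
  set s : ℝ := 2 / (((Module.finrank ℝ V : ℝ) + 2) * p - (Module.finrank ℝ V : ℝ) * q) with hs
  set ω : ℝ := (volume (ball (0 : V) 1)).toReal with hω
  have hω0 : 0 < ω := ENNReal.toReal_pos (measure_ball_pos _ _ one_pos).ne' measure_ball_lt_top.ne
  refine ⟨8 + (C * ω) ^ s, by positivity, fun F μ hF U x₀ r hr hU hmin => ?_⟩
  refine (h F μ hF U x₀ r hr hU hmin).weaken (Real.toNNReal_le_toNNReal ?_)
  set E : ℝ := energy F (ball x₀ r) U with hE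
  have hE0 : 0 ≤ E := integral_nonneg fun x => hF.nonneg hp hν (by lia) _
  have hvol : volume.real (ball x₀ r) = r ^ (Module.finrank ℝ V) * ω := by
    rw [Measure.real, Measure.addHaar_ball_of_pos _ _ hr, ENNReal.toReal_mul,
      ENNReal.toReal_ofReal (by positivity)]
  have havg : ⨍ x in ball x₀ r, F (gradient U x) = (r ^ (Module.finrank ℝ V) * ω)⁻¹ * E := by
    rw [setAverage_eq, hvol, smul_eq_mul, hE, energy]
  have e1 : C * (E / r ^ (Module.finrank ℝ V)) =
      C * ω * ((r ^ (Module.finrank ℝ V) * ω)⁻¹ * E) := by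
    field_simp
  have h0 : 0 ≤ (r ^ (Module.finrank ℝ V) * ω)⁻¹ * E := by positivity
  rw [havg, e1, Real.mul_rpow (by positivity) h0]
  have h1 : 0 ≤ ((r ^ (Module.finrank ℝ V) * ω)⁻¹ * E) ^ s := Real.rpow_nonneg h0 _
  have h2 : 0 < (C * ω) ^ s := by positivity
  nlinarith

end Iteration

section LocalMinimizers

variable {n : ℕ} {Ω : Set (EuclideanSpace ℝ (Fin n))} {F u U : EuclideanSpace ℝ (Fin n) → ℝ}
variable {x₀ : EuclideanSpace ℝ (Fin n)} {r : ℝ}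

lemma gradient_eqOn_of_eqOn {f g : EuclideanSpace ℝ (Fin n) → ℝ}
    {S : Set (EuclideanSpace ℝ (Fin n))} (hS : IsOpen S) (h : EqOn f g S) :
    EqOn (gradient f) (gradient g) S := fun _ hx =>
  (Filter.eventuallyEq_of_mem (hS.mem_nhds hx) h).gradient_eq

/-- A local minimizer agrees on a ball with a globally Lipschitz minimizer. -/
lemma IsLocMinimizerH.isLipMin (hmin : IsLocMinimizerH Ω F u) (hu : LocLipOn Ω u)
    (hball : closure (ball x₀ r) ⊆ Ω) (hU : IsLip U) (huU : EqOn u U (ball x₀ r)) :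
    IsLipMin F (ball x₀ r) U := by
  intro w hw K hK hKB hwK
  have hne : closure {x | u x + (w x - U x) ≠ u x} ⊆ K := by
    refine closure_minimal (fun x hx => ?_) hK.isClosed
    by_contra h
    exact hx (by rw [hwK x h, sub_self, add_zero])
  have hcl : IsCompact (closure (ball x₀ r)) :=
    (isCompact_closedBall x₀ r).of_isClosed_subset isClosed_closure closure_ball_subset_closedBall
  have h := hmin (ball x₀ r) isOpen_ball hcl hball (fun x => u x + (w x - U x)) (by
    intro S hS hSΩ
    obtain ⟨C, hC⟩ := hu S hS hSΩ
    obtain ⟨D, hD⟩ := hw.sub hU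
    exact ⟨_, hC.add hD.lipschitzOnWith⟩) (hK.of_isClosed_subset isClosed_closure hne)
    (hne.trans hKB)
  have h1 := gradient_eqOn_of_eqOn isOpen_ball huU
  have h2 : EqOn (gradient fun x => u x + (w x - U x)) (gradient w) (ball x₀ r) :=
    gradient_eqOn_of_eqOn isOpen_ball fun x hx => by
      rw [huU hx, add_sub_cancel]
  rw [setIntegral_congr_fun measurableSet_ball fun x hx => congrArg F (h1 hx),
    setIntegral_congr_fun measurableSet_ball fun x hx => congrArg F (h2 hx)] at h
  exact h

end LocalMinimizers

end HelperLemmas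

/-- Homogeneous `(p,q)`-growth Lipschitz estimate under Marcellini's gap
bound `q/p < 1 + 2/n`, recovering Marcellini's classical bound
`‖Du‖_{L^∞(B/2)} ≤ c(⨍_B F(Du))^{2/((n+2)p−nq)} + c`. -/
theorem marcellini_lipschitz_estimate (n : ℕ) (hn : 2 < n) (p q ν L : ℝ)
    (hp : 1 < p) (hpq : p ≤ q) (hν : 0 < ν) (hν1 : ν ≤ 1) (hL : 1 ≤ L)
    (hgap : q / p < 1 + 2 / (n : ℝ)) :
    ∃ c : ℝ, 0 < c ∧
      ∀ (Ω : Set (EuclideanSpace ℝ (Fin n))), IsOpen Ω →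
      ∀ F : EuclideanSpace ℝ (Fin n) → ℝ, ∀ μ : ℝ, μ ∈ Icc (0:ℝ) 1 →
        ConvexOn ℝ univ F → ContDiffOn ℝ 2 F {(0 : EuclideanSpace ℝ (Fin n))}ᶜ →
        (∀ z : EuclideanSpace ℝ (Fin n), z ≠ 0 →
          ν * (‖z‖ ^ 2 + μ ^ 2) ^ (p / 2) ≤ F z ∧
          F z ≤ L * (‖z‖ ^ 2 + μ ^ 2) ^ (q / 2) + L * (‖z‖ ^ 2 + μ ^ 2) ^ (p / 2)) →
        (∀ z : EuclideanSpace ℝ (Fin n), z ≠ 0 →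
          (‖z‖ ^ 2 + μ ^ 2) * ‖fderiv ℝ (fderiv ℝ F) z‖ ≤
            L * (‖z‖ ^ 2 + μ ^ 2) ^ (q / 2) + L * (‖z‖ ^ 2 + μ ^ 2) ^ (p / 2)) →
        (∀ z : EuclideanSpace ℝ (Fin n), z ≠ 0 → ∀ ξ : EuclideanSpace ℝ (Fin n),
          ν * (‖z‖ ^ 2 + μ ^ 2) ^ ((p - 2) / 2) * ‖ξ‖ ^ 2 ≤ fderiv ℝ (fderiv ℝ F) z ξ ξ) →
      ∀ u : EuclideanSpace ℝ (Fin n) → ℝ, LocLipOn Ω u → IsLocMinimizerH Ω F u →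
      ∀ (x₀ : EuclideanSpace ℝ (Fin n)) (r : ℝ), 0 < r → closure (ball x₀ r) ⊆ Ω →
        essSup (fun x => (‖gradient u x‖₊ : ℝ≥0∞)) (volume.restrict (ball x₀ (r / 2))) ≤
          ENNReal.ofReal
            (c * (⨍ x in ball x₀ r, F (gradient u x)) ^
                (2 / (((n : ℝ) + 2) * p - (n : ℝ) * q)) + c) := by
  have hfr : Module.finrank ℝ (EuclideanSpace ℝ (Fin n)) = n := finrank_euclideanSpace_fin
  have hn0 : (0 : ℝ) < n := by
    have : 0 < n := by lia
    exact_mod_cast this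
  have hδ : 0 < ((n : ℝ) + 2) * p - (n : ℝ) * q := by
    rw [div_lt_iff₀ (by linarith)] at hgap
    have h := mul_lt_mul_of_pos_left hgap hn0
    have e : (n : ℝ) * ((1 + 2 / n) * p) = ((n : ℝ) + 2) * p := by field_simp
    linarith
  obtain ⟨c, hc, h⟩ := exists_lipschitzOnWith_average (EuclideanSpace ℝ (Fin n)) (by rwa [hfr]) hp hpq
    hν hL (by rwa [hfr])
  rw [hfr] at h
  refine ⟨c, hc, fun Ω _ F μ hμ hconv hF2 hgrowth hhess hell u hu hmin x₀ r hr hball => ?_⟩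
  have hF : PQGrowth p q ν L μ F := ⟨hμ, hconv, hF2, hgrowth, hhess, hell⟩
  have hcl : IsCompact (closure (ball x₀ r)) :=
    (isCompact_closedBall x₀ r).of_isClosed_subset isClosed_closure closure_ball_subset_closedBall
  obtain ⟨C, hC⟩ := hu _ hcl hball
  obtain ⟨U, hU, huU⟩ := hC.extend_real
  have huB : EqOn u U (ball x₀ r) := huU.mono subset_closure
  have hgrad := gradient_eqOn_of_eqOn isOpen_ball huB
  have hlip := h F μ hF U x₀ r hr ⟨C, hU⟩ (hmin.isLipMin hu hball ⟨C, hU⟩ huB)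
  rw [setAverage_congr_fun measurableSet_ball
    (Filter.Eventually.of_forall fun x hx => congrArg F (hgrad hx))]
  refine essSup_le_of_ae_le _ ?_
  filter_upwards [ae_restrict_mem measurableSet_ball] with x hx
  rw [hgrad (ball_subset_ball (by linarith) hx), ENNReal.ofReal, ENNReal.coe_le_coe,
    ← NNReal.coe_le_coe, coe_nnnorm]
  exact hlip.norm_gradient_le (isOpen_ball.mem_nhds hx)
end
end
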